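/- Let k be an algebraically closed field, let Γ ⊂ ℝ² be a two-dimensional lattice polygon, set N = #(Γ ∩ ℤ²), and let J ⊆ I(Γ) be the ideal of k[X_p : p ∈ Γ ∩ ℤ²] generated by I₂(Γ). Then the dimension of the quotient k-vector space I₃(Γ) / J₃, where J₃ is the space of homogeneous degree-3 elements of J, equals: 0 if #(∂Γ ∩ ℤ²) ≥ 4 or Γ is unimodularly equivalent to Σ; 1 if #(∂Γ ∩ ℤ²) = 3, Γ is not unimodularly equivalent to Σ, and Γ is not hyperelliptic; and N − 3 if #(∂Γ ∩ ℤ²) = 3, Γ is not unimodularly equivalent to Σ, and Γ is hyperelliptic. -/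

import Mathlib

open Pointwise

noncomputable section

def toR (p : ℤ × ℤ) : ℝ × ℝ := ((p.1 : ℝ), (p.2 : ℝ))

def IsLatticePolygon (P : Set (ℝ × ℝ)) : Prop :=
  ∃ S : Finset (ℤ × ℤ), P = convexHull ℝ (toR '' ↑S)

def latticePts (A : Set (ℝ × ℝ)) : Set (ℤ × ℤ) := {p | toR p ∈ A}

def interiorHull (P : Set (ℝ × ℝ)) : Set (ℝ × ℝ) :=
  convexHull ℝ (toR '' latticePts (interior P))

/-- `Γ` is hyperelliptic: `Γ⁽¹⁾` is one-dimensional, i.e. contained in an affine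
line and containing at least two points. -/
def IsHyperelliptic (Γ : Set (ℝ × ℝ)) : Prop :=
  Collinear ℝ (interiorHull Γ) ∧ (interiorHull Γ).Nontrivial

/-- Affine map `x ↦ M x + v` on `ℝ²` induced by `M ∈ Mat₂(ℤ)`, `v ∈ ℤ²`. -/
def unimodMap (M : Matrix (Fin 2) (Fin 2) ℤ) (v : ℤ × ℤ) (x : ℝ × ℝ) : ℝ × ℝ :=
  ((M 0 0 : ℝ) * x.1 + (M 0 1 : ℝ) * x.2 + (v.1 : ℝ),
   (M 1 0 : ℝ) * x.1 + (M 1 1 : ℝ) * x.2 + (v.2 : ℝ))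

def UnimodEquiv (P Q : Set (ℝ × ℝ)) : Prop :=
  ∃ (M : Matrix (Fin 2) (Fin 2) ℤ) (v : ℤ × ℤ), IsUnit M.det ∧ Q = unimodMap M v '' P

/-- The unimodular triangle `Σ = conv{(0,0),(1,0),(0,1)}`. -/
def SigmaTri : Set (ℝ × ℝ) :=
  convexHull ℝ {((0 : ℝ), (0 : ℝ)), ((1 : ℝ), (0 : ℝ)), ((0 : ℝ), (1 : ℝ))}

abbrev LatPt (Γ : Set (ℝ × ℝ)) := {p : ℤ × ℤ // toR p ∈ Γ}

def chi (k : Type*) [Field k] (Γ : Set (ℝ × ℝ)) :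
    MvPolynomial (LatPt Γ) k →ₐ[k] AddMonoidAlgebra k (ℤ × ℤ × ℕ) :=
  MvPolynomial.aeval fun p =>
    AddMonoidAlgebra.single ((p : ℤ × ℤ).1, (p : ℤ × ℤ).2, (1 : ℕ)) (1 : k)

def toricIdeal (k : Type*) [Field k] (Γ : Set (ℝ × ℝ)) :
    Ideal (MvPolynomial (LatPt Γ) k) := RingHom.ker (chi k Γ)

def toricIdealDeg (k : Type*) [Field k] (Γ : Set (ℝ × ℝ)) (d : ℕ) :
    Submodule k (MvPolynomial (LatPt Γ) k) :=
  Submodule.restrictScalars k (toricIdeal k Γ) ⊓ MvPolynomial.homogeneousSubmodule (LatPt Γ) k d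

/-- The ideal `J ⊆ I(Γ)` generated by the quadrics `I₂(Γ)`. -/
def quadIdeal (k : Type*) [Field k] (Γ : Set (ℝ × ℝ)) :
    Ideal (MvPolynomial (LatPt Γ) k) :=
  Ideal.span (toricIdealDeg k Γ 2 : Set (MvPolynomial (LatPt Γ) k))

/-- The degree-3 homogeneous part `J₃` of `J`, as a `k`-subspace. -/
def quadIdealDeg3 (k : Type*) [Field k] (Γ : Set (ℝ × ℝ)) :
    Submodule k (MvPolynomial (LatPt Γ) k) :=
  Submodule.restrictScalars k (quadIdeal k Γ) ⊓ MvPolynomial.homogeneousSubmodule (LatPt Γ) k 3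

/-- `dim_k (I₃(Γ) / J₃)`. -/
def cubicDefect (k : Type*) [Field k] (Γ : Set (ℝ × ℝ)) : ℕ :=
  Module.finrank k
    (↥(toricIdealDeg k Γ 3) ⧸
      Submodule.comap (toricIdealDeg k Γ 3).subtype (quadIdealDeg3 k Γ))

/-- Twice the signed area of the triangle `abc`. -/
def dt (a b c : ℤ × ℤ) : ℤ := (b.1 - a.1) * (c.2 - a.2) - (b.2 - a.2) * (c.1 - a.1)

/-- The lattice point `p` lies in the convex hull of `a`, `b`, `c`. -/
def InTri (a b c p : ℤ × ℤ) : Prop :=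
  ∃ α β γ : ℤ, 0 ≤ α ∧ 0 ≤ β ∧ 0 ≤ γ ∧ 0 < α + β + γ ∧
    (α + β + γ) * p.1 = α * a.1 + β * b.1 + γ * c.1 ∧
    (α + β + γ) * p.2 = α * a.2 + β * b.2 + γ * c.2

theorem dt_rot (a b c : ℤ × ℤ) : dt b c a = dt a b c := by
  simp only [dt]; ring

theorem dt_swap (a b c : ℤ × ℤ) : dt a c b = -dt a b c := by
  simp only [dt]; ring

theorem dt_add (a b c p : ℤ × ℤ) : dt b c p + dt c a p + dt a b p = dt a b c := by
  simp only [dt]; ring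

theorem dt_self_left (a b : ℤ × ℤ) : dt a b a = 0 := by simp only [dt]; ring

theorem dt_self_right (a b : ℤ × ℤ) : dt a b b = 0 := by simp only [dt]; ring

namespace InTri

variable {a b c p q r z : ℤ × ℤ}

theorem left : InTri a b c a := ⟨1, 0, 0, by norm_num, by norm_num, by norm_num, by norm_num,
  by ring, by ring⟩

theorem rot (h : InTri a b c p) : InTri b c a p := by
  obtain ⟨α, β, γ, h1, h2, h3, h4, h5, h6⟩ := h
  exact ⟨β, γ, α, h2, h3, h1, by linarith, by linear_combination h5, by linear_combination h6⟩

theorem swap (h : InTri a b c p) : InTri a c b p := by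
  obtain ⟨α, β, γ, h1, h2, h3, h4, h5, h6⟩ := h
  exact ⟨α, γ, β, h1, h3, h2, by linarith, by linear_combination h5, by linear_combination h6⟩

theorem mid : InTri a b c b := (left (a := b) (b := c) (c := a)).rot.rot

theorem right : InTri a b c c := (left (a := c) (b := a) (c := b)).rot

theorem dt_mul (α β γ : ℤ) (h5 : (α + β + γ) * p.1 = α * a.1 + β * b.1 + γ * c.1)
    (h6 : (α + β + γ) * p.2 = α * a.2 + β * b.2 + γ * c.2) (u v : ℤ × ℤ) :
    (α + β + γ) * dt u v p = α * dt u v a + β * dt u v b + γ * dt u v c := by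
  simp only [dt]
  linear_combination (v.1 - u.1) * h6 - (v.2 - u.2) * h5

/-- An affine functional that is nonnegative on the vertices is nonnegative on the triangle. -/
theorem dt_nonneg (h : InTri a b c p) {u v : ℤ × ℤ} (ha : 0 ≤ dt u v a) (hb : 0 ≤ dt u v b)
    (hc : 0 ≤ dt u v c) : 0 ≤ dt u v p := by
  obtain ⟨α, β, γ, h1, h2, h3, h4, h5, h6⟩ := h
  have := dt_mul α β γ h5 h6 u v
  have h7 : 0 ≤ (α + β + γ) * dt u v p := by rw [this]; positivity
  exact nonneg_of_mul_nonneg_right h7 h4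

theorem iff_dt (hD : 0 < dt a b c) :
    InTri a b c p ↔ 0 ≤ dt b c p ∧ 0 ≤ dt c a p ∧ 0 ≤ dt a b p := by
  constructor
  · intro h
    refine ⟨h.dt_nonneg ?_ ?_ ?_, h.dt_nonneg ?_ ?_ ?_, h.dt_nonneg ?_ ?_ ?_⟩ <;>
    simp only [dt] at * <;> nlinarith
  · rintro ⟨h1, h2, h3⟩
    refine ⟨_, _, _, h1, h2, h3, by rw [dt_add]; exact hD, ?_, ?_⟩ <;> simp only [dt] <;> ring

theorem comp (hp : InTri a b c p) (hq : InTri a b c q) (hr : InTri a b c r)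
    (hz : InTri p q r z) : InTri a b c z := by
  obtain ⟨α, β, γ, h1, h2, h3, h4, h5, h6⟩ := hp
  obtain ⟨α', β', γ', h1', h2', h3', h4', h5', h6'⟩ := hq
  obtain ⟨α'', β'', γ'', h1'', h2'', h3'', h4'', h5'', h6''⟩ := hr
  obtain ⟨l, m, n, g1, g2, g3, g4, g5, g6⟩ := hz
  set s := α + β + γ with hs
  set s' := α' + β' + γ' with hs'
  set s'' := α'' + β'' + γ'' with hs''
  have key : (l * s' * s'' * α + m * s * s'' * α' + n * s * s' * α'') +
      (l * s' * s'' * β + m * s * s'' * β' + n * s * s' * β'') +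
      (l * s' * s'' * γ + m * s * s'' * γ' + n * s * s' * γ'') = s * s' * s'' * (l + m + n) := by
    linear_combination (-l * s' * s'') * hs - m * s * s'' * hs' - n * s * s' * hs''
  refine ⟨l * s' * s'' * α + m * s * s'' * α' + n * s * s' * α'',
    l * s' * s'' * β + m * s * s'' * β' + n * s * s' * β'',
    l * s' * s'' * γ + m * s * s'' * γ' + n * s * s' * γ'', by positivity, by positivity,
    by positivity, ?_, ?_, ?_⟩
  · rw [key]; positivity
  · rw [key]
    linear_combination s * s' * s'' * g5 + l * s' * s'' * h5 + m * s * s'' * h5' + n * s * s' * h5''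
  · rw [key]
    linear_combination s * s' * s'' * g6 + l * s' * s'' * h6 + m * s * s'' * h6' + n * s * s' * h6''

end InTri

/-- Sets of lattice points closed under taking lattice points of triangles. -/
def LConv (A : Set (ℤ × ℤ)) : Prop :=
  ∀ ⦃a b c p⦄, a ∈ A → b ∈ A → c ∈ A → InTri a b c p → p ∈ A

/-- A triangle of normalized area at least two has a lattice point besides its vertices. -/
theorem exists_inTri_of_two_le {a b c : ℤ × ℤ} (hD : 2 ≤ dt a b c) :
    ∃ p, InTri a b c p ∧ p ≠ a ∧ p ≠ b ∧ p ≠ c := by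
  set D := dt a b c with hDd
  have hD0 : 0 < D := by linarith
  obtain ⟨q, s, t, hq1, hq2, hst⟩ : ∃ (q : ℤ × ℤ) (s t : ℤ),
      D * q.1 = s * (b.1 - a.1) + t * (c.1 - a.1) ∧
      D * q.2 = s * (b.2 - a.2) + t * (c.2 - a.2) ∧ ¬ (D ∣ s ∧ D ∣ t) := by
    by_contra! hcon
    obtain ⟨h1, h2⟩ := hcon (1, 0) (c.2 - a.2) (-(b.2 - a.2))
      (by simp only [hDd, dt]; ring) (by simp only []; ring)
    obtain ⟨h3, h4⟩ := hcon (0, 1) (-(c.1 - a.1)) (b.1 - a.1)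
      (by simp only []; ring) (by simp only [hDd, dt]; ring)
    obtain ⟨x, hx⟩ := h1
    obtain ⟨y, hy⟩ := h2
    obtain ⟨z, hz⟩ := h3
    obtain ⟨w, hw⟩ := h4
    have : D = D * D * (x * w - y * z) := by
      have : D = (b.1 - a.1) * (c.2 - a.2) - -(b.2 - a.2) * -(c.1 - a.1) := by
        simp only [hDd, dt]; ring
      rw [hx, hy, hz, hw] at this
      linear_combination this
    have h1 : D * (D * (x * w - y * z) - 1) = 0 := by linear_combination -this
    rcases mul_eq_zero.1 h1 with h | h
    · omega
    · have : D ∣ 1 := ⟨x * w - y * z, by linarith⟩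
      have := Int.le_of_dvd one_pos this
      omega
  have hs0 := Int.emod_nonneg s hD0.ne'
  have hs1 := Int.emod_lt_of_pos s hD0
  have ht0 := Int.emod_nonneg t hD0.ne'
  have ht1 := Int.emod_lt_of_pos t hD0
  have hse := Int.emod_add_mul_ediv s D
  have hte := Int.emod_add_mul_ediv t D
  have hne : s % D ≠ 0 ∨ t % D ≠ 0 := by
    by_contra! h
    exact hst ⟨Int.dvd_of_emod_eq_zero h.1, Int.dvd_of_emod_eq_zero h.2⟩
  generalize s % D = s' at *
  generalize t % D = t' at *
  generalize s / D = i at *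
  generalize t / D = j at *
  have main : ∀ p : ℤ × ℤ, ∀ σ τ : ℤ, D * (p.1 - a.1) = σ * (b.1 - a.1) + τ * (c.1 - a.1) →
      D * (p.2 - a.2) = σ * (b.2 - a.2) + τ * (c.2 - a.2) → 0 ≤ σ → 0 ≤ τ → σ + τ ≤ D →
      (σ ≠ 0 ∨ τ ≠ 0) → σ < D → τ < D → ∃ p, InTri a b c p ∧ p ≠ a ∧ p ≠ b ∧ p ≠ c := by
    intro p σ τ h1 h2 h3 h4 h5 h6 h7 h8
    have e1 : dt a b p = τ := by
      apply mul_left_cancel₀ hD0.ne'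
      simp only [dt] at *
      linear_combination (b.1 - a.1) * h2 - (b.2 - a.2) * h1 - τ * hDd
    have e2 : dt c a p = σ := by
      apply mul_left_cancel₀ hD0.ne'
      simp only [dt] at *
      linear_combination (a.1 - c.1) * h2 - (a.2 - c.2) * h1 - σ * hDd
    have e3 : dt b c p = D - σ - τ := by linarith [dt_add a b c p]
    refine ⟨p, (InTri.iff_dt hD0).2 ⟨by omega, by omega, by omega⟩, ?_, ?_, ?_⟩
    · rintro rfl
      rw [dt_self_left] at e1
      rw [dt_self_right] at e2
      omega
    · rintro rfl
      rw [dt_self_left] at e3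
      rw [dt_self_right] at e1
      omega
    · rintro rfl
      rw [dt_self_right] at e3
      rw [dt_self_left] at e2
      omega
  by_cases hsum : s' + t' ≤ D
  · exact main (a.1 + (q.1 - i * (b.1 - a.1) - j * (c.1 - a.1)),
      a.2 + (q.2 - i * (b.2 - a.2) - j * (c.2 - a.2))) s' t'
      (by simp only []; linear_combination hq1 - (b.1 - a.1) * hse - (c.1 - a.1) * hte)
      (by simp only []; linear_combination hq2 - (b.2 - a.2) * hse - (c.2 - a.2) * hte)
      hs0 ht0 hsum hne hs1 ht1
  · exact main (b.1 + c.1 - a.1 - (q.1 - i * (b.1 - a.1) - j * (c.1 - a.1)),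
      b.2 + c.2 - a.2 - (q.2 - i * (b.2 - a.2) - j * (c.2 - a.2))) (D - s') (D - t')
      (by simp only []; linear_combination -hq1 + (b.1 - a.1) * hse + (c.1 - a.1) * hte)
      (by simp only []; linear_combination -hq2 + (b.2 - a.2) * hse + (c.2 - a.2) * hte)
      (by omega) (by omega) (by omega) (by omega) (by omega) (by omega)

/-- The functional `dt a b`, evaluated at the midpoint of the pair with sum `m` and doubled. -/
def dtTwo (a b m : ℤ × ℤ) : ℤ :=
  (b.1 - a.1) * (m.2 - 2 * a.2) - (b.2 - a.2) * (m.1 - 2 * a.1)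

theorem dtTwo_add (a b p q : ℤ × ℤ) : dtTwo a b (p + q) = dt a b p + dt a b q := by
  simp only [dtTwo, dt, Prod.fst_add, Prod.snd_add]; ring

/-- Lattice triangles are normal: a lattice point of the dilate by two is a sum of two lattice
points of the triangle. -/
theorem exists_add_eq_of_dtTwo (n : ℕ) (a b c m : ℤ × ℤ) (hn : dt a b c = n)
    (hD : 0 < dt a b c) (hα : 0 ≤ dtTwo b c m) (hβ : 0 ≤ dtTwo c a m) (hγ : 0 ≤ dtTwo a b m) :
    ∃ x y, InTri a b c x ∧ InTri a b c y ∧ x + y = m := by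
  induction n using Nat.strong_induction_on generalizing a b c with
  | _ n ih =>
  by_cases hE : ∃ e, InTri a b c e ∧ e ≠ a ∧ e ≠ b ∧ e ≠ c
  · obtain ⟨e, he, hea, heb, hec⟩ := hE
    -- replace the first vertex by `e`
    have sub : ∀ (a b c : ℤ × ℤ), dt a b c = n → 0 < dt a b c → 0 ≤ dtTwo b c m → InTri a b c e →
        e ≠ a → 0 < dt b c e → 0 ≤ dtTwo c a m * dt b c e - dtTwo b c m * dt c a e →
        0 ≤ dtTwo a b m * dt b c e - dtTwo b c m * dt a b e →
        ∃ x y, InTri a b c x ∧ InTri a b c y ∧ x + y = m := by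
      intro a b c hn hD hα he hea hpos g1 g2
      have hb := (InTri.iff_dt hD).1 he
      have hadd := dt_add a b c e
      have hlt : dt b c e < dt a b c := by
        by_contra hge
        have z1 : dt c a e = 0 := by omega
        have z2 : dt a b e = 0 := by omega
        apply hea
        have w1 : dt a b c * (e.1 - a.1) = 0 := by
          simp only [dt] at *
          linear_combination (b.1 - a.1) * z1 + (c.1 - a.1) * z2
        have w2 : dt a b c * (e.2 - a.2) = 0 := by
          simp only [dt] at *
          linear_combination (b.2 - a.2) * z1 + (c.2 - a.2) * z2
        have w1' := (mul_eq_zero.1 w1).resolve_left hD.ne'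
        have w2' := (mul_eq_zero.1 w2).resolve_left hD.ne'
        exact Prod.ext (by linarith) (by linarith)
      have e0 : dt e b c = dt b c e := (dt_rot _ _ _).symm
      have e1 : dt a b c * dtTwo c e m = dtTwo c a m * dt b c e - dtTwo b c m * dt c a e := by
        simp only [dt, dtTwo]; ring
      have e2 : dt a b c * dtTwo e b m = dtTwo a b m * dt b c e - dtTwo b c m * dt a b e := by
        simp only [dt, dtTwo]; ring
      obtain ⟨x, y, hx, hy, hxy⟩ := ih (dt e b c).toNat (by omega) e b c (by omega) (by omega) hα
        (nonneg_of_mul_nonneg_right (e1 ▸ g1) hD) (nonneg_of_mul_nonneg_right (e2 ▸ g2) hD)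
      exact ⟨x, y, he.comp .mid .right hx, he.comp .mid .right hy, hxy⟩
    have hb := (InTri.iff_dt hD).1 he
    have hadd := dt_add a b c e
    have hr1 := dt_rot a b c
    have hr2 := dt_rot b c a
    have subb := sub b c a (by omega) (by omega) hβ he.rot heb
    have subc := sub c a b (by omega) (by omega) hγ he.rot.rot hec
    have suba := sub a b c hn hD hα he hea
    have rotb : (∃ x y, InTri b c a x ∧ InTri b c a y ∧ x + y = m) →
        ∃ x y, InTri a b c x ∧ InTri a b c y ∧ x + y = m :=
      fun ⟨x, y, hx, hy, h⟩ => ⟨x, y, hx.rot.rot, hy.rot.rot, h⟩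
    have rotc : (∃ x y, InTri c a b x ∧ InTri c a b y ∧ x + y = m) →
        ∃ x y, InTri a b c x ∧ InTri a b c y ∧ x + y = m :=
      fun ⟨x, y, hx, hy, h⟩ => ⟨x, y, hx.rot, hy.rot, h⟩
    generalize dtTwo b c m = α' at *
    generalize dtTwo c a m = β' at *
    generalize dtTwo a b m = γ' at *
    generalize dt b c e = α at *
    generalize dt c a e = β at *
    generalize dt a b e = γ at *
    obtain ⟨p1, p2, p3⟩ := hb
    -- choose the vertex with the smallest ratio of coordinates
    rcases p1.eq_or_lt with p1 | p1 <;> rcases p2.eq_or_lt with p2 | p2 <;>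
      rcases p3.eq_or_lt with p3 | p3
    · omega
    · exact rotc (subc p3 (by rw [← p1]; simp; positivity) (by rw [← p2]; simp; positivity))
    · exact rotb (subb p2 (by rw [← p3]; simp; positivity) (by rw [← p1]; simp; positivity))
    · rcases le_total (β' * γ) (γ' * β) with h | h
      · exact rotb (subb p2 (by linarith) (by rw [← p1]; simp; positivity))
      · exact rotc (subc p3 (by rw [← p1]; simp; positivity) (by linarith))
    · exact suba p1 (by rw [← p2]; simp; positivity) (by rw [← p3]; simp; positivity)
    · rcases le_total (α' * γ) (γ' * α) with h | h
      · exact suba p1 (by rw [← p2]; simp; positivity) (by linarith)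
      · exact rotc (subc p3 (by linarith) (by rw [← p2]; simp; positivity))
    · rcases le_total (α' * β) (β' * α) with h | h
      · exact suba p1 (by linarith) (by rw [← p3]; simp; positivity)
      · exact rotb (subb p2 (by rw [← p3]; simp; positivity) (by linarith))
    · have tr : ∀ x y z x' y' z' : ℤ, 0 < x → 0 < y → 0 < z → x' * y ≤ y' * x → y' * z ≤ z' * y →
          x' * z ≤ z' * x := by
        intro x y z x' y' z' hx hy hz h1 h2
        refine le_of_mul_le_mul_left (a := y) ?_ hy
        nlinarith
      rcases le_total (α' * β) (β' * α) with h | h <;> rcases le_total (β' * γ) (γ' * β) with h' | h'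
        <;> rcases le_total (α' * γ) (γ' * α) with h'' | h''
      · exact suba p1 (by linarith) (by linarith)
      · exact suba p1 (by linarith) (by linarith [tr _ _ _ _ _ _ p1 p2 p3 h h'])
      · exact suba p1 (by linarith) (by linarith)
      · exact rotc (subc p3 (by linarith) (by linarith))
      · exact rotb (subb p2 (by linarith) (by linarith))
      · exact rotb (subb p2 (by linarith) (by linarith))
      · exact rotc (subc p3 (by linarith [tr _ _ _ _ _ _ p3 p2 p1 h' h]) (by linarith))
      · exact rotc (subc p3 (by linarith) (by linarith))
  · have h1 : dt a b c = 1 := by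
      by_contra hne
      exact hE (exists_inTri_of_two_le (by omega))
    have hsum : dtTwo b c m + dtTwo c a m + dtTwo a b m = 2 := by
      rw [← mul_one 2, ← h1]; simp only [dt, dtTwo]; ring
    have m1 : m.1 = dtTwo b c m * a.1 + dtTwo c a m * b.1 + dtTwo a b m * c.1 := by
      rw [← one_mul m.1, ← h1]; simp only [dt, dtTwo]; ring
    have m2 : m.2 = dtTwo b c m * a.2 + dtTwo c a m * b.2 + dtTwo a b m * c.2 := by
      rw [← one_mul m.2, ← h1]; simp only [dt, dtTwo]; ring
    generalize dtTwo b c m = α at *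
    generalize dtTwo c a m = β at *
    generalize dtTwo a b m = γ at *
    have fin : ∀ x y, InTri a b c x → InTri a b c y → m.1 = x.1 + y.1 → m.2 = x.2 + y.2 →
        ∃ x y, InTri a b c x ∧ InTri a b c y ∧ x + y = m :=
      fun x y hx hy e1 e2 => ⟨x, y, hx, hy, Prod.ext (by simp [e1]) (by simp [e2])⟩
    have hle : α ≤ 2 ∧ β ≤ 2 := by omega
    have hγ' : γ = 2 - α - β := by omega
    subst hγ'
    obtain ⟨l1, l2⟩ := hle
    interval_cases α <;> interval_cases β <;> try omega
    · exact fin c c .right .right (by linarith) (by linarith)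
    · exact fin b c .mid .right (by linarith) (by linarith)
    · exact fin b b .mid .mid (by linarith) (by linarith)
    · exact fin a c .left .right (by linarith) (by linarith)
    · exact fin a b .left .mid (by linarith) (by linarith)
    · exact fin a a .left .left (by linarith) (by linarith)

/-- Every lattice point of a lattice triangle belongs to a triple of lattice points of the triangle
with the same sum as the vertices. -/
theorem InTri.exists_add_eq {a b c e : ℤ × ℤ} (hD : 0 < dt a b c) (he : InTri a b c e) :
    ∃ x y, InTri a b c x ∧ InTri a b c y ∧ e + x + y = a + b + c := by
  have hb := (InTri.iff_dt hD).1 he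
  have hadd := dt_add a b c e
  have key : ∀ u v, dtTwo u v (a + b + c - e) = dt u v a + dt u v b + dt u v c - dt u v e := by
    intro u v
    simp only [dtTwo, dt, Prod.fst_add, Prod.snd_add, Prod.fst_sub, Prod.snd_sub]; ring
  obtain ⟨x, y, hx, hy, hxy⟩ := exists_add_eq_of_dtTwo (dt a b c).toNat a b c (a + b + c - e)
    (by omega) hD
    (by rw [key, dt_self_left, dt_self_right, dt_rot]; omega)
    (by rw [key, dt_self_left, dt_self_right, dt_rot, dt_rot]; omega)
    (by rw [key, dt_self_left, dt_self_right]; omega)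
  exact ⟨x, y, hx, hy, by rw [add_assoc, hxy]; abel⟩

theorem LConv.eq_of_cap {B : Set (ℤ × ℤ)} (hB : LConv B) {x h j p q : ℤ}
    (h1 : (1, 0) ∈ B) (hc : (x, h) ∈ B) (hx : 2 ≤ x)
    (hj : (j, -1) ∈ B) (hj1 : 1 ≤ j) (hpq : (x - 1) * q - h * (p - 1) = 1)
    (hp : 1 ≤ p) (hpx : p ≤ x) (hq : 1 ≤ q) (hqh : q ≤ h) (hd : (1 + x - p, h - q) ∉ B) :
    x = 2 ∧ j = 1 ∧ q = 1 := by
  have key : (j - 1) * q + p ≤ 1 := by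
    by_contra! hlt
    refine hd (hB h1 hj hc ⟨(j - 1) * q + p - 2, 1, (j - 1) * (h - q) + (x - p), by linarith,
      by norm_num, add_nonneg (mul_nonneg (by linarith) (by linarith)) (by linarith),
      ?_, ?_, ?_⟩)
    · nlinarith
    · simp only []; linear_combination (j - 1) * hpq
    · simp only []; linear_combination -hpq
  have hj' : j = 1 := by
    by_contra hne
    have : 1 ≤ j - 1 := by omega
    nlinarith
  subst hj'
  have hp' : p = 1 := by linarith
  subst hp'
  have : (x - 1) * q = 1 := by linarith
  have := Int.eq_one_or_neg_one_of_mul_eq_one this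
  have hx2 : x = 2 := by omega
  subst hx2
  exact ⟨rfl, rfl, by linarith⟩

theorem LConv.hyperelliptic_shape {B : Set (ℤ × ℤ)} (hB : LConv B) {g : ℤ} (hg : 1 ≤ g)
    (h0 : (0, 0) ∈ B) (h1 : (1, 0) ∈ B) (hc : (2, 2 * g + 1) ∈ B) (hd : (1, -1) ∈ B)
    (n1 : (0, -1) ∉ B) (n2 : (1, g + 1) ∉ B) (n3 : (2, 2 * g) ∉ B) (P : ℤ × ℤ) (hP : P ∈ B) :
    P = (0, 0) ∨ P = (2, 2 * g + 1) ∨ P.1 = 1 ∧ P.2 ≤ g := by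
  obtain ⟨x, k⟩ := P
  rcases lt_trichotomy x 1 with hx | hx | hx
  · rcases lt_or_ge k 0 with hk | hk
    · exact absurd (hB hP hd h0 ⟨1, -x, -k - 1, by norm_num, by omega,
        by omega, by omega, by simp only []; ring, by simp only []; ring⟩) n1
    · by_cases hne : x = 0 ∧ k = 0
      · left; rw [hne.1, hne.2]
      · have hw : 0 ≤ k - 1 - g * x := by
          rcases eq_or_ne x 0 with rfl | hx0
          · simp at hne ⊢; omega
          · have : x ≤ -1 := by omega
            nlinarith
        refine absurd (hB hP hc h1 ⟨g + 1, (g + 1) * (1 - x), k - 1 - g * x, by omega, ?_,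
          hw, ?_, by simp only []; ring, by simp only []; ring⟩) n2
        · exact mul_nonneg (by omega) (by omega)
        · have : 0 ≤ (g + 1) * (1 - x) := mul_nonneg (by omega) (by omega)
          omega
  · right; right
    subst hx
    refine ⟨rfl, ?_⟩
    by_contra! hlt
    simp only [] at hlt
    refine n2 (hB h1 h1 hP ⟨k - (g + 1), 0, g + 1, by omega, by omega, by omega, by omega, ?_, ?_⟩)
      <;> simp only [] <;> ring
  · set k' := k + (2 * g + 1) * (1 - x) with hk'
    rcases lt_or_ge k' 0 with hk | hk
    · exact absurd (hB hP hd hc ⟨1, x - 2, -k' - 1, by norm_num, by omega,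
        by omega, by omega, by simp only [hk']; ring, by simp only [hk']; ring⟩) n3
    · by_cases hne : x = 2 ∧ k = 2 * g + 1
      · right; left; rw [hne.1, hne.2]
      · have hw : 0 ≤ k' - 1 - g * (2 - x) := by
          rcases eq_or_ne x 2 with rfl | hx0
          · simp at hne ⊢; omega
          · have : 2 - x ≤ -1 := by omega
            nlinarith
        refine absurd (hB hP h0 h1 ⟨g + 1, (g + 1) * (x - 1), k' - 1 - g * (2 - x), by omega, ?_,
          hw, ?_, by simp only [hk']; ring, by simp only [hk']; ring⟩) n2
        · exact mul_nonneg (by omega) (by omega)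
        · have : 0 ≤ (g + 1) * (x - 1) := mul_nonneg (by omega) (by omega)
          omega

/-- The affine map with origin `o` and linear part given by the columns `u`, `w`. -/
def frame (o u w p : ℤ × ℤ) : ℤ × ℤ :=
  (o.1 + p.1 * u.1 + p.2 * w.1, o.2 + p.1 * u.2 + p.2 * w.2)

/-- The determinant of two integer vectors. -/
def cross (u w : ℤ × ℤ) : ℤ := u.1 * w.2 - u.2 * w.1

theorem InTri.map_frame {p q r z : ℤ × ℤ} (h : InTri p q r z) (o u w : ℤ × ℤ) :
    InTri (frame o u w p) (frame o u w q) (frame o u w r) (frame o u w z) := by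
  obtain ⟨α, β, γ, h1, h2, h3, h4, h5, h6⟩ := h
  refine ⟨α, β, γ, h1, h2, h3, h4, ?_, ?_⟩ <;> simp only [frame]
  · linear_combination u.1 * h5 + w.1 * h6
  · linear_combination u.2 * h5 + w.2 * h6

theorem LConv.comap_frame {A : Set (ℤ × ℤ)} (hA : LConv A) (o u w : ℤ × ℤ) :
    LConv {p | frame o u w p ∈ A} :=
  fun _ _ _ _ ha hb hc h => hA ha hb hc (h.map_frame o u w)

theorem dt_frame (o u w p q r : ℤ × ℤ) :
    dt (frame o u w p) (frame o u w q) (frame o u w r) = cross u w * dt p q r := by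
  simp only [dt, frame, cross]; ring

theorem exists_frame_eq {u w : ℤ × ℤ} (h : cross u w = 1 ∨ cross u w = -1) (o p : ℤ × ℤ) :
    ∃ q, frame o u w q = p := by
  refine ⟨(cross u w * cross (p - o) w, cross u w * cross u (p - o)), ?_⟩
  have h2 : cross u w * cross u w = 1 := by rcases h with h | h <;> rw [h] <;> norm_num
  have e1 : cross (p - o) w * u.1 + cross u (p - o) * w.1 = cross u w * (p.1 - o.1) := by
    simp only [cross, Prod.fst_sub, Prod.snd_sub]; ring
  have e2 : cross (p - o) w * u.2 + cross u (p - o) * w.2 = cross u w * (p.2 - o.2) := by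
    simp only [cross, Prod.fst_sub, Prod.snd_sub]; ring
  refine Prod.ext ?_ ?_ <;> simp only [frame]
  · linear_combination (cross u w) * e1 + (p.1 - o.1) * h2
  · linear_combination (cross u w) * e2 + (p.2 - o.2) * h2

/-- `e` is an interior point of the triangle `abc` at lattice distance one from the edge `ab`. -/
def Cap (a b c e : ℤ × ℤ) : Prop := dt a b e = 1 ∧ 0 < dt b c e ∧ 0 < dt c a e

/-- The set `A` is contained in a strip around the lattice line through `b`, and has exactly two
points `a`, `c` off that line. -/
def HypShape (A : Set (ℤ × ℤ)) (a b c : ℤ × ℤ) : Prop :=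
  ∃ (w : ℤ × ℤ) (g : ℤ), 1 ≤ g ∧ (cross (b - a) w = 1 ∨ cross (b - a) w = -1) ∧
    c = frame a (b - a) w (2, 2 * g + 1) ∧ frame a (b - a) w (1, -1) ∈ A ∧
    ∀ P ∈ A, P = a ∨ P = c ∨ ∃ k ≤ g, P = frame a (b - a) w (1, k)

theorem LConv.shape_of_pos {B : Set (ℤ × ℤ)} (hB : LConv B) {x h j p q p' q' : ℤ}
    (h0 : (0, 0) ∈ B) (h1 : (1, 0) ∈ B) (hc : (x, h) ∈ B)
    (ec : Cap (0, 0) (1, 0) (x, h) (1, 1)) (ea : Cap (1, 0) (x, h) (0, 0) (p, q))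
    (eb : Cap (x, h) (0, 0) (1, 0) (p', q')) (dc : (0, -1) ∉ B)
    (da : (1 + x - p, h - q) ∉ B) (db : (x - p', h - q') ∉ B) (hj : (j, -1) ∈ B) (hj1 : 1 ≤ j) :
    ∃ g, 1 ≤ g ∧ x = 2 ∧ h = 2 * g + 1 ∧ (1, -1) ∈ B ∧
      ∀ P ∈ B, P = (0, 0) ∨ P = (2, 2 * g + 1) ∨ P.1 = 1 ∧ P.2 ≤ g := by
  simp only [Cap, dt] at ec ea eb
  ring_nf at ec ea eb
  obtain ⟨-, c1, c2⟩ := ec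
  obtain ⟨a0, a1, a2⟩ := ea
  obtain ⟨b0, b1, b2⟩ := eb
  have hp : 1 ≤ p := by nlinarith
  have hqh : q ≤ h := by nlinarith
  obtain ⟨rfl, rfl, rfl⟩ := hB.eq_of_cap h1 hc (by omega) hj hj1 (by linarith) hp (by nlinarith)
    (by omega) hqh da
  have hp1 : p = 1 := by
    have : h * (p - 1) = 0 := by linarith
    rcases mul_eq_zero.1 this with h | h <;> omega
  subst hp1
  have hp' : p' = 1 := by
    have h1 : 0 < p' := by nlinarith
    have h2 : p' < 2 := by nlinarith
    omega
  subst hp'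
  obtain ⟨g, rfl⟩ : ∃ g, h = 2 * g + 1 := ⟨q', by linarith⟩
  have hq' : q' = g := by linarith
  subst hq'
  refine ⟨q', by omega, rfl, rfl, hj, hB.hyperelliptic_shape (by omega) h0 h1 hc hj dc ?_ ?_⟩
  · convert db using 3 <;> omega
  · convert da using 3 <;> omega

theorem exists_neg_one {B : Set (ℤ × ℤ)} (hB : LConv B) (h0 : (0, 0) ∈ B) (h1 : (1, 0) ∈ B)
    {P : ℤ × ℤ} (hP : P ∈ B) (hneg : P.2 < 0) : ∃ j, (j, -1) ∈ B := by
  obtain ⟨x, y⟩ := P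
  simp only [] at hneg
  have e1 := Int.emod_nonneg (-x) (b := -y) (by omega)
  have e2 := Int.emod_lt_of_pos (-x) (b := -y) (by omega)
  have e3 := Int.emod_add_mul_ediv (-x) (-y)
  refine ⟨-(-x / -y), hB hP h1 h0 ⟨1, -x % -y, -y - 1 - -x % -y, by norm_num, e1, by omega,
    by omega, ?_, ?_⟩⟩ <;> simp only []
  · linear_combination -e3
  · ring

theorem LConv.hypShape_of_neg {A : Set (ℤ × ℤ)} (hA : LConv A) {a b c ea eb ec P : ℤ × ℤ}
    (ha : a ∈ A) (hb : b ∈ A) (hc : c ∈ A) (hec : Cap a b c ec) (hea : Cap b c a ea)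
    (heb : Cap c a b eb) (dc : a + b - ec ∉ A) (da : b + c - ea ∉ A) (db : c + a - eb ∉ A)
    (hP : P ∈ A) (hneg : dt a b P < 0) : HypShape A a b c ∨ HypShape A b a c := by
  set u := b - a with hu
  set w := ec - b with hw
  have hdet : cross u w = 1 := by
    rw [← hec.1]; simp only [cross, hu, hw, dt, Prod.fst_sub, Prod.snd_sub]; ring
  have surj := exists_frame_eq (.inl hdet) a
  have hB := hA.comap_frame a u w
  have fa : frame a u w (0, 0) = a := by simp [frame]
  have fb : frame a u w (1, 0) = b := by simp [frame, hu]
  have fec : frame a u w (1, 1) = ec := by simp [frame, hu, hw]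
  obtain ⟨⟨x, h⟩, fc⟩ := surj c
  obtain ⟨⟨p, q⟩, fea⟩ := surj ea
  obtain ⟨⟨p', q'⟩, feb⟩ := surj eb
  obtain ⟨⟨P1, P2⟩, fP⟩ := surj P
  have fdc : frame a u w (0, -1) = a + b - ec := by
    rw [← fec, ← fb]; ext <;> simp [frame] <;> ring
  have fda : frame a u w (1 + x - p, h - q) = b + c - ea := by
    rw [← fb, ← fea, ← fc]; ext <;> simp [frame] <;> ring
  have fdb : frame a u w (x - p', h - q') = c + a - eb := by
    rw [← feb, ← fc]; ext <;> simp [frame] <;> ring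
  have hDt : ∀ p q r, dt (frame a u w p) (frame a u w q) (frame a u w r) = dt p q r := by
    intro p q r; rw [dt_frame, hdet, one_mul]
  set B := {p | frame a u w p ∈ A} with hBd
  have h0 : (0, 0) ∈ B := by rw [hBd, Set.mem_ofPred_eq, fa]; exact ha
  have h1 : (1, 0) ∈ B := by rw [hBd, Set.mem_ofPred_eq, fb]; exact hb
  have h2 : (x, h) ∈ B := by rw [hBd, Set.mem_ofPred_eq, fc]; exact hc
  have n0 : (0, -1) ∉ B := by rw [hBd, Set.mem_ofPred_eq, fdc]; exact dc
  have n1 : (1 + x - p, h - q) ∉ B := by rw [hBd, Set.mem_ofPred_eq, fda]; exact da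
  have n2 : (x - p', h - q') ∉ B := by rw [hBd, Set.mem_ofPred_eq, fdb]; exact db
  have hP' : (P1, P2) ∈ B := by rw [hBd, Set.mem_ofPred_eq, fP]; exact hP
  have c0 : Cap (0, 0) (1, 0) (x, h) (1, 1) := by
    simp only [Cap] at hec ⊢; rwa [← hDt, ← hDt (1, 0), ← hDt (x, h), fa, fb, fc, fec]
  have c1 : Cap (1, 0) (x, h) (0, 0) (p, q) := by
    simp only [Cap] at hea ⊢; rwa [← hDt, ← hDt (x, h), ← hDt (0, 0), fa, fb, fc, fea]
  have c2 : Cap (x, h) (0, 0) (1, 0) (p', q') := by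
    simp only [Cap] at heb ⊢; rwa [← hDt, ← hDt (0, 0), ← hDt (1, 0), fa, fb, fc, feb]
  have hP2 : P2 < 0 := by
    have hd := hDt (0, 0) (1, 0) (P1, P2)
    rw [fa, fb, fP] at hd
    rw [hd] at hneg
    simpa [dt] using hneg
  obtain ⟨j, hj⟩ := exists_neg_one hB h0 h1 hP' hP2
  have hj0 : j ≠ 0 := by rintro rfl; exact n0 hj
  rcases lt_or_gt_of_ne hj0 with hneg | hpos
  · right
    have fr : ∀ s t, frame a u w (1 - s + t, t) = frame b (a - b) (u + w) (s, t) := by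
      intro s t; ext <;> simp [frame, hu, hw] <;> ring
    have mem : ∀ s t, frame b (a - b) (u + w) (s, t) ∈ A ↔ (1 - s + t, t) ∈ B := by
      intro s t; rw [← fr]; rfl
    have hB' := hA.comap_frame b (a - b) (u + w)
    obtain ⟨g, hg, hx, hh, m1, m2⟩ := hB'.shape_of_pos (x := 1 - x + h) (h := h) (j := -j)
      (p := 1 - p' + q') (q := q') (p' := 1 - p + q) (q' := q)
      ((mem _ _).2 (by simpa using h1)) ((mem _ _).2 (by simpa using h0))
      ((mem _ _).2 (by ring_nf; exact h2)) (by
        simp only [Cap, dt] at c0 ⊢; ring_nf at c0 ⊢; exact ⟨c0.1, c0.2.2, c0.2.1⟩)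
      (by simp only [Cap, dt] at c2 ⊢; ring_nf at c2 ⊢; exact ⟨c2.1, by linarith, by linarith⟩)
      (by simp only [Cap, dt] at c1 ⊢; ring_nf at c1 ⊢; exact ⟨c1.1, by linarith, by linarith⟩)
      (fun hh => n0 (by have := (mem _ _).1 hh; ring_nf at this; exact this))
      (fun hh => n2 (by have := (mem _ _).1 hh; ring_nf at this ⊢; exact this))
      (fun hh => n1 (by have := (mem _ _).1 hh; ring_nf at this ⊢; exact this))
      ((mem _ _).2 (by ring_nf; exact hj)) (by omega)
    have hc' : c = frame b (a - b) (u + w) (2, 2 * g + 1) := by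
      rw [← fr, ← fc]; congr 2; omega
    refine ⟨u + w, g, hg, .inr ?_, hc', m1, fun Q hQ => ?_⟩
    · rw [← hdet]; simp only [cross, hu, hw, Prod.fst_add, Prod.snd_add, Prod.fst_sub, Prod.snd_sub]
      ring
    · obtain ⟨⟨s, t⟩, hst⟩ := exists_frame_eq (u := a - b) (w := u + w) (.inr (by
        rw [← hdet]
        simp only [cross, hu, hw, Prod.fst_add, Prod.snd_add, Prod.fst_sub, Prod.snd_sub]; ring)) b Q
      rcases m2 (s, t) (by rw [Set.mem_ofPred_eq, hst]; exact hQ) with h | h | h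
      · left; rw [← hst, h]; simp [frame]
      · right; left; rw [← hst, h, hc']
      · right; right; refine ⟨t, h.2, ?_⟩
        rw [← hst]; congr 2; exact h.1
  · left
    obtain ⟨g, hg, rfl, rfl, m1, m2⟩ := hB.shape_of_pos h0 h1 h2 c0 c1 c2 n0 n1 n2 hj hpos
    refine ⟨w, g, hg, .inl hdet, fc.symm, m1, fun Q hQ => ?_⟩
    obtain ⟨⟨s, t⟩, hst⟩ := surj Q
    rcases m2 (s, t) (by rw [hBd, Set.mem_ofPred_eq, hst]; exact hQ) with h | h | h
    · left; rw [← hst, h]; simp [frame]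
    · right; left; rw [← hst, h, fc]
    · right; right; refine ⟨t, h.2, ?_⟩
      rw [← hst]; congr 2; exact h.1

/-- `p` precedes `q` lexicographically. -/
def LexLT (p q : ℤ × ℤ) : Prop := p.1 < q.1 ∨ p.1 = q.1 ∧ p.2 < q.2

theorem LexLT.trichotomy (p q : ℤ × ℤ) : LexLT p q ∨ p = q ∨ LexLT q p := by
  simp only [LexLT, Prod.ext_iff]; omega

/-- A point of a triangle does not exceed all vertices lexicographically. -/
theorem InTri.not_lexLT {a b c e : ℤ × ℤ} (h : InTri a b c e) (ha : LexLT a e) (hb : LexLT b e)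
    (hc : LexLT c e) : False := by
  obtain ⟨α, β, γ, h1, h2, h3, h4, h5, h6⟩ := h
  have key : ∀ (t : ℤ) (x : ℤ × ℤ), 0 ≤ t → LexLT x e → 0 ≤ t * (e.1 - x.1) ∧
      (t * (e.1 - x.1) = 0 → 0 ≤ t * (e.2 - x.2) ∧ (t * (e.2 - x.2) = 0 → t = 0)) := by
    intro t x ht hx
    rcases ht.eq_or_lt with rfl | ht
    · simp
    · refine ⟨mul_nonneg ht.le (by rcases hx with h | h <;> omega), fun h0 => ?_⟩
      have e1 := (mul_eq_zero.1 h0).resolve_left ht.ne'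
      have e2 : 0 < e.2 - x.2 := by rcases hx with h | h <;> omega
      have := mul_pos ht e2
      exact ⟨this.le, fun h => by omega⟩
  obtain ⟨a1, a2⟩ := key α a h1 ha
  obtain ⟨b1, b2⟩ := key β b h2 hb
  obtain ⟨c1, c2⟩ := key γ c h3 hc
  have s1 : α * (e.1 - a.1) + β * (e.1 - b.1) + γ * (e.1 - c.1) = 0 := by linear_combination h5
  have s2 : α * (e.2 - a.2) + β * (e.2 - b.2) + γ * (e.2 - c.2) = 0 := by linear_combination h6
  obtain ⟨a3, a4⟩ := a2 (by omega)
  obtain ⟨b3, b4⟩ := b2 (by omega)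
  obtain ⟨c3, c4⟩ := c2 (by omega)
  have := a4 (by omega)
  have := b4 (by omega)
  have := c4 (by omega)
  omega

theorem InTri.neg {a b c e : ℤ × ℤ} (h : InTri a b c e) : InTri (-a) (-b) (-c) (-e) := by
  obtain ⟨α, β, γ, h1, h2, h3, h4, h5, h6⟩ := h
  refine ⟨α, β, γ, h1, h2, h3, h4, ?_, ?_⟩ <;> simp only [Prod.fst_neg, Prod.snd_neg]
  · linear_combination -h5
  · linear_combination -h6

theorem LexLT.neg {p q : ℤ × ℤ} (h : LexLT p q) : LexLT (-q) (-p) := by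
  simp only [LexLT, Prod.fst_neg, Prod.snd_neg] at *; omega

/-- Among collinear points, the lexicographically middle one lies on the segment. -/
theorem InTri.of_lexLT {p q r : ℤ × ℤ} (h : dt p q r = 0) (h1 : LexLT p q) (h2 : LexLT q r) :
    InTri p r r q := by
  simp only [dt] at h
  rcases eq_or_ne p.1 r.1 with e | e
  · refine ⟨r.2 - q.2, q.2 - p.2, 0, ?_, ?_, le_rfl, ?_, ?_, ?_⟩ <;>
      rcases h1 with h1 | h1 <;> rcases h2 with h2 | h2 <;> try omega
    · rw [← e, ← h1.1]; ring
    · ring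
  · refine ⟨r.1 - q.1, q.1 - p.1, 0, ?_, ?_, le_rfl, ?_, ?_, ?_⟩
    · rcases h2 with h2 | h2 <;> omega
    · rcases h1 with h1 | h1 <;> omega
    · rcases h1 with h1 | h1 <;> rcases h2 with h2 | h2 <;> omega
    · ring
    · linear_combination -h

theorem InTri.edge_symm {a b e : ℤ × ℤ} (h : InTri a b b e) : InTri b a a e :=
  InTri.comp .mid .left .left h

/-- A point of a degenerate triangle lies on one of the edges. -/
theorem InTri.mem_edge_of_dt_eq_zero {a b c e : ℤ × ℤ} (h : InTri a b c e) (hD : dt a b c = 0)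
    (ha : e ≠ a) (hb : e ≠ b) (hc : e ≠ c) : InTri a b b e ∨ InTri b c c e := by
  obtain ⟨α, β, γ, h1, h2, h3, h4, h5, h6⟩ := id h
  have hz : ∀ u v, dt u v a = 0 → dt u v b = 0 → dt u v c = 0 → dt u v e = 0 := by
    intro u v e1 e2 e3
    have := InTri.dt_mul α β γ h5 h6 u v
    rw [e1, e2, e3] at this
    simp only [mul_zero, add_zero, mul_eq_zero] at this
    exact this.resolve_left h4.ne'
  have z1 : dt a b e = 0 := hz _ _ (dt_self_left _ _) (dt_self_right _ _) hD
  have z2 : dt b c e = 0 := hz _ _ (by rw [dt_rot, hD]) (dt_self_left _ _) (dt_self_right _ _)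
  have edge : ∀ u v, dt u v e = 0 → LexLT u e → LexLT e v → InTri u v v e := by
    intro u v h0 h1 h2
    exact InTri.of_lexLT (by rw [dt_swap, h0, neg_zero]) h1 h2
  have edge' : ∀ u v, dt u v e = 0 → LexLT v e → LexLT e u → InTri u v v e := by
    intro u v h0 h1 h2
    refine (edge v u ?_ h1 h2).edge_symm
    rw [← neg_eq_zero, ← h0]
    simp only [dt]; ring
  have n1 : ¬ (LexLT a e ∧ LexLT b e ∧ LexLT c e) := fun ⟨x, y, z⟩ => h.not_lexLT x y z
  have n2 : ¬ (LexLT e a ∧ LexLT e b ∧ LexLT e c) :=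
    fun ⟨x, y, z⟩ => h.neg.not_lexLT x.neg y.neg z.neg
  have ta := (LexLT.trichotomy a e).imp_right (Or.resolve_left · ha.symm)
  have tb := (LexLT.trichotomy b e).imp_right (Or.resolve_left · hb.symm)
  have tc := (LexLT.trichotomy c e).imp_right (Or.resolve_left · hc.symm)
  have e1 := edge a b z1
  have e2 := edge' a b z1
  have e3 := edge b c z2
  have e4 := edge' b c z2
  rcases ta with x | x <;> rcases tb with y | y <;> rcases tc with z | z
  · exact absurd ⟨x, y, z⟩ n1
  · exact .inr (e3 y z)
  · exact .inl (e1 x y)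
  · exact .inl (e1 x y)
  · exact .inl (e2 y x)
  · exact .inl (e2 y x)
  · exact .inr (e4 z y)
  · exact absurd ⟨x, y, z⟩ n2

/-- The segment `ab` contains no lattice points besides its ends. -/
def PrimEdge (a b : ℤ × ℤ) : Prop := ∀ e, InTri a b b e → e = a ∨ e = b

/-- The triangle `abc` contains no lattice points besides its vertices. -/
def EmptyTri (a b c : ℤ × ℤ) : Prop := ∀ p, InTri a b c p → p = a ∨ p = b ∨ p = c

/-- The pair `a`, `b` is determined by its sum among the pairs of points of `A`. -/
def UniqPair (A : Set (ℤ × ℤ)) (a b : ℤ × ℤ) : Prop :=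
  ∀ p ∈ A, ∀ q ∈ A, p + q = a + b → p = a ∨ p = b

/-- No pair of the triple `a`, `b`, `c` can be replaced by another pair with the same sum. -/
def Isolated (A : Set (ℤ × ℤ)) (a b c : ℤ × ℤ) : Prop :=
  UniqPair A a b ∧ UniqPair A b c ∧ UniqPair A c a

theorem UniqPair.symm {A : Set (ℤ × ℤ)} {a b : ℤ × ℤ} (h : UniqPair A a b) : UniqPair A b a :=
  fun p hp q hq hpq => (h p hp q hq (by rw [hpq, add_comm])).symm

theorem Isolated.rot {A : Set (ℤ × ℤ)} {a b c : ℤ × ℤ} (h : Isolated A a b c) : Isolated A b c a :=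
  ⟨h.2.1, h.2.2, h.1⟩

theorem Isolated.swap {A : Set (ℤ × ℤ)} {a b c : ℤ × ℤ} (h : Isolated A a b c) :
    Isolated A a c b := ⟨h.2.2.symm, h.2.1.symm, h.1.symm⟩

theorem EmptyTri.rot {a b c : ℤ × ℤ} (h : EmptyTri a b c) : EmptyTri b c a := by
  intro p hp
  have := h p hp.rot.rot
  tauto

theorem EmptyTri.swap {a b c : ℤ × ℤ} (h : EmptyTri a b c) : EmptyTri a c b := by
  intro p hp
  have := h p hp.swap
  tauto

theorem PrimEdge.symm {a b : ℤ × ℤ} (h : PrimEdge a b) : PrimEdge b a :=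
  fun p hp => (h p hp.edge_symm).symm

theorem InTri.edge_compl {a b e : ℤ × ℤ} (h : InTri a b b e) : InTri a b b (a + b - e) := by
  obtain ⟨α, β, γ, h1, h2, h3, h4, h5, h6⟩ := h
  refine ⟨β + γ, α, 0, by positivity, h1, le_rfl, by linarith, ?_, ?_⟩ <;>
    simp only [Prod.fst_sub, Prod.snd_sub, Prod.fst_add, Prod.snd_add]
  · linear_combination -h5
  · linear_combination -h6

theorem UniqPair.primEdge {A : Set (ℤ × ℤ)} (hA : LConv A) {a b : ℤ × ℤ} (ha : a ∈ A) (hb : b ∈ A)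
    (h : UniqPair A a b) : PrimEdge a b := fun e he =>
  h e (hA ha hb hb he) (a + b - e) (hA ha hb hb he.edge_compl) (by abel)

theorem InTri.edge_of_dt_eq_zero {a b c e : ℤ × ℤ} (hD : 0 < dt a b c) (h : InTri a b c e)
    (h0 : dt a b e = 0) : InTri a b b e := by
  have h1 := (InTri.iff_dt hD).1 h
  have h2 := dt_add a b c e
  refine ⟨dt b c e, dt c a e, 0, h1.1, h1.2.1, le_rfl, by omega, ?_, ?_⟩ <;> simp only [dt] at *
  · linear_combination (c.1 - e.1) * h0
  · linear_combination (c.2 - e.2) * h0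

theorem exists_cap {a b c : ℤ × ℤ} (hD : 0 < dt a b c) (hab : PrimEdge a b) (hbc : PrimEdge b c)
    (hca : PrimEdge c a) (hE : ¬ EmptyTri a b c) : ∃ e, Cap a b c e := by
  have pos : ∀ e, InTri a b c e → e ≠ a → e ≠ b → e ≠ c →
      0 < dt a b e ∧ 0 < dt b c e ∧ 0 < dt c a e := by
    intro e he ha hb hc
    obtain ⟨h1, h2, h3⟩ := (InTri.iff_dt hD).1 he
    refine ⟨h3.lt_of_ne' fun h => ?_, h1.lt_of_ne' fun h => ?_, h2.lt_of_ne' fun h => ?_⟩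
    · rcases hab e (he.edge_of_dt_eq_zero hD h) with h | h <;> contradiction
    · rcases hbc e (he.rot.edge_of_dt_eq_zero (by rwa [dt_rot]) h) with h | h <;> contradiction
    · rcases hca e (he.rot.rot.edge_of_dt_eq_zero (by rwa [dt_rot, dt_rot]) h) with h | h <;>
        contradiction
  have main : ∀ n : ℕ, ∀ e, InTri a b c e → e ≠ a → e ≠ b → e ≠ c → dt a b e = n →
      ∃ e, Cap a b c e := by
    intro n
    induction n using Nat.strong_induction_on with
    | _ n ih =>
    intro e he ha hb hc hn
    obtain ⟨h1, h2, h3⟩ := pos e he ha hb hc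
    by_cases h : dt a b e = 1
    · exact ⟨e, h, h2, h3⟩
    obtain ⟨p, hp, pa, pb, pe⟩ := exists_inTri_of_two_le (a := a) (b := b) (c := e) (by omega)
    have hp' : InTri a b c p := InTri.comp .left .mid he hp
    obtain ⟨q1, q2, q3⟩ := (InTri.iff_dt h1).1 hp
    have hadd := dt_add a b e p
    have hadd' := dt_add a b c e
    have hlt : dt a b p < dt a b e := by
      by_contra hge
      have z1 : dt b e p = 0 := by omega
      have z2 : dt e a p = 0 := by omega
      apply pe
      have w1 : dt a b e * (p.1 - e.1) = 0 := by
        simp only [dt] at *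
        linear_combination (b.1 - e.1) * z2 + (a.1 - e.1) * z1
      have w2 : dt a b e * (p.2 - e.2) = 0 := by
        simp only [dt] at *
        linear_combination (b.2 - e.2) * z2 + (a.2 - e.2) * z1
      have w1' := (mul_eq_zero.1 w1).resolve_left h1.ne'
      have w2' := (mul_eq_zero.1 w2).resolve_left h1.ne'
      exact Prod.ext (by linarith) (by linarith)
    refine ih (dt a b p).toNat (by omega) p hp' pa pb ?_ (by omega)
    rintro rfl
    omega
  simp only [EmptyTri, not_forall, not_or] at hE
  obtain ⟨e, he, ha, hb, hc⟩ := hE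
  have := (pos e he ha hb hc).1
  exact main (dt a b e).toNat e he ha hb hc (by omega)

theorem frame_add_eq {u w : ℤ × ℤ} (h : cross u w = 1 ∨ cross u w = -1) {o p q r s : ℤ × ℤ}
    (he : frame o u w p + frame o u w q = frame o u w r + frame o u w s) : p + q = r + s := by
  have h2 : cross u w * cross u w = 1 := by rcases h with h | h <;> rw [h] <;> norm_num
  have e1 := congrArg Prod.fst he
  have e2 := congrArg Prod.snd he
  simp only [frame, Prod.fst_add, Prod.snd_add] at e1 e2
  have f1 : cross u w * (p.1 + q.1 - r.1 - s.1) = 0 := by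
    simp only [cross]; linear_combination w.2 * e1 - w.1 * e2
  have f2 : cross u w * (p.2 + q.2 - r.2 - s.2) = 0 := by
    simp only [cross]; linear_combination u.1 * e2 - u.2 * e1
  have hne : cross u w ≠ 0 := by rcases h with h | h <;> rw [h] <;> norm_num
  have f1' := (mul_eq_zero.1 f1).resolve_left hne
  have f2' := (mul_eq_zero.1 f2).resolve_left hne
  ext <;> simp only [Prod.fst_add, Prod.snd_add] <;> linarith

theorem HypShape.isolated {A : Set (ℤ × ℤ)} {a b c : ℤ × ℤ} (h : HypShape A a b c) :
    Isolated A a b c := by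
  obtain ⟨w, g, hg, hdet, hc, -, hA⟩ := h
  set u := b - a with hu
  have fa : a = frame a u w (0, 0) := by simp [frame]
  have fb : b = frame a u w (1, 0) := by simp [frame, hu]
  have key : ∀ P ∈ A, ∃ s t, P = frame a u w (s, t) ∧
      (s = 0 ∧ t = 0 ∨ s = 2 ∧ t = 2 * g + 1 ∨ s = 1 ∧ t ≤ g) := by
    intro P hP
    rcases hA P hP with h | h | ⟨k, hk, h⟩
    · exact ⟨0, 0, h.trans fa, .inl ⟨rfl, rfl⟩⟩
    · exact ⟨2, 2 * g + 1, h.trans hc, .inr (.inl ⟨rfl, rfl⟩)⟩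
    · exact ⟨1, k, h, .inr (.inr ⟨rfl, hk⟩)⟩
  have uniq : ∀ x1 x2 y1 y2 : ℤ, (∀ s t s' t' : ℤ,
      (s = 0 ∧ t = 0 ∨ s = 2 ∧ t = 2 * g + 1 ∨ s = 1 ∧ t ≤ g) →
      (s' = 0 ∧ t' = 0 ∨ s' = 2 ∧ t' = 2 * g + 1 ∨ s' = 1 ∧ t' ≤ g) →
      s + s' = x1 + y1 → t + t' = x2 + y2 → s = x1 ∧ t = x2 ∨ s = y1 ∧ t = y2) →
      UniqPair A (frame a u w (x1, x2)) (frame a u w (y1, y2)) := by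
    intro x1 x2 y1 y2 H P hP Q hQ hPQ
    obtain ⟨s, t, hP', h1⟩ := key P hP
    obtain ⟨s', t', hQ', h2⟩ := key Q hQ
    rw [hP', hQ'] at hPQ
    have := frame_add_eq hdet hPQ
    simp only [Prod.mk_add_mk, Prod.mk.injEq] at this
    rw [hP']
    rcases H s t s' t' h1 h2 this.1 this.2 with ⟨rfl, rfl⟩ | ⟨rfl, rfl⟩
    · exact .inl rfl
    · exact .inr rfl
  refine ⟨?_, ?_, ?_⟩
  · have := uniq 0 0 1 0 (by omega)
    rwa [← fa, ← fb] at this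
  · rw [fb, hc]
    exact uniq _ _ _ _ (by omega)
  · rw [hc]
    have := uniq 2 (2 * g + 1) 0 0 (by omega)
    rwa [← fa] at this

theorem isolated_of_forall_inTri {A : Set (ℤ × ℤ)} {a b c : ℤ × ℤ} (hD : 0 < dt a b c)
    (hab : PrimEdge a b) (hbc : PrimEdge b c) (hca : PrimEdge c a)
    (hA : ∀ P ∈ A, InTri a b c P) : Isolated A a b c := by
  have key : ∀ a b c, 0 < dt a b c → PrimEdge a b → (∀ P ∈ A, InTri a b c P) → UniqPair A a b := by
    intro a b c hD hab hA P hP Q hQ hPQ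
    refine hab P ((hA P hP).edge_of_dt_eq_zero hD ?_)
    have h1 := ((InTri.iff_dt hD).1 (hA P hP)).2.2
    have h2 := ((InTri.iff_dt hD).1 (hA Q hQ)).2.2
    have h3 : dt a b P + dt a b Q = 0 := by
      rw [← dtTwo_add, hPQ, dtTwo_add, dt_self_left, dt_self_right, add_zero]
    omega
  exact ⟨key a b c hD hab hA, key b c a (by rwa [dt_rot]) hbc fun P hP => (hA P hP).rot,
    key c a b (by rwa [dt_rot, dt_rot]) hca fun P hP => (hA P hP).rot.rot⟩

theorem HypShape.symm {A : Set (ℤ × ℤ)} {a b c : ℤ × ℤ} (h : HypShape A a b c) :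
    HypShape A c b a := by
  obtain ⟨w, g, hg, hdet, hc, hd, hA⟩ := h
  have fr : ∀ s t, frame c (b - c) w (s, t) =
      frame a (b - a) w (2 - s, t + (2 * g + 1) * (1 - s)) := by
    intro s t
    rw [hc]
    ext <;> simp only [frame, Prod.fst_sub, Prod.snd_sub] <;> ring
  refine ⟨w, g, hg, ?_, ?_, ?_, fun P hP => ?_⟩
  · have : cross (b - c) w = -cross (b - a) w := by
      rw [hc]; simp only [cross, frame, Prod.fst_sub, Prod.snd_sub]; ring
    rw [this]; omega
  · rw [fr]; ext <;> simp only [frame, Prod.fst_sub, Prod.snd_sub] <;> ring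
  · rw [fr]; convert hd using 2; norm_num
  · rcases hA P hP with h | h | ⟨k, hk, h⟩
    · exact .inr (.inl h)
    · exact .inl h
    · refine .inr (.inr ⟨k, hk, ?_⟩)
      rw [fr, h]; congr 2; ring

/-- A triangle with caps whose opposite points do not belong to `A` either contains `A` or sits in
a hyperelliptic shape. -/
theorem LConv.classify_of_cap {A : Set (ℤ × ℤ)} (hA : LConv A) {a b c ea eb ec : ℤ × ℤ}
    (hD : 0 < dt a b c) (ha : a ∈ A) (hb : b ∈ A) (hc : c ∈ A) (hec : Cap a b c ec)
    (hea : Cap b c a ea) (heb : Cap c a b eb) (dc : a + b - ec ∉ A) (da : b + c - ea ∉ A)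
    (db : c + a - eb ∉ A) :
    (∀ P ∈ A, InTri a b c P) ∨ HypShape A a b c ∨ HypShape A b c a ∨ HypShape A c a b := by
  by_contra! hcon
  obtain ⟨⟨P, hP, hnot⟩, h1, h2, h3⟩ := hcon
  rw [InTri.iff_dt hD, not_and_or, not_and_or, not_le, not_le, not_le] at hnot
  rcases hnot with h | h | h
  · rcases hA.hypShape_of_neg hb hc ha hea heb hec da db dc hP h with h | h
    · exact h2 h
    · exact h1 h.symm
  · rcases hA.hypShape_of_neg hc ha hb heb hec hea db dc da hP h with h | h
    · exact h3 h
    · exact h2 h.symm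
  · rcases hA.hypShape_of_neg ha hb hc hec hea heb dc da db hP h with h | h
    · exact h1 h
    · exact h3 h.symm

theorem dt_ne_zero_of_primEdge {a b c : ℤ × ℤ} (hab : PrimEdge a b) (hbc : PrimEdge b c)
    (hE : ¬ EmptyTri a b c) : dt a b c ≠ 0 := by
  intro h0
  simp only [EmptyTri, not_forall, not_or] at hE
  obtain ⟨e, he, ha, hb, hc⟩ := hE
  rcases he.mem_edge_of_dt_eq_zero h0 ha hb hc with h | h
  · rcases hab e h with h | h <;> contradiction
  · rcases hbc e h with h | h <;> contradiction

theorem Cap.ne {a b c e : ℤ × ℤ} (h : Cap a b c e) : e ≠ a ∧ e ≠ b := by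
  obtain ⟨h1, h2, h3⟩ := h
  constructor
  · rintro rfl; rw [dt_self_left] at h1; omega
  · rintro rfl; rw [dt_self_right] at h1; omega

theorem UniqPair.not_mem_of_cap {A : Set (ℤ × ℤ)} {a b c e : ℤ × ℤ} (h : UniqPair A a b)
    (he : e ∈ A) (hcap : Cap a b c e) : a + b - e ∉ A := fun hd => by
  have := hcap.ne
  rcases h e he _ hd (by abel) with h | h <;> tauto

theorem Cap.inTri {a b c e : ℤ × ℤ} (h : Cap a b c e) (hD : 0 < dt a b c) : InTri a b c e :=
  (InTri.iff_dt hD).2 ⟨h.2.1.le, h.2.2.le, by rw [h.1]; norm_num⟩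

/-- The classification of isolated triples which contain further lattice points. -/
theorem Isolated.classify {A : Set (ℤ × ℤ)} (hA : LConv A) {a b c : ℤ × ℤ} (ha : a ∈ A)
    (hb : b ∈ A) (hc : c ∈ A) (h : Isolated A a b c) (hE : ¬ EmptyTri a b c) :
    (∀ P ∈ A, InTri a b c P) ∨ HypShape A a b c ∨ HypShape A b c a ∨ HypShape A c a b := by
  have main : ∀ a b c, a ∈ A → b ∈ A → c ∈ A → Isolated A a b c → ¬ EmptyTri a b c → 0 < dt a b c →
      (∀ P ∈ A, InTri a b c P) ∨ HypShape A a b c ∨ HypShape A b c a ∨ HypShape A c a b := by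
    intro a b c ha hb hc h hE hD
    have p1 := h.1.primEdge hA ha hb
    have p2 := h.2.1.primEdge hA hb hc
    have p3 := h.2.2.primEdge hA hc ha
    have hD2 : 0 < dt b c a := by rwa [dt_rot]
    have hD3 : 0 < dt c a b := by rwa [dt_rot, dt_rot]
    obtain ⟨ec, hec⟩ := exists_cap hD p1 p2 p3 hE
    obtain ⟨ea, hea⟩ := exists_cap hD2 p2 p3 p1 fun h => hE h.rot.rot
    obtain ⟨eb, heb⟩ := exists_cap hD3 p3 p1 p2 fun h => hE h.rot
    exact hA.classify_of_cap hD ha hb hc hec hea heb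
      (h.1.not_mem_of_cap (hA ha hb hc (hec.inTri hD)) hec)
      (h.2.1.not_mem_of_cap (hA hb hc ha (hea.inTri hD2)) hea)
      (h.2.2.not_mem_of_cap (hA hc ha hb (heb.inTri hD3)) heb)
  have hne := dt_ne_zero_of_primEdge (h.1.primEdge hA ha hb) (h.2.1.primEdge hA hb hc) hE
  rcases lt_or_gt_of_ne hne with hneg | hpos
  · rcases main a c b ha hc hb h.swap (fun h => hE h.swap) (by rw [dt_swap]; omega) with
      h | h | h | h
    · exact .inl fun P hP => (h P hP).swap
    · exact .inr (.inr (.inl h.symm))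
    · exact .inr (.inl h.symm)
    · exact .inr (.inr (.inr h.symm))
  · exact main a b c ha hb hc h hE hpos

theorem multiset_rot {α : Type*} (a b c : α) : ({a, b, c} : Multiset α) = {b, c, a} := by
  change a ::ₘ b ::ₘ c ::ₘ 0 = b ::ₘ c ::ₘ a ::ₘ 0
  rw [Multiset.cons_swap, Multiset.cons_swap a c]

theorem multiset_swap {α : Type*} (a b c : α) : ({a, b, c} : Multiset α) = {a, c, b} := by
  change a ::ₘ b ::ₘ c ::ₘ 0 = a ::ₘ c ::ₘ b ::ₘ 0
  rw [Multiset.cons_swap b c]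

/-- A relation on triples that is invariant under permutations is transported along equality of the
underlying multisets. -/
theorem triple_transport {α : Type*} {C : α → α → α → Prop}
    (hrot : ∀ a b c, C a b c → C b c a) (hswap : ∀ a b c, C a b c → C a c b) {a b c a' b' c' : α}
    (h : ({a, b, c} : Multiset α) = {a', b', c'}) (hC : C a b c) : C a' b' c' := by
  have pair : ∀ {x y z x' y' z' : α}, ({x, y, z} : Multiset α) = {x', y', z'} → C x y z → x = x' →
      C x' y' z' := by
    rintro x y z x' y' z' h hC rfl
    have h1 : ({y, z} : Multiset α) = {y', z'} := (Multiset.cons_inj_right x).1 h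
    have hy : y ∈ ({y', z'} : Multiset α) := by rw [← h1]; simp
    simp only [Multiset.insert_eq_cons, Multiset.mem_cons, Multiset.mem_singleton] at hy
    rcases hy with rfl | rfl
    · have h2 : ({z} : Multiset α) = {z'} := (Multiset.cons_inj_right y).1 h1
      rwa [← Multiset.singleton_inj.1 h2]
    · rw [Multiset.pair_comm y'] at h1
      have h2 : ({z} : Multiset α) = {y'} := (Multiset.cons_inj_right y).1 h1
      rw [← Multiset.singleton_inj.1 h2]
      exact hswap _ _ _ hC
  have ha : a' ∈ ({a, b, c} : Multiset α) := by rw [h]; simp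
  simp only [Multiset.insert_eq_cons, Multiset.mem_cons, Multiset.mem_singleton] at ha
  rcases ha with rfl | rfl | rfl
  · exact pair h hC rfl
  · exact pair ((multiset_rot _ _ _).symm.trans h) (hrot _ _ _ hC) rfl
  · exact pair ((multiset_rot _ _ _).trans h) (hrot _ _ _ (hrot _ _ _ hC)) rfl

/-- Two triples are connected if one is obtained from the other by repeatedly replacing a pair of
points by a pair of points of `A` with the same sum. -/
inductive Conn (A : Set (ℤ × ℤ)) : Multiset (ℤ × ℤ) → Multiset (ℤ × ℤ) → Prop
  | refl (s) : Conn A s s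
  | symm {s t} : Conn A s t → Conn A t s
  | trans {s t r} : Conn A s t → Conn A t r → Conn A s r
  | move {a b c b' c'} (ha : a ∈ A) (hb : b ∈ A) (hc : c ∈ A) (hb' : b' ∈ A) (hc' : c' ∈ A)
      (h : b + c = b' + c') : Conn A {a, b, c} {a, b', c'}

namespace Conn

variable {A B : Set (ℤ × ℤ)}

theorem mono (hAB : A ⊆ B) {s t : Multiset (ℤ × ℤ)} (h : Conn A s t) : Conn B s t := by
  induction h with
  | refl s => exact .refl s
  | symm _ ih => exact ih.symm
  | trans _ _ ih1 ih2 => exact ih1.trans ih2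
  | move ha hb hc hb' hc' h =>
    exact .move (hAB ha) (hAB hb) (hAB hc) (hAB hb') (hAB hc') h

theorem sum_eq {s t : Multiset (ℤ × ℤ)} (h : Conn A s t) : s.sum = t.sum := by
  induction h with
  | refl s => rfl
  | symm _ ih => exact ih.symm
  | trans _ _ ih1 ih2 => exact ih1.trans ih2
  | move ha hb hc hb' hc' h => simp [h]

theorem eq_iff_of_isolated {a b c : ℤ × ℤ} (hI : Isolated A a b c) {s t : Multiset (ℤ × ℤ)}
    (h : Conn A s t) : {a, b, c} = s ↔ {a, b, c} = t := by
  induction h with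
  | refl s => rfl
  | symm _ ih => exact ih.symm
  | trans _ _ ih1 ih2 => exact ih1.trans ih2
  | @move x p q p' q' hx hp hq hp' hq' h =>
    have key : ∀ p q p' q' : ℤ × ℤ, p' ∈ A → q' ∈ A → p + q = p' + q' →
        ({a, b, c} : Multiset (ℤ × ℤ)) = {x, p, q} → {a, b, c} = ({x, p', q'} : Multiset _) := by
      intro p q p' q' hp' hq' h he
      have hI' : Isolated A x p q := triple_transport (C := Isolated A) (fun _ _ _ h => h.rot)
        (fun _ _ _ h => h.swap) he hI
      rw [he]
      rcases hI'.2.1 p' hp' q' hq' h.symm with rfl | rfl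
      · rw [add_left_cancel h]
      · rw [add_comm] at h
        rw [add_left_cancel h, multiset_swap]
    exact ⟨key p q p' q' hp' hq' h, key p' q' p q hp hq h.symm⟩

end Conn

/-- Squared norm. -/
def normSq (p : ℤ × ℤ) : ℤ := p.1 * p.1 + p.2 * p.2

theorem normSq_sub_pos {a b : ℤ × ℤ} (h : a ≠ b) : 0 < normSq (a - b) := by
  simp only [normSq, Prod.fst_sub, Prod.snd_sub]
  by_contra! hle
  have h1 : (a.1 - b.1) * (a.1 - b.1) = 0 := by
    nlinarith [mul_self_nonneg (a.1 - b.1), mul_self_nonneg (a.2 - b.2)]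
  have h2 : (a.2 - b.2) * (a.2 - b.2) = 0 := by
    nlinarith [mul_self_nonneg (a.1 - b.1), mul_self_nonneg (a.2 - b.2)]
  rw [mul_self_eq_zero] at h1 h2
  exact h (Prod.ext (by linarith) (by linarith))

theorem normSq_nonneg (a : ℤ × ℤ) : 0 ≤ normSq a := by
  simp only [normSq]; nlinarith [mul_self_nonneg a.1, mul_self_nonneg a.2]

theorem edge_normSq_lt {a b e : ℤ × ℤ} (h : InTri a b b e) (ha : e ≠ a) (hb : e ≠ b) :
    normSq e + normSq (a + b - e) < normSq a + normSq b := by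
  obtain ⟨α, β', γ, h1, h2, h3, h4, h5, h6⟩ := h
  obtain ⟨β, hβ⟩ : ∃ β, β = β' + γ := ⟨_, rfl⟩
  have h4' : 0 < α + β := by omega
  have h5' : (α + β) * e.1 = α * a.1 + β * b.1 := by rw [hβ]; linear_combination h5
  have h6' : (α + β) * e.2 = α * a.2 + β * b.2 := by rw [hβ]; linear_combination h6
  have ext : ∀ x : ℤ × ℤ, (α + β) * e.1 = (α + β) * x.1 → (α + β) * e.2 = (α + β) * x.2 → e = x :=
    fun x e1 e2 => Prod.ext (mul_left_cancel₀ h4'.ne' e1) (mul_left_cancel₀ h4'.ne' e2)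
  have hα : 0 < α := by
    refine h1.lt_of_ne fun h => hb (ext _ ?_ ?_)
    · rw [h5', ← h]; ring
    · rw [h6', ← h]; ring
  have hβ0 : 0 < β := by
    refine lt_of_le_of_ne (by omega) fun h => ha (ext _ ?_ ?_)
    · rw [h5', ← h]; ring
    · rw [h6', ← h]; ring
  have hab : a ≠ b := by
    rintro rfl
    exact ha (ext _ (by rw [h5']; ring) (by rw [h6']; ring))
  have key : (α + β) * (α + β) * (normSq a + normSq b - normSq e - normSq (a + b - e)) =
      2 * (α * β) * normSq (a - b) := by
    simp only [normSq, Prod.fst_sub, Prod.snd_sub, Prod.fst_add, Prod.snd_add]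
    linear_combination (-2 * ((α + β) * e.1 + α * a.1 + β * b.1) + 2 * (a.1 + b.1) * (α + β)) * h5'
      + (-2 * ((α + β) * e.2 + α * a.2 + β * b.2) + 2 * (a.2 + b.2) * (α + β)) * h6'
  have := normSq_sub_pos hab
  have h7 : 0 < (α + β) * (α + β) * (normSq a + normSq b - normSq e - normSq (a + b - e)) := by
    rw [key]; positivity
  have := pos_of_mul_pos_right h7 (by positivity)
  linarith

theorem tri_normSq_lt {a b c e x y : ℤ × ℤ} (hD : 0 < dt a b c) (he : InTri a b c e)
    (hx : InTri a b c x) (hy : InTri a b c y) (hsum : e + x + y = a + b + c) (ha : e ≠ a)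
    (hb : e ≠ b) (hc : e ≠ c) : normSq e + normSq x + normSq y < normSq a + normSq b + normSq c := by
  have hab : a ≠ b := by rintro rfl; simp [dt] at hD
  have hbc : b ≠ c := by rintro rfl; simp [dt] at hD; nlinarith
  have hca : c ≠ a := by rintro rfl; simp [dt] at hD
  have iden : ∀ p, dt a b c * dt a b c * normSq p = dt a b c * (dt b c p * normSq a + dt c a p * normSq b +
      dt a b p * normSq c) - (dt b c p * dt c a p * normSq (a - b) + dt c a p * dt a b p * normSq (b - c) +
      dt a b p * dt b c p * normSq (c - a)) := by
    intro p
    have hs := dt_add a b c p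
    have e1 : dt a b c * p.1 = dt b c p * a.1 + dt c a p * b.1 + dt a b p * c.1 := by
      simp only [dt]; ring
    have e2 : dt a b c * p.2 = dt b c p * a.2 + dt c a p * b.2 + dt a b p * c.2 := by
      simp only [dt]; ring
    generalize dt a b c = D at *
    generalize dt b c p = α at *
    generalize dt c a p = β at *
    generalize dt a b p = γ at *
    subst hs
    simp only [normSq, Prod.fst_sub, Prod.snd_sub]
    linear_combination ((α + β + γ) * p.1 + α * a.1 + β * b.1 + γ * c.1) * e1 +
      ((α + β + γ) * p.2 + α * a.2 + β * b.2 + γ * c.2) * e2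
  have s1 := congrArg Prod.fst hsum
  have s2 := congrArg Prod.snd hsum
  simp only [Prod.fst_add, Prod.snd_add] at s1 s2
  have w1 : dt b c e + dt b c x + dt b c y = dt a b c := by
    simp only [dt]; linear_combination (b.1 - c.1) * (-s2) + (b.2 - c.2) * s1
  have w2 : dt c a e + dt c a x + dt c a y = dt a b c := by
    simp only [dt]; linear_combination (c.1 - a.1) * (-s2) + (c.2 - a.2) * s1
  have w3 : dt a b e + dt a b x + dt a b y = dt a b c := by
    simp only [dt]; linear_combination (a.1 - b.1) * (-s2) + (a.2 - b.2) * s1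
  have defect : ∀ p, InTri a b c p → 0 ≤ dt b c p * dt c a p * normSq (a - b) +
      dt c a p * dt a b p * normSq (b - c) + dt a b p * dt b c p * normSq (c - a) := by
    intro p hp
    obtain ⟨h1, h2, h3⟩ := (InTri.iff_dt hD).1 hp
    have := normSq_nonneg (a - b)
    have := normSq_nonneg (b - c)
    have := normSq_nonneg (c - a)
    positivity
  have dx := defect x hx
  have dy := defect y hy
  have de : 0 < dt b c e * dt c a e * normSq (a - b) +
      dt c a e * dt a b e * normSq (b - c) + dt a b e * dt b c e * normSq (c - a) := by
    obtain ⟨h1, h2, h3⟩ := (InTri.iff_dt hD).1 he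
    have q1 := normSq_sub_pos hab
    have q2 := normSq_sub_pos hbc
    have q3 := normSq_sub_pos hca
    have hs := dt_add a b c e
    have e1 : dt a b c * e.1 = dt b c e * a.1 + dt c a e * b.1 + dt a b e * c.1 := by
      simp only [dt]; ring
    have e2 : dt a b c * e.2 = dt b c e * a.2 + dt c a e * b.2 + dt a b e * c.2 := by
      simp only [dt]; ring
    have ext : ∀ z : ℤ × ℤ, dt a b c * e.1 = dt a b c * z.1 → dt a b c * e.2 = dt a b c * z.2 →
        e = z :=
      fun x e1 e2 => Prod.ext (mul_left_cancel₀ hD.ne' e1) (mul_left_cancel₀ hD.ne' e2)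
    rcases h1.eq_or_lt with z1 | p1 <;> rcases h2.eq_or_lt with z2 | p2 <;>
      rcases h3.eq_or_lt with z3 | p3
    · omega
    · refine absurd (ext c ?_ ?_) hc
      · rw [e1, ← hs, ← z1, ← z2]; ring
      · rw [e2, ← hs, ← z1, ← z2]; ring
    · refine absurd (ext b ?_ ?_) hb
      · rw [e1, ← hs, ← z1, ← z3]; ring
      · rw [e2, ← hs, ← z1, ← z3]; ring
    · rw [← z1]; simp; positivity
    · refine absurd (ext a ?_ ?_) ha
      · rw [e1, ← hs, ← z3, ← z2]; ring
      · rw [e2, ← hs, ← z3, ← z2]; ring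
    · rw [← z2]; simp; positivity
    · rw [← z3]; simp; positivity
    · positivity
  have ie := iden e
  have ix := iden x
  have iy := iden y
  have tot : dt a b c * dt a b c * (normSq e + normSq x + normSq y) < dt a b c * dt a b c *
      (normSq a + normSq b + normSq c) := by
    have : dt a b c * dt a b c * (normSq a + normSq b + normSq c) = dt a b c *
        ((dt b c e + dt b c x + dt b c y) * normSq a + (dt c a e + dt c a x + dt c a y) * normSq b +
          (dt a b e + dt a b x + dt a b y) * normSq c) := by rw [w1, w2, w3]; ring
    rw [this]
    linarith
  exact lt_of_mul_lt_mul_left tot (by positivity)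

/-- The triple `e`, `x`, `y` lies in the triangle `abc`. -/
def SubTri (a b c e x y : ℤ × ℤ) : Prop := InTri a b c e ∧ InTri a b c x ∧ InTri a b c y

theorem SubTri.refl (a b c : ℤ × ℤ) : SubTri a b c a b c := ⟨.left, .mid, .right⟩

theorem SubTri.trans {a b c x y z p q r : ℤ × ℤ} (h : SubTri a b c x y z) (h' : SubTri x y z p q r) :
    SubTri a b c p q r :=
  ⟨h.1.comp h.2.1 h.2.2 h'.1, h.1.comp h.2.1 h.2.2 h'.2.1, h.1.comp h.2.1 h.2.2 h'.2.2⟩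

theorem SubTri.rot {a b c x y z : ℤ × ℤ} (h : SubTri a b c x y z) : SubTri b c a x y z :=
  ⟨h.1.rot, h.2.1.rot, h.2.2.rot⟩

theorem SubTri.swap {a b c x y z : ℤ × ℤ} (h : SubTri a b c x y z) : SubTri a c b x y z :=
  ⟨h.1.swap, h.2.1.swap, h.2.2.swap⟩

theorem SubTri.mem {A : Set (ℤ × ℤ)} (hA : LConv A) {a b c x y z : ℤ × ℤ} (ha : a ∈ A) (hb : b ∈ A)
    (hc : c ∈ A) (h : SubTri a b c x y z) : x ∈ A ∧ y ∈ A ∧ z ∈ A :=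
  ⟨hA ha hb hc h.1, hA ha hb hc h.2.1, hA ha hb hc h.2.2⟩

/-- Splitting an edge that is not primitive. -/
theorem exists_conn_of_edge {A : Set (ℤ × ℤ)} (hA : LConv A) {a b c e : ℤ × ℤ} (ha : a ∈ A)
    (hb : b ∈ A) (hc : c ∈ A) (he : InTri a b b e) (hea : e ≠ a) (heb : e ≠ b) :
    ∃ x y z, SubTri a b c x y z ∧ normSq x + normSq y + normSq z <
      normSq a + normSq b + normSq c ∧ Conn A {a, b, c} {x, y, z} := by
  have h1 := edge_normSq_lt he hea heb
  refine ⟨c, e, a + b - e, ⟨.right, InTri.comp .left .mid .mid he,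
    InTri.comp .left .mid .mid he.edge_compl⟩, by linarith, ?_⟩
  rw [← multiset_rot]
  exact .move hc ha hb (hA ha hb hb he) (hA ha hb hb he.edge_compl) (by abel)

/-- A triple which is not isolated and contains further lattice points is connected to a smaller
triple. -/
theorem exists_conn_of_not_isolated {A : Set (ℤ × ℤ)} (hA : LConv A) {a b c : ℤ × ℤ} (ha : a ∈ A)
    (hb : b ∈ A) (hc : c ∈ A) (hI : ¬ Isolated A a b c) (hE : ¬ EmptyTri a b c) :
    ∃ x y z, SubTri a b c x y z ∧ normSq x + normSq y + normSq z <
      normSq a + normSq b + normSq c ∧ Conn A {a, b, c} {x, y, z} := by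
  by_cases hab : PrimEdge a b
  swap
  · simp only [PrimEdge, not_forall, not_or] at hab
    obtain ⟨e, he, h1, h2⟩ := hab
    exact exists_conn_of_edge hA ha hb hc he h1 h2
  by_cases hbc : PrimEdge b c
  swap
  · simp only [PrimEdge, not_forall, not_or] at hbc
    obtain ⟨e, he, h1, h2⟩ := hbc
    obtain ⟨x, y, z, h, h', h''⟩ := exists_conn_of_edge hA hb hc ha he h1 h2
    exact ⟨x, y, z, h.rot.rot, by linarith, by rwa [multiset_rot a b c]⟩
  by_cases hca : PrimEdge c a
  swap
  · simp only [PrimEdge, not_forall, not_or] at hca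
    obtain ⟨e, he, h1, h2⟩ := hca
    obtain ⟨x, y, z, h, h', h''⟩ := exists_conn_of_edge hA hc ha hb he h1 h2
    exact ⟨x, y, z, h.rot, by linarith, by rwa [← multiset_rot c a b]⟩
  have main : ∀ a b c, a ∈ A → b ∈ A → c ∈ A → ¬ Isolated A a b c → ¬ EmptyTri a b c →
      PrimEdge a b → PrimEdge b c → PrimEdge c a → 0 < dt a b c →
      ∃ x y z, SubTri a b c x y z ∧ normSq x + normSq y + normSq z <
        normSq a + normSq b + normSq c ∧ Conn A {a, b, c} {x, y, z} := by
    intro a b c ha hb hc hI hE hab hbc hca hD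
    have hD2 : 0 < dt b c a := by rwa [dt_rot]
    have hD3 : 0 < dt c a b := by rwa [dt_rot, dt_rot]
    obtain ⟨ec, hec⟩ := exists_cap hD hab hbc hca hE
    obtain ⟨ea, hea⟩ := exists_cap hD2 hbc hca hab fun h => hE h.rot.rot
    obtain ⟨eb, heb⟩ := exists_cap hD3 hca hab hbc fun h => hE h.rot
    have step : ∀ a b c e, a ∈ A → b ∈ A → c ∈ A → 0 < dt a b c → Cap a b c e →
        a + b - e ∈ A → ∃ x y z, SubTri a b c x y z ∧ normSq x + normSq y + normSq z <
        normSq a + normSq b + normSq c ∧ Conn A {a, b, c} {x, y, z} := by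
      intro a b c e ha hb hc hD he hd
      have heT := he.inTri hD
      have heA := hA ha hb hc heT
      obtain ⟨x, y, hx, hy, hsum⟩ := heT.exists_add_eq hD
      have hec : e ≠ c := by
        rintro rfl
        have := he.2.1
        rw [dt_self_right] at this
        omega
      refine ⟨e, x, y, ⟨heT, hx, hy⟩, tri_normSq_lt hD heT hx hy hsum he.ne.1 he.ne.2 hec, ?_⟩
      have c1 : Conn A {c, a, b} {c, e, a + b - e} := .move hc ha hb heA hd (by abel)
      have c2 : Conn A {e, a + b - e, c} {e, x, y} :=
        .move heA hd hc (hA ha hb hc hx) (hA ha hb hc hy)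
          (by rw [show x + y = e + x + y - e by abel, hsum]; abel)
      rw [multiset_rot c a b] at c1
      rw [multiset_rot c e] at c1
      exact c1.trans c2
    by_cases d1 : a + b - ec ∈ A
    · exact step a b c ec ha hb hc hD hec d1
    by_cases d2 : b + c - ea ∈ A
    · obtain ⟨x, y, z, h, h', h''⟩ := step b c a ea hb hc ha hD2 hea d2
      exact ⟨x, y, z, h.rot.rot, by linarith, by rwa [multiset_rot a b c]⟩
    by_cases d3 : c + a - eb ∈ A
    · obtain ⟨x, y, z, h, h', h''⟩ := step c a b eb hc ha hb hD3 heb d3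
      exact ⟨x, y, z, h.rot, by linarith, by rwa [← multiset_rot c a b]⟩
    refine absurd ?_ hI
    rcases hA.classify_of_cap hD ha hb hc hec hea heb d1 d2 d3 with h | h | h | h
    · exact isolated_of_forall_inTri hD hab hbc hca h
    · exact h.isolated
    · exact h.isolated.rot.rot
    · exact h.isolated.rot
  have hne := dt_ne_zero_of_primEdge hab hbc hE
  rcases lt_or_gt_of_ne hne with hneg | hpos
  · obtain ⟨x, y, z, h, h', h''⟩ := main a c b ha hc hb (fun h => hI h.swap)
      (fun h => hE h.swap) hca.symm hbc.symm hab.symm (by rw [dt_swap]; omega)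
    exact ⟨x, y, z, h.swap, by linarith, by rwa [multiset_swap a b c]⟩
  · exact main a b c ha hb hc hI hE hab hbc hca hpos

theorem normSq_sum_eq {a b c x y z : ℤ × ℤ} (h : ({a, b, c} : Multiset (ℤ × ℤ)) = {x, y, z}) :
    normSq a + normSq b + normSq c = normSq x + normSq y + normSq z := by
  have := congrArg (fun s => (s.map normSq).sum) h
  simpa [add_assoc] using this

/-- A triple that is empty or not isolated is connected to an empty triple inside its hull. -/
theorem exists_conn_emptyTri {A : Set (ℤ × ℤ)} (hA : LConv A) {a b c : ℤ × ℤ} (ha : a ∈ A)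
    (hb : b ∈ A) (hc : c ∈ A) (h : EmptyTri a b c ∨ ¬ Isolated A a b c) :
    ∃ x y z, SubTri a b c x y z ∧ EmptyTri x y z ∧ Conn A {a, b, c} {x, y, z} := by
  obtain ⟨n, hn⟩ : ∃ n : ℕ, normSq a + normSq b + normSq c = n :=
    ⟨(normSq a + normSq b + normSq c).toNat, by
      have := normSq_nonneg a; have := normSq_nonneg b; have := normSq_nonneg c; omega⟩
  induction n using Nat.strong_induction_on generalizing a b c with
  | _ n ih =>
  by_cases hE : EmptyTri a b c
  · exact ⟨a, b, c, .refl a b c, hE, .refl _⟩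
  have hI := h.resolve_left hE
  obtain ⟨x, y, z, hsub, hlt, hconn⟩ := exists_conn_of_not_isolated hA ha hb hc hI hE
  obtain ⟨hx, hy, hz⟩ := hsub.mem hA ha hb hc
  have := normSq_nonneg x
  have := normSq_nonneg y
  have := normSq_nonneg z
  obtain ⟨x', y', z', hsub', hE', hconn₂⟩ := ih (normSq x + normSq y + normSq z).toNat (by omega)
    hx hy hz (.inr fun hI' => hlt.ne (normSq_sum_eq ((hconn.eq_iff_of_isolated hI').2 rfl)))
    (by omega)
  exact ⟨x', y', z', hsub.trans hsub', hE', hconn.trans hconn₂⟩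

/-- Every triple has an empty triple with the same sum inside its hull. -/
theorem exists_emptyTri_sum_eq (a b c : ℤ × ℤ) :
    ∃ x y z, SubTri a b c x y z ∧ EmptyTri x y z ∧ x + y + z = a + b + c := by
  obtain ⟨n, hn⟩ : ∃ n : ℕ, normSq a + normSq b + normSq c = n :=
    ⟨(normSq a + normSq b + normSq c).toNat, by
      have := normSq_nonneg a; have := normSq_nonneg b; have := normSq_nonneg c; omega⟩
  induction n using Nat.strong_induction_on generalizing a b c with
  | _ n ih =>
  by_cases hE : EmptyTri a b c
  · exact ⟨a, b, c, .refl a b c, hE, rfl⟩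
  obtain ⟨x, y, z, hsub, hlt, hsum⟩ : ∃ x y z, SubTri a b c x y z ∧
      normSq x + normSq y + normSq z < normSq a + normSq b + normSq c ∧
      x + y + z = a + b + c := by
    simp only [EmptyTri, not_forall, not_or] at hE
    obtain ⟨e, he, h1, h2, h3⟩ := hE
    rcases lt_trichotomy (dt a b c) 0 with hD | hD | hD
    · have hD' : 0 < dt a c b := by rw [dt_swap]; omega
      obtain ⟨x, y, hx, hy, hsum⟩ := he.swap.exists_add_eq hD'
      refine ⟨e, x, y, ⟨he, hx.swap, hy.swap⟩, ?_, by rw [hsum]; abel⟩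
      have := tri_normSq_lt hD' he.swap hx hy hsum h1 h3 h2
      linarith
    · rcases he.mem_edge_of_dt_eq_zero hD h1 h2 h3 with h | h
      · obtain ⟨x, y, z, hs, hlt, hc⟩ := exists_conn_of_edge (A := Set.univ) (c := c)
          (fun _ _ _ _ _ _ _ _ => trivial) trivial trivial trivial h h1 h2
        exact ⟨x, y, z, hs, hlt, by simpa [add_assoc] using hc.sum_eq.symm⟩
      · obtain ⟨x, y, z, hs, hlt, hc⟩ := exists_conn_of_edge (A := Set.univ) (c := a)
          (fun _ _ _ _ _ _ _ _ => trivial) trivial trivial trivial h h2 h3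
        refine ⟨x, y, z, hs.rot.rot, by linarith, ?_⟩
        have := hc.sum_eq.symm
        simp only [Multiset.insert_eq_cons, Multiset.sum_cons, Multiset.sum_singleton,
          ← add_assoc] at this
        rw [this]; abel
    · obtain ⟨x, y, hx, hy, hsum⟩ := he.exists_add_eq hD
      exact ⟨e, x, y, ⟨he, hx, hy⟩, tri_normSq_lt hD he hx hy hsum h1 h2 h3, hsum⟩
  have := normSq_nonneg x
  have := normSq_nonneg y
  have := normSq_nonneg z
  obtain ⟨x', y', z', hsub', hE', hs⟩ := ih (normSq x + normSq y + normSq z).toNat (by omega)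
    x y z (by omega)
  exact ⟨x', y', z', hsub.trans hsub', hE', hs.trans hsum⟩

theorem frame_inj {u w : ℤ × ℤ} (h : cross u w = 1 ∨ cross u w = -1) {o p q : ℤ × ℤ}
    (he : frame o u w p = frame o u w q) : p = q :=
  add_right_cancel (frame_add_eq h (q := p) (s := p) (by rw [he]))

theorem frame_zero (o u w : ℤ × ℤ) : frame o u w (0, 0) = o := by simp [frame]

theorem LConv.comap_frame_diff {A : Set (ℤ × ℤ)} {v : ℤ × ℤ} (hA : LConv (A \ {v})) {u w : ℤ × ℤ}
    (h : cross u w = 1 ∨ cross u w = -1) : LConv ({p | frame v u w p ∈ A} \ {(0, 0)}) := by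
  convert hA.comap_frame v u w using 1
  ext p
  have : p = (0, 0) ↔ frame v u w p = v :=
    ⟨fun hp => by rw [hp, frame_zero], fun hp => frame_inj h (hp.trans (frame_zero v u w).symm)⟩
  simp [this]

/-- Removing an extreme point `v` from a triple consisting of a lattice basis at `v`. -/
theorem exists_conn_diff_of_basis {A : Set (ℤ × ℤ)} (hA : LConv A) {v : ℤ × ℤ}
    (hB : LConv (A \ {v})) (hv : v ∈ A) {p q x y z : ℤ × ℤ} (hp : p ∈ A) (hq : q ∈ A)
    (hdet : cross (p - v) (q - v) = 1 ∨ cross (p - v) (q - v) = -1) (hx : x ∈ A \ {v})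
    (hy : y ∈ A \ {v}) (hz : z ∈ A \ {v}) (hsum : x + y + z = v + p + q) :
    ∃ r1 r2 r3, r1 ∈ A \ {v} ∧ r2 ∈ A \ {v} ∧ r3 ∈ A \ {v} ∧
      Conn A {v, p, q} {r1, r2, r3} := by
  have hpv : p ≠ v := by rintro rfl; simp [cross] at hdet
  have hqv : q ≠ v := by rintro rfl; simp [cross] at hdet
  -- a point on the negative side of the first axis allows a move
  have side : ∀ p q, p ∈ A → q ∈ A → p ≠ v → q ≠ v →
      (cross (p - v) (q - v) = 1 ∨ cross (p - v) (q - v) = -1) → ∀ s r : ℤ, 1 ≤ r → r ≤ s →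
      frame v (p - v) (q - v) (-s, r) ∈ A → ∃ r1 r2 r3, r1 ∈ A \ {v} ∧ r2 ∈ A \ {v} ∧
        r3 ∈ A \ {v} ∧ Conn A {v, p, q} {r1, r2, r3} := by
    intro p q hp hq hpv hqv hdet s r hr hrs hmem
    have hA0 := hA.comap_frame v (p - v) (q - v)
    have h0 : (0, 0) ∈ {x | frame v (p - v) (q - v) x ∈ A} := by
      rw [Set.mem_ofPred_eq, frame_zero]; exact hv
    have h1 : (0, 1) ∈ {x | frame v (p - v) (q - v) x ∈ A} := by
      rw [Set.mem_ofPred_eq]; convert hq; ext <;> simp [frame]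
    have hg : (-1, 1) ∈ {x | frame v (p - v) (q - v) x ∈ A} :=
      hA0 (b := (0, 1)) (c := (0, 0)) hmem h1 h0 ⟨1, s - r, r - 1, by norm_num, by omega, by omega,
        by omega, by simp only []; ring, by simp only []; ring⟩
    rw [Set.mem_ofPred_eq] at hg
    have hgv : frame v (p - v) (q - v) (-1, 1) ≠ v := by
      intro h
      have := frame_inj hdet (h.trans (frame_zero v (p - v) (q - v)).symm)
      simp at this
    refine ⟨p, p, frame v (p - v) (q - v) (-1, 1), ⟨hp, hpv⟩, ⟨hp, hpv⟩, ⟨hg, hgv⟩, ?_⟩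
    have c : Conn A {p, v, q} {p, p, frame v (p - v) (q - v) (-1, 1)} :=
      .move hp hv hq hp hg (by ext <;> simp [frame] <;> ring)
    rw [multiset_rot v p q, multiset_swap p q v]
    exact c
  have low : ∀ x ∈ A \ {v}, ∀ s t, x = frame v (p - v) (q - v) (s, t) → s + t ≤ 0 →
      ∃ r1 r2 r3, r1 ∈ A \ {v} ∧ r2 ∈ A \ {v} ∧ r3 ∈ A \ {v} ∧
        Conn A {v, p, q} {r1, r2, r3} := by
    intro x hx s t hst hle
    by_cases hs : s ≤ 0
    · by_cases ht : t ≤ 0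
      · refine absurd rfl (hB hx (b := p) (c := q) (p := v) ⟨hp, hpv⟩ ⟨hq, hqv⟩
          ⟨1, -s, -t, by norm_num, by omega, by omega, by omega, ?_, ?_⟩).2 <;>
          simp only [hst, frame, Prod.fst_sub, Prod.snd_sub] <;> ring
      · exact side p q hp hq hpv hqv hdet (-s) t (by omega) (by omega)
          (by rw [neg_neg, ← hst]; exact hx.1)
    · rw [multiset_swap]
      refine side q p hq hp hqv hpv ?_ (-t) s (by omega) (by omega) ?_
      · have : cross (q - v) (p - v) = -cross (p - v) (q - v) := by simp only [cross]; ring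
        rw [this]; omega
      · convert hx.1
        rw [hst]; ext <;> simp only [frame] <;> ring
  obtain ⟨⟨x1, x2⟩, fx⟩ := exists_frame_eq hdet v x
  obtain ⟨⟨y1, y2⟩, fy⟩ := exists_frame_eq hdet v y
  obtain ⟨⟨z1, z2⟩, fz⟩ := exists_frame_eq hdet v z
  by_cases h1 : x1 + x2 ≤ 0
  · exact low x hx _ _ fx.symm h1
  by_cases h2 : y1 + y2 ≤ 0
  · exact low y hy _ _ fy.symm h2
  by_cases h3 : z1 + z2 ≤ 0
  · exact low z hz _ _ fz.symm h3
  exfalso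
  have e : frame v (p - v) (q - v) (x1 + y1 + z1, x2 + y2 + z2) +
      frame v (p - v) (q - v) (0, 0) = frame v (p - v) (q - v) (1, 0) +
        frame v (p - v) (q - v) (0, 1) := by
    have e1 : frame v (p - v) (q - v) (x1 + y1 + z1, x2 + y2 + z2) = x + y + z - v - v := by
      rw [← fx, ← fy, ← fz]; ext <;> simp [frame] <;> ring
    rw [e1, hsum, frame_zero]
    ext <;> simp [frame] <;> ring
  have := frame_add_eq hdet e
  simp only [Prod.mk_add_mk, Prod.mk.injEq] at this
  omega

theorem exists_unit_height {A : Set (ℤ × ℤ)} (hA : LConv A) (h0 : (0, 0) ∈ A) (h1 : (1, 0) ∈ A)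
    {x h : ℤ} (hh : h ≠ 0) (hx : (x, h) ∈ A) :
    ∃ f, (f, h.sign) ∈ A ∧ (f - 1) * |h| + 1 ≤ x := by
  have hpos : 0 < |h| := abs_pos.2 hh
  have e1 := Int.emod_nonneg (-x) hpos.ne'
  have e2 := Int.emod_lt_of_pos (-x) hpos
  have e3 := Int.emod_add_mul_ediv (-x) |h|
  refine ⟨-(-x / |h|), hA hx h1 h0 ⟨1, -x % |h|, |h| - 1 - -x % |h|, by norm_num, e1, by omega,
    by omega, ?_, ?_⟩, ?_⟩
  · simp only []; linear_combination -e3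
  · simp only []
    rw [show 1 + -x % |h| + (|h| - 1 - -x % |h|) = |h| by ring, mul_comm, Int.sign_mul_abs]; ring
  · nlinarith

/-- A segment `v w` with an extreme point `v` can be replaced by a lattice basis at `v`. -/
theorem exists_basis_of_height {A : Set (ℤ × ℤ)} (hA : LConv A) (hB : LConv (A \ {(0, 0)}))
    (h0 : (0, 0) ∈ A) (h1 : (1, 0) ∈ A) {x1 x2 y1 y2 z1 z2 : ℤ} (hx : (x1, x2) ∈ A)
    (hy : (y1, y2) ∈ A) (hz : (z1, z2) ∈ A) (s1 : x1 + y1 + z1 ≤ 2) (s2 : x2 + y2 + z2 = 0)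
    {ε : ℤ} (ex : x2.sign = ε) (ey : y2.sign = -ε) (ez : z2.sign = -ε) (hε : ε = 1 ∨ ε = -1) :
    ∃ f, (f, ε) ∈ A ∧ (1 - f, -ε) ∈ A := by
  have hne : ∀ t : ℤ, t.sign = 1 ∨ t.sign = -1 → t ≠ 0 := by rintro t ht rfl; simp at ht
  obtain ⟨f, hf, hfx⟩ := exists_unit_height hA h0 h1 (hne x2 (by omega)) hx
  obtain ⟨f', hf', hfy⟩ := exists_unit_height hA h0 h1 (hne y2 (by omega)) hy
  obtain ⟨f'', hf'', hfz⟩ := exists_unit_height hA h0 h1 (hne z2 (by omega)) hz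
  rw [ex] at hf
  rw [ey] at hf'
  rw [ez] at hf''
  have sep : ∀ g, (g, -ε) ∈ A → 1 ≤ f + g := by
    intro g hg
    by_contra! hlt
    refine absurd rfl (hB (a := (f, ε)) (b := (g, -ε)) (c := (1, 0)) (p := (0, 0)) ⟨hf, ?_⟩ ⟨hg, ?_⟩
      ⟨h1, ?_⟩ ⟨1, 1, -(f + g), by norm_num, by norm_num, by omega, by omega, ?_, ?_⟩).2
    · simp only [Set.mem_singleton_iff, Prod.mk.injEq]; omega
    · simp only [Set.mem_singleton_iff, Prod.mk.injEq]; omega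
    · simp
    · simp only []; ring
    · simp only []; ring
  have g1 := sep f' hf'
  have g2 := sep f'' hf''
  by_cases c1 : f + f' = 1
  · exact ⟨f, hf, by rwa [show 1 - f = f' by omega]⟩
  by_cases c2 : f + f'' = 1
  · exact ⟨f, hf, by rwa [show 1 - f = f'' by omega]⟩
  exfalso
  have ax : |x2| = ε * x2 := by rw [← ex, Int.sign_mul_self_eq_abs]
  have ay : |y2| = -ε * y2 := by rw [← ey, Int.sign_mul_self_eq_abs]
  have az : |z2| = -ε * z2 := by rw [← ez, Int.sign_mul_self_eq_abs]
  have pa : |x2| = |y2| + |z2| := by rw [ax, ay, az]; linear_combination ε * s2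
  have b1 : (1 - f) * |y2| ≤ (f' - 1) * |y2| :=
    mul_le_mul_of_nonneg_right (by omega) (abs_nonneg _)
  have b2 : (1 - f) * |z2| ≤ (f'' - 1) * |z2| :=
    mul_le_mul_of_nonneg_right (by omega) (abs_nonneg _)
  rw [pa] at hfx
  linarith

theorem exists_cross_eq_one {v w : ℤ × ℤ} (hvw : v ≠ w) (h : PrimEdge v w) :
    ∃ u, cross (w - v) u = 1 := by
  obtain ⟨m, hm⟩ : ∃ m, m = w.1 - v.1 := ⟨_, rfl⟩
  obtain ⟨n, hn⟩ : ∃ n, n = w.2 - v.2 := ⟨_, rfl⟩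
  obtain ⟨d, hd⟩ : ∃ d : ℤ, d = Int.gcd m n := ⟨_, rfl⟩
  obtain ⟨s, hs⟩ : d ∣ m := hd ▸ Int.gcd_dvd_left m n
  obtain ⟨t, ht⟩ : d ∣ n := hd ▸ Int.gcd_dvd_right m n
  have hd0 : d ≠ 0 := by
    rintro rfl
    exact hvw (Prod.ext (by linarith) (by linarith))
  have hdpos : 1 ≤ d := by omega
  have he : InTri v w w (v.1 + s, v.2 + t) :=
    ⟨d - 1, 1, 0, by omega, by norm_num, le_rfl, by omega, by simp only []; linear_combination hm - hs,
      by simp only []; linear_combination hn - ht⟩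
  have hd1 : d = 1 := by
    rcases h _ he with h | h
    · obtain ⟨h1, h2⟩ := Prod.ext_iff.1 h
      simp only [add_eq_left] at h1 h2
      rw [h1, mul_zero] at hs
      rw [h2, mul_zero] at ht
      exact absurd (Prod.ext (by linarith) (by linarith)) hvw
    · obtain ⟨h1, h2⟩ := Prod.ext_iff.1 h
      simp only at h1 h2
      have hsm : s = m := by linarith
      have htn : t = n := by linarith
      subst hsm htn
      by_contra hne
      have e1 : (d - 1) * s = 0 := by linarith
      have e2 : (d - 1) * t = 0 := by linarith
      rw [mul_eq_zero] at e1 e2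
      have e1' : s = 0 := by omega
      have e2' : t = 0 := by omega
      exact hvw (Prod.ext (by linarith) (by linarith))
  have hcop : IsCoprime m n := by
    rw [Int.isCoprime_iff_gcd_eq_one]; omega
  obtain ⟨a, b, hab⟩ := hcop
  refine ⟨(-b, a), ?_⟩
  simp only [cross, Prod.fst_sub, Prod.snd_sub, ← hm, ← hn]
  linear_combination hab

theorem exists_basis_of_sum_eq {B : Set (ℤ × ℤ)} (hA : LConv B) (hB : LConv (B \ {(0, 0)}))
    (h0 : (0, 0) ∈ B) (h1 : (1, 0) ∈ B) {x y z : ℤ × ℤ} {m : ℤ} (hm : m = 1 ∨ m = 2)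
    (hx : x ∈ B \ {(0, 0)}) (hy : y ∈ B \ {(0, 0)}) (hz : z ∈ B \ {(0, 0)})
    (hs : x + y + z = (m, 0)) :
    (m = 2 ∧ (x = (1, 0) ∨ y = (1, 0) ∨ z = (1, 0))) ∨
      ∃ f ε, (ε = 1 ∨ ε = -1) ∧ (f, ε) ∈ B ∧ (1 - f, -ε) ∈ B := by
  have h1' : ((1, 0) : ℤ × ℤ) ∈ B \ {(0, 0)} := ⟨h1, by simp⟩
  have key : ∀ x y z : ℤ × ℤ, x ∈ B \ {(0, 0)} → y ∈ B \ {(0, 0)} → z ∈ B \ {(0, 0)} →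
      x + y + z = (m, 0) → z.2 = 0 → m = 2 ∧ z = (1, 0) := by
    rintro ⟨x1, x2⟩ ⟨y1, y2⟩ ⟨z1, z2⟩ hx hy hz hs hz2
    simp only [Prod.mk_add_mk, Prod.mk.injEq] at hs hz2 ⊢
    subst hz2
    have hz1 : 1 ≤ z1 := by
      by_contra! hlt
      exact (hB (p := (0, 0)) hz h1' h1' ⟨1, -z1, 0, by norm_num, by omega, le_rfl, by omega,
        by simp only []; ring, by simp only []; ring⟩).2 rfl
    have hzm : z1 < m := by
      by_contra! hle
      refine (hB (p := (0, 0)) hx hy h1' ⟨1, 1, -(x1 + y1), by norm_num, by norm_num, by omega,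
        by omega, by simp only []; ring, ?_⟩).2 rfl
      simp only []; linarith
    omega
  by_cases hz2 : z.2 = 0
  · have := key x y z hx hy hz hs hz2; tauto
  by_cases hy2 : y.2 = 0
  · have := key x z y hx hz hy (by rw [← hs]; abel) hy2; tauto
  by_cases hx2 : x.2 = 0
  · have := key y z x hy hz hx (by rw [← hs]; abel) hx2; tauto
  right
  obtain ⟨x1, x2⟩ := x
  obtain ⟨y1, y2⟩ := y
  obtain ⟨z1, z2⟩ := z
  simp only [Prod.mk_add_mk, Prod.mk.injEq] at hs hx2 hy2 hz2
  have H : ∀ {x1 x2 y1 y2 z1 z2 ε : ℤ}, (x1, x2) ∈ B → (y1, y2) ∈ B → (z1, z2) ∈ B →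
      x1 + y1 + z1 ≤ 2 → x2 + y2 + z2 = 0 → x2.sign = ε → y2.sign = -ε → z2.sign = -ε →
      (ε = 1 ∨ ε = -1) → ∃ f ε, (ε = 1 ∨ ε = -1) ∧ (f, ε) ∈ B ∧ (1 - f, -ε) ∈ B :=
    fun hx hy hz s1 s2 ex ey ez hε =>
      (exists_basis_of_height hA hB h0 h1 hx hy hz s1 s2 ex ey ez hε).imp fun f hf => ⟨_, hε, hf⟩
  rcases lt_or_gt_of_ne hx2 with cx | cx <;> rcases lt_or_gt_of_ne hy2 with cy | cy <;>
    rcases lt_or_gt_of_ne hz2 with cz | cz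
  · omega
  · exact H hz.1 hx.1 hy.1 (by omega) (by omega) (Int.sign_eq_one_of_pos cz)
      (Int.sign_eq_neg_one_of_neg cx) (Int.sign_eq_neg_one_of_neg cy) (.inl rfl)
  · exact H hy.1 hx.1 hz.1 (by omega) (by omega) (Int.sign_eq_one_of_pos cy)
      (Int.sign_eq_neg_one_of_neg cx) (Int.sign_eq_neg_one_of_neg cz) (.inl rfl)
  · exact H hx.1 hy.1 hz.1 (by omega) (by omega) (Int.sign_eq_neg_one_of_neg cx)
      (Int.sign_eq_one_of_pos cy) (Int.sign_eq_one_of_pos cz) (.inr rfl)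
  · exact H hx.1 hy.1 hz.1 (by omega) (by omega) (Int.sign_eq_one_of_pos cx)
      (Int.sign_eq_neg_one_of_neg cy) (Int.sign_eq_neg_one_of_neg cz) (.inl rfl)
  · exact H hy.1 hx.1 hz.1 (by omega) (by omega) (Int.sign_eq_neg_one_of_neg cy)
      (Int.sign_eq_one_of_pos cx) (Int.sign_eq_one_of_pos cz) (.inr rfl)
  · exact H hz.1 hx.1 hy.1 (by omega) (by omega) (Int.sign_eq_neg_one_of_neg cz)
      (Int.sign_eq_one_of_pos cx) (Int.sign_eq_one_of_pos cy) (.inr rfl)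
  · omega

/-- Removing an extreme point `v` from a triple supported on a primitive edge at `v`. -/
theorem exists_conn_diff_of_edge {A : Set (ℤ × ℤ)} (hA : LConv A) {v : ℤ × ℤ}
    (hB : LConv (A \ {v})) (hv : v ∈ A) {w q x y z : ℤ × ℤ} (hw : w ∈ A) (hvw : v ≠ w)
    (hE : PrimEdge v w) (hq : q = v ∨ q = w) (hx : x ∈ A \ {v}) (hy : y ∈ A \ {v})
    (hz : z ∈ A \ {v}) (hsum : x + y + z = v + w + q) :
    ∃ r1 r2 r3, r1 ∈ A \ {v} ∧ r2 ∈ A \ {v} ∧ r3 ∈ A \ {v} ∧ Conn A {v, w, q} {r1, r2, r3} := by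
  obtain ⟨u, hu⟩ := exists_cross_eq_one hvw hE
  have hu' := Or.inl (b := cross (w - v) u = -1) hu
  have f0 := frame_zero v (w - v) u
  have f1 : frame v (w - v) u (1, 0) = w := by ext <;> simp [frame]
  have hA0 := hA.comap_frame v (w - v) u
  have hB0 := hB.comap_frame_diff (u := w - v) (w := u) hu'
  have mem : ∀ x x', x ∈ A \ {v} → frame v (w - v) u x' = x →
      x' ∈ {p | frame v (w - v) u p ∈ A} \ {(0, 0)} := by
    rintro _ x' ⟨h, hne⟩ rfl
    refine ⟨h, ?_⟩
    rintro rfl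
    exact hne f0
  obtain ⟨x', fx⟩ := exists_frame_eq hu' v x
  obtain ⟨y', fy⟩ := exists_frame_eq hu' v y
  obtain ⟨z', fz⟩ := exists_frame_eq hu' v z
  obtain ⟨m, hm, hfm⟩ : ∃ m : ℤ, ((m = 1 ∧ q = v) ∨ (m = 2 ∧ q = w)) ∧
      frame v (w - v) u (m, 0) = w + q - v := by
    rcases hq with rfl | rfl
    · exact ⟨1, by simp, by rw [f1]; abel⟩
    · exact ⟨2, by simp, by ext <;> simp [frame] <;> ring⟩
  have hs : x' + y' + z' = (m, 0) := by
    refine frame_inj hu' (hfm.symm ▸ ?_ : _ = frame v (w - v) u (m, 0))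
    have : frame v (w - v) u (x' + y' + z') = x + y + z - v - v := by
      rw [← fx, ← fy, ← fz]; ext <;> simp [frame] <;> ring
    rw [this, hsum]; abel
  rcases exists_basis_of_sum_eq hA0 hB0 (by rw [Set.mem_ofPred_eq, f0]; exact hv)
    (by rw [Set.mem_ofPred_eq, f1]; exact hw) (hm.imp And.left And.left) (mem x x' hx fx) (mem y y' hy fy)
    (mem z z' hz fz) hs with ⟨rfl, h⟩ | ⟨f, ε, hε, hg, hg'⟩
  · obtain rfl : q = w := hm.elim (fun h => absurd h.1 (by norm_num)) And.right
    have share : ∀ x y z : ℤ × ℤ, x ∈ A \ {v} → y ∈ A \ {v} → z ∈ A \ {v} →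
        x + y + z = v + q + q → x = q → ∃ r1 r2 r3, r1 ∈ A \ {v} ∧ r2 ∈ A \ {v} ∧
          r3 ∈ A \ {v} ∧ Conn A {v, q, q} {r1, r2, r3} := by
      rintro x y z hx hy hz hsum rfl
      refine ⟨x, y, z, hx, hy, hz, ?_⟩
      rw [← multiset_rot x v x]
      exact .move hw hv hw hy.1 hz.1 (by
        have : x + (y + z) = x + (v + x) := by rw [← add_assoc, hsum]; abel
        exact (add_left_cancel this).symm)
    rcases h with rfl | rfl | rfl
    · exact share x y z hx hy hz hsum (fx.symm.trans f1)
    · exact share y x z hy hx hz (by rw [← hsum]; abel) (fy.symm.trans f1)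
    · exact share z x y hz hx hy (by rw [← hsum]; abel) (fz.symm.trans f1)
  · rw [Set.mem_ofPred_eq] at hg hg'
    have ne : ∀ f ε : ℤ, (ε = 1 ∨ ε = -1) → frame v (w - v) u (f, ε) ≠ v := by
      intro f ε hε h
      have := frame_inj hu' (h.trans f0.symm)
      simp only [Prod.mk.injEq] at this
      omega
    have hadd : v + w = frame v (w - v) u (f, ε) + frame v (w - v) u (1 - f, -ε) := by
      ext <;> simp [frame] <;> ring
    have gv := ne f ε hε
    have gv' := ne (1 - f) (-ε) (by omega)
    rcases hq with rfl | rfl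
    · have c : Conn A {q, w, q} {q, frame q (w - q) u (f, ε), frame q (w - q) u (1 - f, -ε)} := by
        rw [multiset_swap]
        exact .move hv hv hw hg hg' hadd
      have hcr : cross (frame q (w - q) u (f, ε) - q) (frame q (w - q) u (1 - f, -ε) - q) =
          -ε * cross (w - q) u := by
        simp only [cross, frame, Prod.fst_sub, Prod.snd_sub]; ring
      obtain ⟨r1, r2, r3, h1, h2, h3, hc⟩ := exists_conn_diff_of_basis hA hB hv hg hg'
        (by rw [hcr, hu]; omega) hx hy hz (by rw [hsum, hadd]; abel)
      exact ⟨r1, r2, r3, h1, h2, h3, c.trans hc⟩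
    · refine ⟨q, _, _, ⟨hw, hvw.symm⟩, ⟨hg, gv⟩, ⟨hg', gv'⟩, ?_⟩
      rw [← multiset_rot q v q]
      exact .move hw hv hw hg hg' hadd

theorem InTri.one_one_one {x y z v : ℤ × ℤ} (h : x + y + z = v + v + v) : InTri x y z v := by
  obtain ⟨h1, h2⟩ := Prod.ext_iff.1 h
  simp only [Prod.fst_add, Prod.snd_add] at h1 h2
  exact ⟨1, 1, 1, by norm_num, by norm_num, by norm_num, by norm_num, by linarith, by linarith⟩

/-- A set obtained by deleting its lexicographically largest point is still lattice convex. -/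
theorem LConv.diff_of_lexLT {A : Set (ℤ × ℤ)} (hA : LConv A) {v : ℤ × ℤ}
    (hmax : ∀ a ∈ A, a ≠ v → LexLT a v) : LConv (A \ {v}) := by
  intro a b c p ha hb hc h
  refine ⟨hA ha.1 hb.1 hc.1 h, ?_⟩
  rintro rfl
  exact h.not_lexLT (hmax a ha.1 ha.2) (hmax b hb.1 hb.2) (hmax c hc.1 hc.2)

theorem EmptyTri.dt_le_one {a b c : ℤ × ℤ} (h : EmptyTri a b c) : dt a b c ≤ 1 := by
  by_contra! h2
  obtain ⟨p, hp, h1, h2, h3⟩ := exists_inTri_of_two_le h2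
  have := h p hp
  tauto

/-- An empty triple containing an extreme point `v` can be connected to a triple avoiding `v`
provided that some triple with the same sum avoids `v`. -/
theorem exists_conn_diff {A : Set (ℤ × ℤ)} (hA : LConv A) {v : ℤ × ℤ}
    (hmax : ∀ a ∈ A, a ≠ v → LexLT a v) (hv : v ∈ A) {p q x y z : ℤ × ℤ} (hp : p ∈ A) (hq : q ∈ A)
    (hE : EmptyTri v p q) (hx : x ∈ A \ {v}) (hy : y ∈ A \ {v})
    (hz : z ∈ A \ {v}) (hsum : x + y + z = v + p + q) :
    ∃ r1 r2 r3, r1 ∈ A \ {v} ∧ r2 ∈ A \ {v} ∧ r3 ∈ A \ {v} ∧ Conn A {v, p, q} {r1, r2, r3} := by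
  have hB := hA.diff_of_lexLT hmax
  by_cases hD : dt v p q = 0
  swap
  · have h1 := hE.dt_le_one
    have h2 := hE.swap.dt_le_one
    rw [dt_swap] at h2
    refine exists_conn_diff_of_basis hA hB hv hp hq ?_ hx hy hz hsum
    have : cross (p - v) (q - v) = dt v p q := rfl
    omega
  have edge : ∀ w, (∀ e, InTri v w w e → InTri v p q e) → (∀ e, e = p ∨ e = q → e = v ∨ e = w) →
      PrimEdge v w := by
    intro w h1 h2 e he
    rcases hE e (h1 e he) with h | h | h
    · exact .inl h
    · exact h2 e (.inl h)
    · exact h2 e (.inr h)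
  by_cases hpv : p = v
  · subst hpv
    by_cases hqp : q = p
    · subst hqp
      exact absurd rfl (hB hx hy hz (.one_one_one hsum)).2
    · rw [multiset_swap]
      refine exists_conn_diff_of_edge hA hB hv hq (Ne.symm hqp) (edge q ?_ ?_) (.inl rfl) hx hy hz
        (by rw [hsum]; abel)
      · exact fun e he => InTri.comp .left .right .right he
      · tauto
  by_cases hqv : q = v
  · subst hqv
    refine exists_conn_diff_of_edge hA hB hv hp (Ne.symm hpv) (edge p ?_ ?_) (.inl rfl) hx hy hz hsum
    · exact fun e he => InTri.comp .left .mid .mid he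
    · tauto
  by_cases hpq : p = q
  · subst hpq
    refine exists_conn_diff_of_edge hA hB hv hp (Ne.symm hpv) (edge p ?_ ?_) (.inr rfl) hx hy hz hsum
    · exact fun e he => InTri.comp .left .mid .mid he
    · tauto
  have collinear : ∀ p q, p ∈ A → q ∈ A → p ≠ v → q ≠ v → p ≠ q → dt v p q = 0 → LexLT p q →
      ∃ r1 r2 r3, r1 ∈ A \ {v} ∧ r2 ∈ A \ {v} ∧ r3 ∈ A \ {v} ∧
        Conn A {v, p, q} {r1, r2, r3} := by
    intro p q hp hq hpv hqv hpq hD hlt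
    have hseg : InTri p v v q := InTri.of_lexLT (by rw [dt_rot]; exact hD) hlt (hmax q hq hqv)
    have hmem := hA hp hv hv hseg.edge_compl
    refine ⟨q, q, p + v - q, ⟨hq, hqv⟩, ⟨hq, hqv⟩, ⟨hmem, ?_⟩, ?_⟩
    · intro h
      rw [Set.mem_singleton_iff, sub_eq_iff_eq_add, add_comm v q] at h
      exact hpq (add_right_cancel h)
    · rw [← multiset_rot q v p]
      exact .move hq hv hp hq hmem (by abel)
  rcases LexLT.trichotomy p q with h | h | h
  · exact collinear p q hp hq hpv hqv hpq hD h
  · exact absurd h hpq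
  · rw [multiset_swap]
    exact collinear q p hq hp hqv hpv (Ne.symm hpq) (by rw [dt_swap, hD, neg_zero]) h

theorem exists_lexMax {A : Set (ℤ × ℤ)} (hfin : A.Finite) (hne : A.Nonempty) :
    ∃ v ∈ A, ∀ a ∈ A, a ≠ v → LexLT a v := by
  obtain ⟨v, hv, hmax⟩ := Set.exists_max_image A (fun a => toLex a) hfin hne
  refine ⟨v, hv, fun a ha hne => ?_⟩
  have := hmax a ha
  rw [Prod.Lex.toLex_le_toLex] at this
  refine this.imp_right fun h => ⟨h.1, lt_of_le_of_ne h.2 fun h2 => hne (Prod.ext h.1 h2)⟩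

theorem EmptyTri.exists_of_mem {a b c v : ℤ × ℤ} (h : EmptyTri a b c)
    (hv : v = a ∨ v = b ∨ v = c) :
    ∃ p q, EmptyTri v p q ∧ ({a, b, c} : Multiset (ℤ × ℤ)) = {v, p, q} := by
  rcases hv with rfl | rfl | rfl
  · exact ⟨b, c, h, rfl⟩
  · exact ⟨c, a, h.rot, multiset_rot a v c⟩
  · exact ⟨a, b, h.rot.rot, (multiset_rot v a b).symm⟩

theorem sum_triple (a b c : ℤ × ℤ) : ({a, b, c} : Multiset (ℤ × ℤ)).sum = a + b + c := by
  simp [add_assoc]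

/-- Any two empty triples with the same sum are connected. -/
theorem LConv.conn_of_emptyTri {A : Set (ℤ × ℤ)} (hA : LConv A) (hfin : A.Finite)
    {a b c a' b' c' : ℤ × ℤ} (ha : a ∈ A) (hb : b ∈ A) (hc : c ∈ A) (ha' : a' ∈ A) (hb' : b' ∈ A)
    (hc' : c' ∈ A) (hE : EmptyTri a b c) (hE' : EmptyTri a' b' c')
    (hsum : a + b + c = a' + b' + c') : Conn A {a, b, c} {a', b', c'} := by
  obtain ⟨n, hn⟩ : ∃ n, A.ncard = n := ⟨_, rfl⟩
  induction n using Nat.strong_induction_on generalizing A a b c a' b' c' with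
  | _ n ih =>
  obtain ⟨v, hv, hmax⟩ := exists_lexMax hfin ⟨a, ha⟩
  have hB := hA.diff_of_lexLT hmax
  have hcard : (A \ {v}).ncard < n := hn ▸ Set.ncard_sdiff_singleton_lt_of_mem hv hfin
  have memA : ∀ {a b c p q : ℤ × ℤ}, a ∈ A → b ∈ A → c ∈ A →
      ({a, b, c} : Multiset (ℤ × ℤ)) = {v, p, q} → p ∈ A ∧ q ∈ A := by
    intro a b c p q ha hb hc h
    have hall : ∀ x ∈ ({a, b, c} : Multiset (ℤ × ℤ)), x ∈ A := by
      intro x hx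
      simp only [Multiset.insert_eq_cons, Multiset.mem_cons, Multiset.mem_singleton] at hx
      rcases hx with rfl | rfl | rfl <;> assumption
    rw [h] at hall
    exact ⟨hall p (by simp), hall q (by simp)⟩
  have mixed : ∀ {a b c a' b' c' : ℤ × ℤ}, a ∈ A → b ∈ A → c ∈ A → a' ∈ A → b' ∈ A → c' ∈ A →
      EmptyTri a b c → EmptyTri a' b' c' → a + b + c = a' + b' + c' → (v = a ∨ v = b ∨ v = c) →
      ¬ (v = a' ∨ v = b' ∨ v = c') → Conn A {a, b, c} {a', b', c'} := by
    intro a b c a' b' c' ha hb hc ha' hb' hc' hE hE' hsum h h'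
    push Not at h'
    obtain ⟨p, q, hE1, he⟩ := hE.exists_of_mem h
    obtain ⟨hp, hq⟩ := memA ha hb hc he
    have hsum1 : a' + b' + c' = v + p + q := by rw [← hsum, ← sum_triple, he, sum_triple]
    have ha1 : a' ∈ A \ {v} := ⟨ha', h'.1.symm⟩
    have hb1 : b' ∈ A \ {v} := ⟨hb', h'.2.1.symm⟩
    have hc1 : c' ∈ A \ {v} := ⟨hc', h'.2.2.symm⟩
    obtain ⟨r1, r2, r3, h1, h2, h3, hconn⟩ := exists_conn_diff hA hmax hv hp hq hE1 ha1 hb1 hc1 hsum1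
    have hI : ¬ Isolated A r1 r2 r3 := by
      intro hI
      have h4 := (hconn.eq_iff_of_isolated hI).2 rfl
      have h5 : v ∈ ({r1, r2, r3} : Multiset (ℤ × ℤ)) := by rw [h4]; simp
      simp only [Multiset.insert_eq_cons, Multiset.mem_cons, Multiset.mem_singleton] at h5
      rcases h5 with rfl | rfl | rfl
      · exact h1.2 rfl
      · exact h2.2 rfl
      · exact h3.2 rfl
    obtain ⟨x, y, z, hsub, hE2, hconn2⟩ := exists_conn_emptyTri hA h1.1 h2.1 h3.1 (.inr hI)
    obtain ⟨hx, hy, hz⟩ := hsub.mem hB h1 h2 h3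
    rw [he]
    have hc3 := hconn.trans hconn2
    refine hc3.trans (Conn.mono Set.sdiff_subset (ih _ hcard hB (hfin.subset Set.sdiff_subset) hx hy hz
      ha1 hb1 hc1 hE2 hE' ?_ rfl))
    have := hc3.sum_eq
    rw [sum_triple, sum_triple] at this
    rw [← this, hsum1]
  by_cases h : v = a ∨ v = b ∨ v = c <;> by_cases h' : v = a' ∨ v = b' ∨ v = c'
  · obtain ⟨p, q, hE1, he⟩ := hE.exists_of_mem h
    obtain ⟨p', q', hE1', he'⟩ := hE'.exists_of_mem h'
    obtain ⟨hp, hq⟩ := memA ha hb hc he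
    obtain ⟨hp', hq'⟩ := memA ha' hb' hc' he'
    rw [he, he']
    refine .move hv hp hq hp' hq' (add_left_cancel (a := v) ?_)
    rw [← sum_triple, ← sum_triple, he, he', sum_triple, sum_triple] at hsum
    rw [← add_assoc, ← add_assoc, hsum]
  · exact mixed ha hb hc ha' hb' hc' hE hE' hsum h h'
  · exact (mixed ha' hb' hc' ha hb hc hE' hE hsum.symm h' h).symm
  · push Not at h h'
    exact Conn.mono Set.sdiff_subset (ih _ hcard hB (hfin.subset Set.sdiff_subset) ⟨ha, h.1.symm⟩
      ⟨hb, h.2.1.symm⟩ ⟨hc, h.2.2.symm⟩ ⟨ha', h'.1.symm⟩ ⟨hb', h'.2.1.symm⟩ ⟨hc', h'.2.2.symm⟩ hE hE'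
      hsum rfl)

theorem LConv.conn_of_sum_eq {A : Set (ℤ × ℤ)} (hA : LConv A) (hfin : A.Finite)
    {a b c a' b' c' : ℤ × ℤ} (ha : a ∈ A) (hb : b ∈ A) (hc : c ∈ A) (ha' : a' ∈ A) (hb' : b' ∈ A)
    (hc' : c' ∈ A) (h : EmptyTri a b c ∨ ¬ Isolated A a b c)
    (h' : EmptyTri a' b' c' ∨ ¬ Isolated A a' b' c') (hsum : a + b + c = a' + b' + c') :
    Conn A {a, b, c} {a', b', c'} := by
  obtain ⟨x, y, z, hs, hE, hC⟩ := exists_conn_emptyTri hA ha hb hc h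
  obtain ⟨x', y', z', hs', hE', hC'⟩ := exists_conn_emptyTri hA ha' hb' hc' h'
  obtain ⟨hx, hy, hz⟩ := hs.mem hA ha hb hc
  obtain ⟨hx', hy', hz'⟩ := hs'.mem hA ha' hb' hc'
  refine hC.trans ((hA.conn_of_emptyTri hfin hx hy hz hx' hy' hz' hE hE' ?_).trans hC'.symm)
  rw [← sum_triple, ← sum_triple, ← hC.sum_eq, ← hC'.sum_eq, sum_triple, sum_triple, hsum]

/-- The multiset of lattice points underlying an exponent vector. -/
def pts {Γ : Set (ℝ × ℝ)} (s : LatPt Γ →₀ ℕ) : Multiset (ℤ × ℤ) :=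
  (Finsupp.toMultiset s).map Subtype.val

theorem pts_zero {Γ : Set (ℝ × ℝ)} : pts (0 : LatPt Γ →₀ ℕ) = 0 := by simp [pts]

theorem pts_add {Γ : Set (ℝ × ℝ)} (s t : LatPt Γ →₀ ℕ) : pts (s + t) = pts s + pts t := by
  simp [pts]

theorem pts_single {Γ : Set (ℝ × ℝ)} (p : LatPt Γ) (n : ℕ) :
    pts (Finsupp.single p n) = n • ({p.1} : Multiset (ℤ × ℤ)) := by
  simp [pts, Finsupp.toMultiset_single, Multiset.map_nsmul]

theorem pts_injective {Γ : Set (ℝ × ℝ)} : Function.Injective (pts (Γ := Γ)) :=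
  (Multiset.map_injective Subtype.val_injective).comp Multiset.toFinsupp.symm.injective

theorem card_pts {Γ : Set (ℝ × ℝ)} (s : LatPt Γ →₀ ℕ) : Multiset.card (pts s) = s.degree := by
  rw [pts, Multiset.card_map, Finsupp.card_toMultiset, Finsupp.degree_apply, Finsupp.sum]
  rfl

theorem mem_of_mem_pts {Γ : Set (ℝ × ℝ)} {s : LatPt Γ →₀ ℕ} {p : ℤ × ℤ} (h : p ∈ pts s) :
    p ∈ latticePts Γ := by
  obtain ⟨q, -, rfl⟩ := Multiset.mem_map.1 h
  exact q.2

theorem exists_pts_eq {Γ : Set (ℝ × ℝ)} (m : Multiset (ℤ × ℤ)) (h : ∀ p ∈ m, p ∈ latticePts Γ) :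
    ∃ s : LatPt Γ →₀ ℕ, pts s = m := by
  induction m using Multiset.induction_on with
  | empty => exact ⟨0, pts_zero⟩
  | cons p m ih =>
    obtain ⟨s, hs⟩ := ih fun q hq => h q (Multiset.mem_cons_of_mem hq)
    refine ⟨Finsupp.single ⟨p, h p (Multiset.mem_cons_self p m)⟩ 1 + s, ?_⟩
    rw [pts_add, pts_single, hs, one_nsmul, Multiset.singleton_add]

theorem exists_pts_eq_triple {Γ : Set (ℝ × ℝ)} {s : LatPt Γ →₀ ℕ} (h : s.degree = 3) :
    ∃ a b c, a ∈ latticePts Γ ∧ b ∈ latticePts Γ ∧ c ∈ latticePts Γ ∧ pts s = {a, b, c} := by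
  rw [← card_pts, Multiset.card_eq_three] at h
  obtain ⟨a, b, c, h⟩ := h
  have hm := fun p => mem_of_mem_pts (s := s) (p := p)
  rw [h] at hm
  exact ⟨a, b, c, hm a (by simp), hm b (by simp), hm c (by simp), h⟩

/-- The weight of a monomial under `chi`. -/
def wt {Γ : Set (ℝ × ℝ)} (s : LatPt Γ →₀ ℕ) : ℤ × ℤ × ℕ :=
  ((pts s).sum.1, (pts s).sum.2, Multiset.card (pts s))

theorem wt_add {Γ : Set (ℝ × ℝ)} (s t : LatPt Γ →₀ ℕ) : wt (s + t) = wt s + wt t := by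
  simp [wt, pts_add]

theorem wt_eq_iff {Γ : Set (ℝ × ℝ)} {s t : LatPt Γ →₀ ℕ} :
    wt s = wt t ↔ (pts s).sum = (pts t).sum ∧ s.degree = t.degree := by
  simp only [wt, card_pts, Prod.ext_iff, and_assoc]

theorem chi_monomial (k : Type*) [Field k] (Γ : Set (ℝ × ℝ)) (s : LatPt Γ →₀ ℕ) (c : k) :
    chi k Γ (MvPolynomial.monomial s c) = AddMonoidAlgebra.single (wt s) c := by
  have h1 : chi k Γ (MvPolynomial.monomial s 1) = AddMonoidAlgebra.single (wt s) 1 := by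
    induction s using Finsupp.induction_linear with
    | zero =>
      rw [← MvPolynomial.one_def, map_one]
      simp [wt, pts_zero, AddMonoidAlgebra.one_def]
      rfl
    | add s t hs ht =>
      rw [show MvPolynomial.monomial (s + t) (1 : k) = MvPolynomial.monomial s 1 *
        MvPolynomial.monomial t 1 by rw [MvPolynomial.monomial_mul, one_mul], map_mul, hs, ht,
        AddMonoidAlgebra.single_mul_single, one_mul, wt_add]
    | single p n =>
      rw [← MvPolynomial.X_pow_eq_monomial, map_pow, chi, MvPolynomial.aeval_X,
        AddMonoidAlgebra.single_pow, one_pow]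
      congr 1
      simp [wt, pts_single, Multiset.sum_nsmul]
  rw [← mul_one c, ← smul_eq_mul, ← MvPolynomial.smul_monomial, map_smul, h1,
    AddMonoidAlgebra.smul_single]

theorem coeff_chi (k : Type*) [Field k] (Γ : Set (ℝ × ℝ)) (f : MvPolynomial (LatPt Γ) k)
    (m : ℤ × ℤ × ℕ) :
    (chi k Γ f).coeff m = ∑ u ∈ f.support with wt u = m, f.coeff u := by
  conv_lhs => rw [f.as_sum, map_sum]
  rw [AddMonoidAlgebra.coeff_sum, Finsupp.finsetSum_apply, Finset.sum_filter]
  refine Finset.sum_congr rfl fun u _ => ?_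
  rw [chi_monomial, AddMonoidAlgebra.coeff_single, Finsupp.single_apply]

/-- The monomial attached to a multiset of lattice points. -/
def monoOf (k : Type*) [Field k] (Γ : Set (ℝ × ℝ)) (m : Multiset (ℤ × ℤ)) :
    MvPolynomial (LatPt Γ) k :=
  open Classical in
  (m.map fun p => if h : toR p ∈ Γ then MvPolynomial.X ⟨p, h⟩ else 0).prod

theorem monoOf_pts (k : Type*) [Field k] (Γ : Set (ℝ × ℝ)) (s : LatPt Γ →₀ ℕ) :
    monoOf k Γ (pts s) = MvPolynomial.monomial s 1 := by
  induction s using Finsupp.induction_linear with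
  | zero => rw [pts_zero]; rfl
  | add s t hs ht =>
    rw [pts_add, monoOf, Multiset.map_add, Multiset.prod_add]
    rw [monoOf] at hs ht
    rw [hs, ht, MvPolynomial.monomial_mul, one_mul]
  | single p n =>
    rw [pts_single, monoOf, Multiset.map_nsmul, Multiset.prod_nsmul, Multiset.map_singleton,
      Multiset.prod_singleton, dif_pos p.2, MvPolynomial.X_pow_eq_monomial]

theorem sub_mem_toricIdealDeg (k : Type*) [Field k] {Γ : Set (ℝ × ℝ)} {s t : LatPt Γ →₀ ℕ}
    {d : ℕ} (hs : s.degree = d) (ht : t.degree = d) (h : (pts s).sum = (pts t).sum) :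
    MvPolynomial.monomial s (1 : k) - MvPolynomial.monomial t 1 ∈ toricIdealDeg k Γ d := by
  refine ⟨?_, ?_⟩
  · change chi k Γ _ = 0
    rw [map_sub, chi_monomial, chi_monomial, wt_eq_iff.2 ⟨h, hs.trans ht.symm⟩, sub_self]
  · exact sub_mem (MvPolynomial.isHomogeneous_monomial 1 hs)
      (MvPolynomial.isHomogeneous_monomial 1 ht)

theorem Conn.monoOf_sub_mem (k : Type*) [Field k] {Γ : Set (ℝ × ℝ)} {s t : Multiset (ℤ × ℤ)}
    (h : Conn (latticePts Γ) s t) : monoOf k Γ s - monoOf k Γ t ∈ quadIdeal k Γ := by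
  induction h with
  | refl s => rw [sub_self]; exact zero_mem _
  | symm _ ih => rw [← neg_sub]; exact neg_mem ih
  | @trans s t r _ _ ih1 ih2 =>
    rw [← sub_add_sub_cancel (monoOf k Γ s) (monoOf k Γ t)]; exact add_mem ih1 ih2
  | @move a b c b' c' ha hb hc hb' hc' h =>
    obtain ⟨s, hs⟩ := exists_pts_eq (Γ := Γ) {b, c} (by simp [hb, hc])
    obtain ⟨t, ht⟩ := exists_pts_eq (Γ := Γ) {b', c'} (by simp [hb', hc'])
    have hmul : ∀ m, monoOf k Γ (a ::ₘ m) = monoOf k Γ {a} * monoOf k Γ m := by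
      intro m; simp [monoOf]
    change monoOf k Γ (a ::ₘ {b, c}) - monoOf k Γ (a ::ₘ {b', c'}) ∈ _
    rw [hmul, hmul, ← mul_sub, ← hs, ← ht, monoOf_pts, monoOf_pts]
    refine Ideal.mul_mem_left _ _ (Ideal.subset_span ?_)
    exact sub_mem_toricIdealDeg k (by rw [← card_pts, hs]; rfl) (by rw [← card_pts, ht]; rfl)
      (by rw [hs, ht]; simpa using h)

/-- The triples that are isolated although their hull contains further lattice points. -/
def isolatedTriples (A : Set (ℤ × ℤ)) : Set (Multiset (ℤ × ℤ)) :=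
  {m | ∃ a b c, a ∈ A ∧ b ∈ A ∧ c ∈ A ∧ m = {a, b, c} ∧ Isolated A a b c ∧ ¬ EmptyTri a b c}

theorem isolatedTriples_finite {A : Set (ℤ × ℤ)} (hfin : A.Finite) : (isolatedTriples A).Finite := by
  refine ((hfin.prod (hfin.prod hfin)).image fun t : (ℤ × ℤ) × (ℤ × ℤ) × (ℤ × ℤ) =>
    ({t.1, t.2.1, t.2.2} : Multiset (ℤ × ℤ))).subset ?_
  rintro _ ⟨a, b, c, ha, hb, hc, rfl, -⟩
  exact ⟨(a, b, c), ⟨ha, hb, hc⟩, rfl⟩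

theorem not_mem_isolatedTriples {A : Set (ℤ × ℤ)} {a b c : ℤ × ℤ} (ha : a ∈ A) (hb : b ∈ A)
    (hc : c ∈ A) (h : {a, b, c} ∉ isolatedTriples A) : EmptyTri a b c ∨ ¬ Isolated A a b c := by
  by_contra! hcon
  exact h ⟨a, b, c, ha, hb, hc, rfl, hcon.2, hcon.1⟩

theorem EmptyTri.not_mem_isolatedTriples {A : Set (ℤ × ℤ)} {a b c : ℤ × ℤ} (h : EmptyTri a b c) :
    {a, b, c} ∉ isolatedTriples A := by
  rintro ⟨x, y, z, -, -, -, he, -, hE⟩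
  exact hE (triple_transport (C := EmptyTri) (fun _ _ _ h => h.rot) (fun _ _ _ h => h.swap) he h)

theorem coeff_eq_zero_of_uniqPair {k : Type*} [Field k] {Γ : Set (ℝ × ℝ)}
    {q : MvPolynomial (LatPt Γ) k} (hq : q ∈ toricIdealDeg k Γ 2) {v : LatPt Γ →₀ ℕ} {a b : ℤ × ℤ}
    (hv : pts v = {a, b}) (h : UniqPair (latticePts Γ) a b) : q.coeff v = 0 := by
  have hchi : chi k Γ q = 0 := hq.1
  have h2 : q.IsHomogeneous 2 := hq.2
  have h0 := coeff_chi k Γ q (wt v)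
  rw [hchi, AddMonoidAlgebra.coeff_zero, Finsupp.coe_zero, Pi.zero_apply,
    Finset.sum_eq_single v] at h0
  · exact h0.symm
  · intro u hu hne
    rw [Finset.mem_filter, MvPolynomial.mem_support_iff, wt_eq_iff] at hu
    refine absurd ?_ hne
    have hdeg : u.degree = 2 := by
      by_contra hd
      exact hu.1 (h2.coeff_eq_zero hd)
    rw [← card_pts, Multiset.card_eq_two] at hdeg
    obtain ⟨x, y, hxy⟩ := hdeg
    have hm := fun p => mem_of_mem_pts (s := u) (p := p)
    rw [hxy] at hm
    have hs := hu.2.1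
    rw [hxy, hv] at hs
    simp only [Multiset.insert_eq_cons, Multiset.sum_cons, Multiset.sum_singleton] at hs
    refine pts_injective ?_
    rw [hxy, hv]
    rcases h x (hm x (by simp)) y (hm y (by simp)) hs with rfl | rfl
    · rw [add_left_cancel hs]
    · rw [add_comm a] at hs
      rw [add_left_cancel hs, Multiset.pair_comm]
  · intro hv
    rw [Finset.mem_filter, MvPolynomial.mem_support_iff] at hv
    by_contra hne
    exact hv ⟨hne, rfl⟩

theorem coeff_eq_zero_of_mem_quadIdeal {k : Type*} [Field k] {Γ : Set (ℝ × ℝ)}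
    {f : MvPolynomial (LatPt Γ) k} (hf : f ∈ quadIdeal k Γ) {s : LatPt Γ →₀ ℕ}
    (hs : pts s ∈ isolatedTriples (latticePts Γ)) : f.coeff s = 0 := by
  classical
  obtain ⟨a, b, c, -, -, -, hs, hI, -⟩ := hs
  suffices h : ∀ g, (g * f).coeff s = 0 by simpa using h 1
  induction hf using Submodule.span_induction with
  | mem q hq =>
    intro g
    rw [MvPolynomial.coeff_mul]
    refine Finset.sum_eq_zero fun uv huv => ?_
    rw [Finset.HasAntidiagonal.mem_antidiagonal] at huv
    have h2 : q.IsHomogeneous 2 := hq.2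
    by_cases hd : uv.2.degree = 2
    · have hcard := congrArg Multiset.card hs
      rw [← huv, pts_add, Multiset.card_add, card_pts uv.2, hd] at hcard
      have h1 : Multiset.card (pts uv.1) = 1 := by
        simp only [Multiset.insert_eq_cons, Multiset.card_cons, Multiset.card_singleton] at hcard
        omega
      obtain ⟨x, hx⟩ := Multiset.card_eq_one.1 h1
      rw [← card_pts, Multiset.card_eq_two] at hd
      obtain ⟨y, z, hyz⟩ := hd
      have he : ({a, b, c} : Multiset (ℤ × ℤ)) = {x, y, z} := by
        rw [← hs, ← huv, pts_add, hx, hyz]; rfl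
      have hI' := triple_transport (C := Isolated (latticePts Γ)) (fun _ _ _ h => h.rot)
        (fun _ _ _ h => h.swap) he hI
      rw [coeff_eq_zero_of_uniqPair hq hyz hI'.2.1, mul_zero]
    · rw [h2.coeff_eq_zero hd, mul_zero]
  | zero => simp
  | add x y _ _ hx hy => intro g; rw [mul_add, MvPolynomial.coeff_add, hx, hy, add_zero]
  | smul r x _ hx => intro g; rw [smul_eq_mul, ← mul_assoc, hx]

theorem mem_quadIdeal_of_coeff_eq_zero {k : Type*} [Field k] {Γ : Set (ℝ × ℝ)}
    (hA : LConv (latticePts Γ)) (hfin : (latticePts Γ).Finite) {f : MvPolynomial (LatPt Γ) k}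
    (hf : f ∈ toricIdealDeg k Γ 3)
    (h0 : ∀ s, pts s ∈ isolatedTriples (latticePts Γ) → f.coeff s = 0) : f ∈ quadIdeal k Γ := by
  classical
  have hchi : chi k Γ f = 0 := hf.1
  have h3 : f.IsHomogeneous 3 := hf.2
  obtain ⟨good, hgood⟩ : ∃ P : (LatPt Γ →₀ ℕ) → Prop, ∀ s, P s ↔
    s.degree = 3 ∧ pts s ∉ isolatedTriples (latticePts Γ) := ⟨_, fun _ => Iff.rfl⟩
  have hsupp : ∀ s ∈ f.support, good s := by
    intro s hs
    rw [MvPolynomial.mem_support_iff] at hs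
    rw [hgood]
    refine ⟨?_, fun h => hs (h0 s h)⟩
    by_contra hd
    exact hs (h3.coeff_eq_zero hd)
  have hdiff : ∀ s t, good s → good t → wt s = wt t →
      MvPolynomial.monomial s (1 : k) - MvPolynomial.monomial t 1 ∈ quadIdeal k Γ := by
    intro s t hs ht hw
    rw [hgood] at hs ht
    obtain ⟨a, b, c, ha, hb, hc, he⟩ := exists_pts_eq_triple hs.1
    obtain ⟨a', b', c', ha', hb', hc', he'⟩ := exists_pts_eq_triple ht.1
    rw [wt_eq_iff, he, he', sum_triple, sum_triple] at hw
    rw [← monoOf_pts, ← monoOf_pts, he, he']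
    exact (hA.conn_of_sum_eq hfin ha hb hc ha' hb' hc'
      (not_mem_isolatedTriples ha hb hc (he ▸ hs.2))
      (not_mem_isolatedTriples ha' hb' hc' (he' ▸ ht.2)) hw.1).monoOf_sub_mem k
  choose ρ hρ using fun m : ℤ × ℤ × ℕ =>
    (by
      by_cases h : ∃ s : LatPt Γ →₀ ℕ, good s ∧ wt s = m
      · exact ⟨h.choose, fun _ => h.choose_spec⟩
      · exact ⟨0, fun h' => absurd h' h⟩ :
      ∃ t : LatPt Γ →₀ ℕ, (∃ s : LatPt Γ →₀ ℕ, good s ∧ wt s = m) → good t ∧ wt t = m)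
  have hzero : ∑ s ∈ f.support, MvPolynomial.monomial (ρ (wt s)) (f.coeff s) = 0 := by
    rw [← Finset.sum_fiberwise_of_maps_to (t := f.support.image wt)
      (fun s hs => Finset.mem_image_of_mem wt hs)]
    refine Finset.sum_eq_zero fun m _ => ?_
    have hc := coeff_chi k Γ f m
    rw [hchi, AddMonoidAlgebra.coeff_zero, Finsupp.coe_zero, Pi.zero_apply] at hc
    rw [Finset.sum_congr rfl (g := fun s => MvPolynomial.monomial (ρ m) (f.coeff s)), ← map_sum, ← hc,
      map_zero]
    intro s hs
    rw [(Finset.mem_filter.1 hs).2]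
  have hsum : f = ∑ s ∈ f.support, MvPolynomial.C (f.coeff s) *
      (MvPolynomial.monomial s (1 : k) - MvPolynomial.monomial (ρ (wt s)) 1) := by
    have : ∀ s ∈ f.support, MvPolynomial.C (f.coeff s) *
        (MvPolynomial.monomial s (1 : k) - MvPolynomial.monomial (ρ (wt s)) 1) =
        MvPolynomial.monomial s (f.coeff s) - MvPolynomial.monomial (ρ (wt s)) (f.coeff s) := by
      intro s _
      rw [mul_sub, MvPolynomial.C_mul_monomial, MvPolynomial.C_mul_monomial, mul_one]
    rw [Finset.sum_congr rfl this, Finset.sum_sub_distrib, hzero, sub_zero]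
    exact f.as_sum
  rw [hsum]
  refine sum_mem fun s hs => Ideal.mul_mem_left _ _ ?_
  have hρs := hρ (wt s) ⟨s, hsupp s hs, rfl⟩
  exact hdiff _ _ (hsupp s hs) hρs.1 hρs.2.symm

theorem exists_companion {Γ : Set (ℝ × ℝ)} (hA : LConv (latticePts Γ)) {s : LatPt Γ →₀ ℕ}
    (hs : pts s ∈ isolatedTriples (latticePts Γ)) :
    ∃ t : LatPt Γ →₀ ℕ, t.degree = 3 ∧ pts t ∉ isolatedTriples (latticePts Γ) ∧
      (pts s).sum = (pts t).sum := by
  obtain ⟨a, b, c, ha, hb, hc, hs, -, -⟩ := hs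
  obtain ⟨x, y, z, hsub, hE, hsum⟩ := exists_emptyTri_sum_eq a b c
  obtain ⟨hx, hy, hz⟩ := hsub.mem hA ha hb hc
  obtain ⟨t, ht⟩ := exists_pts_eq (Γ := Γ) {x, y, z} (by simp [hx, hy, hz])
  refine ⟨t, by rw [← card_pts, ht]; rfl, by rw [ht]; exact hE.not_mem_isolatedTriples, ?_⟩
  rw [hs, ht, sum_triple, sum_triple, hsum]

/-- The cubic defect counts the isolated triples. -/
theorem cubicDefect_eq_ncard (k : Type*) [Field k] {Γ : Set (ℝ × ℝ)}
    (hA : LConv (latticePts Γ)) (hfin : (latticePts Γ).Finite) :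
    cubicDefect k Γ = (isolatedTriples (latticePts Γ)).ncard := by
  classical
  obtain ⟨S, hS⟩ : ∃ S : Set (LatPt Γ →₀ ℕ), S = pts ⁻¹' isolatedTriples (latticePts Γ) := ⟨_, rfl⟩
  have hmem : ∀ s, s ∈ S ↔ pts s ∈ isolatedTriples (latticePts Γ) := by simp [hS]
  have hSfin : S.Finite := by
    rw [hS]; exact (isolatedTriples_finite hfin).preimage pts_injective.injOn
  have hdeg : ∀ s ∈ S, s.degree = 3 := by
    intro s hs
    obtain ⟨a, b, c, -, -, -, he, -⟩ := (hmem s).1 hs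
    rw [← card_pts, he]; rfl
  have hcard : S.ncard = (isolatedTriples (latticePts Γ)).ncard := by
    rw [← Set.ncard_image_of_injective S pts_injective, hS, Set.image_preimage_eq_inter_range,
      Set.inter_eq_left.2]
    rintro _ ⟨a, b, c, ha, hb, hc, rfl, -⟩
    exact exists_pts_eq _ (by simp [ha, hb, hc])
  have : Fintype S := hSfin.fintype
  let φ : toricIdealDeg k Γ 3 →ₗ[k] (S → k) :=
    LinearMap.pi fun s => (MvPolynomial.lcoeff k s.1) ∘ₗ (toricIdealDeg k Γ 3).subtype
  have hφ : ∀ f s, φ f s = (f : MvPolynomial (LatPt Γ) k).coeff s.1 := fun _ _ => rfl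
  have hker : LinearMap.ker φ =
      Submodule.comap (toricIdealDeg k Γ 3).subtype (quadIdealDeg3 k Γ) := by
    ext f
    rw [LinearMap.mem_ker, Submodule.mem_comap]
    constructor
    · intro h
      refine ⟨mem_quadIdeal_of_coeff_eq_zero hA hfin f.2 fun s hs => ?_, f.2.2⟩
      exact congrFun h ⟨s, (hmem s).2 hs⟩
    · intro h
      funext s
      exact coeff_eq_zero_of_mem_quadIdeal h.1 ((hmem s.1).1 s.2)
  have hsurj : Function.Surjective φ := by
    intro g
    choose t ht1 ht2 ht3 using fun s : S => exists_companion hA ((hmem s.1).1 s.2)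
    refine ⟨⟨∑ s : S, g s • (MvPolynomial.monomial s.1 (1 : k) - MvPolynomial.monomial (t s) 1),
      sum_mem fun s _ => Submodule.smul_mem _ _
        (sub_mem_toricIdealDeg k (hdeg s.1 s.2) (ht1 s) (ht3 s))⟩, ?_⟩
    funext r
    rw [hφ]
    simp only [MvPolynomial.coeff_sum, MvPolynomial.coeff_smul, MvPolynomial.coeff_sub,
      MvPolynomial.coeff_monomial]
    have hne : ∀ s : S, t s ≠ r.1 := fun s h => ht2 s (h ▸ (hmem r.1).1 r.2)
    simp [hne, Subtype.coe_inj]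
  rw [cubicDefect, ← hcard, ((Submodule.quotEquivOfEq _ _ hker.symm).trans
    (φ.quotKerEquivOfSurjective hsurj)).finrank_eq, Module.finrank_fintype_fun_eq_card,
    ← Nat.card_eq_fintype_card, Nat.card_coe_set_eq]

/-- A triangle with primitive edges whose vertices belong to `A` and which contains `A`. -/
structure PrimTri (A : Set (ℤ × ℤ)) (a b c : ℤ × ℤ) : Prop where
  left_mem : a ∈ A
  mid_mem : b ∈ A
  right_mem : c ∈ A
  pos : 0 < dt a b c
  edge_left : PrimEdge a b
  edge_right : PrimEdge b c
  edge_last : PrimEdge c a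
  inTri : ∀ P ∈ A, InTri a b c P

namespace PrimTri

variable {A : Set (ℤ × ℤ)} {a b c : ℤ × ℤ}

theorem rot (h : PrimTri A a b c) : PrimTri A b c a where
  left_mem := h.mid_mem
  mid_mem := h.right_mem
  right_mem := h.left_mem
  pos := by rw [dt_rot]; exact h.pos
  edge_left := h.edge_right
  edge_right := h.edge_last
  edge_last := h.edge_left
  inTri P hP := (h.inTri P hP).rot

theorem ne (h : PrimTri A a b c) : a ≠ b := by
  rintro rfl
  have := h.pos
  simp [dt] at this

theorem dt_pos (h : PrimTri A a b c) {P : ℤ × ℤ} (hP : P ∈ A) (ha : P ≠ a) (hb : P ≠ b) :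
    0 < dt a b P := by
  refine (((InTri.iff_dt h.pos).1 (h.inTri P hP)).2.2).lt_of_ne fun h0 => ?_
  rcases h.edge_left P (InTri.edge_of_dt_eq_zero h.pos (h.inTri P hP) h0.symm) with h | h
  · exact ha h
  · exact hb h

theorem isolated (h : PrimTri A a b c) : Isolated A a b c :=
  isolated_of_forall_inTri h.pos h.edge_left h.edge_right h.edge_last h.inTri

theorem left_eq_of_inTri (h : PrimTri A a b c) {x y z : ℤ × ℤ} (hx : x ∈ A) (hy : y ∈ A)
    (hz : z ∈ A) (hT : InTri x y z a) : a = x ∨ a = y ∨ a = z := by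
  by_contra! hne
  have hlt : ∀ p ∈ A, a ≠ p → dt b c p ≤ dt a b c - 1 := by
    intro p hp hap
    have h1 := dt_add a b c p
    have h2 := (InTri.iff_dt h.pos).1 (h.inTri p hp)
    by_cases hpb : p = b
    · subst hpb
      have := h.pos
      rw [dt_self_left]; omega
    · have := h.dt_pos hp hap.symm hpb
      omega
  obtain ⟨α, β, γ, h1, h2, h3, h4, h5, h6⟩ := hT
  have key := InTri.dt_mul α β γ h5 h6 b c
  rw [dt_rot] at key
  have e1 := mul_le_mul_of_nonneg_left (hlt x hx hne.1) h1
  have e2 := mul_le_mul_of_nonneg_left (hlt y hy hne.2.1) h2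
  have e3 := mul_le_mul_of_nonneg_left (hlt z hz hne.2.2) h3
  nlinarith

theorem multiset_eq (h : PrimTri A a b c) {x y z : ℤ × ℤ} (hx : x ∈ A) (hy : y ∈ A) (hz : z ∈ A)
    (hT : ∀ P ∈ A, InTri x y z P) : ({a, b, c} : Multiset (ℤ × ℤ)) = {x, y, z} := by
  have h1 := h.left_eq_of_inTri hx hy hz (hT a h.left_mem)
  have h2 := h.rot.left_eq_of_inTri hx hy hz (hT b h.mid_mem)
  have h3 := h.rot.rot.left_eq_of_inTri hx hy hz (hT c h.right_mem)
  refine Multiset.eq_of_le_of_card_le ((Multiset.le_iff_subset ?_).2 ?_) le_rfl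
  · simp [h.ne, h.rot.ne, h.rot.rot.ne.symm]
  · intro p hp
    simp only [Multiset.insert_eq_cons, Multiset.mem_cons, Multiset.mem_singleton] at hp ⊢
    rcases hp with rfl | rfl | rfl <;> assumption

theorem exists_cap (h : PrimTri A a b c) (hE : ¬ EmptyTri a b c) : ∃ e, Cap a b c e :=
  _root_.exists_cap h.pos h.edge_left h.edge_right h.edge_last hE

/-- Coordinates in which `a = (0, 0)`, `b = (1, 0)` and the cap is `(1, 1)`. -/
theorem exists_coords {e : ℤ × ℤ} (h : dt a b e = 1) :
    ∃ u w, cross u w = 1 ∧ a = frame a u w (0, 0) ∧ b = frame a u w (1, 0) ∧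
      e = frame a u w (1, 1) := by
  refine ⟨b - a, e - b, ?_, (frame_zero _ _ _).symm, by ext <;> simp [frame],
    by ext <;> simp [frame]⟩
  rw [← h]
  simp only [cross, dt, Prod.fst_sub, Prod.snd_sub]; ring

end PrimTri

theorem cone_mul_nonpos {s t s' t' : ℤ} (hs : 0 ≤ s) (hst : s ≤ t) (hs' : 0 ≤ s') (hst' : s' ≤ t')
    (h : s * t' = s' * t) : (t' - t - (s' - s)) * -(s' - s) ≤ 0 := by
  rcases (hs.trans hst).eq_or_lt with ht | ht
  · have hs0 : s = 0 := by omega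
    subst hs0 ht
    nlinarith
  · have e : t * t * ((t' - t - (s' - s)) * (s' - s)) =
        (s * (t - s)) * ((t' - t) * (t' - t)) := by
      have e1 : t * (s' - s) = s * (t' - t) := by linear_combination -h
      have e2 : t * (t' - t - (s' - s)) = (t - s) * (t' - t) := by linear_combination h
      calc _ = (t * (t' - t - (s' - s))) * (t * (s' - s)) := by ring
        _ = _ := by rw [e1, e2]; ring
    have e3 : 0 ≤ (s * (t - s)) * ((t' - t) * (t' - t)) :=
      mul_nonneg (mul_nonneg hs (by omega)) (mul_self_nonneg _)
    rw [← e] at e3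
    have := nonneg_of_mul_nonneg_right e3 (mul_pos ht ht)
    linarith

/-- Two vertices of a triangle do not lie strictly on the same side of a line through the cap
and two further interior lattice points. -/
theorem Cap.mul_nonpos {a b c e p q : ℤ × ℤ} (he : Cap a b c e)
    (hp : 0 < dt a b p ∧ 0 < dt b c p ∧ 0 < dt c a p)
    (hq : 0 < dt a b q ∧ 0 < dt b c q ∧ 0 < dt c a q) (h0 : dt p q e = 0) :
    dt p q a * dt p q b ≤ 0 := by
  obtain ⟨u, w, hcr, ha, hb, hef⟩ := PrimTri.exists_coords he.1
  obtain ⟨⟨x, h⟩, hc⟩ := exists_frame_eq (.inl hcr) a c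
  obtain ⟨⟨p1, p2⟩, hpf⟩ := exists_frame_eq (.inl hcr) a p
  obtain ⟨⟨q1, q2⟩, hqf⟩ := exists_frame_eq (.inl hcr) a q
  have fr : ∀ {A B C P Q R}, A = frame a u w P → B = frame a u w Q → C = frame a u w R →
      dt A B C = dt P Q R := by
    rintro A B C P Q R h1 h2 h3; rw [h1, h2, h3, dt_frame, hcr, one_mul]
  obtain ⟨-, he2, he3⟩ := he
  rw [fr hb hc.symm hef] at he2
  rw [fr hc.symm ha hef] at he3
  rw [fr ha hb hpf.symm, fr hb hc.symm hpf.symm, fr hc.symm ha hpf.symm] at hp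
  rw [fr ha hb hqf.symm, fr hb hc.symm hqf.symm, fr hc.symm ha hqf.symm] at hq
  rw [fr hpf.symm hqf.symm hef] at h0
  rw [fr hpf.symm hqf.symm ha, fr hpf.symm hqf.symm hb]
  simp only [dt] at he2 he3 hp hq h0 ⊢
  ring_nf at he2 he3
  have hx : 2 ≤ x := by linarith
  have hh : x < h := by linarith
  have low : ∀ p1 p2 : ℤ, 0 < p2 → 0 < h * p1 - x * p2 → 1 ≤ p1 := by
    intro p1 p2 h1 h2
    by_contra! hlt
    nlinarith
  have up : ∀ p1 p2 : ℤ, 0 < p2 → 0 < (x - 1) * p2 - h * (p1 - 1) → p1 ≤ p2 := by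
    intro p1 p2 h1 h2
    by_contra! hlt
    nlinarith
  have hp2 : 0 < p2 := by linarith [hp.1]
  have hq2 : 0 < q2 := by linarith [hq.1]
  have := cone_mul_nonpos (s := p1 - 1) (t := p2 - 1) (s' := q1 - 1) (t' := q2 - 1)
    (by linarith [low p1 p2 hp2 (by linarith [hp.2.2])])
    (by linarith [up p1 p2 hp2 (by linarith [hp.2.1])])
    (by linarith [low q1 q2 hq2 (by linarith [hq.2.2])])
    (by linarith [up q1 q2 hq2 (by linarith [hq.2.1])]) (by linear_combination h0)
  have e1 : (q1 - p1) * (0 - p2) - (q2 - p2) * (0 - p1) = q2 - p2 - (q1 - p1) := by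
    linear_combination h0
  have e2 : (q1 - p1) * (0 - p2) - (q2 - p2) * (1 - p1) = -(q1 - p1) := by
    linear_combination h0
  rw [e1, e2]
  calc _ = _ := by ring
    _ ≤ 0 := this

/-- The lattice points of the hyperelliptic triangle, in suitable coordinates. -/
structure HypNormal (A : Set (ℤ × ℤ)) (o u w : ℤ × ℤ) (g : ℤ) : Prop where
  cross_eq : cross u w = 1 ∨ cross u w = -1
  mem_iff : ∀ P, P ∈ A ↔ P = o ∨ P = frame o u w (2, 2 * g + 1) ∨
    ∃ k, 0 ≤ k ∧ k ≤ g ∧ P = frame o u w (1, k)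

theorem EmptyTri.of_dt_eq_one {a b c : ℤ × ℤ} (h : dt a b c = 1) : EmptyTri a b c := by
  intro p hp
  obtain ⟨h1, h2, h3⟩ := (InTri.iff_dt (by omega)).1 hp
  have hadd := dt_add a b c p
  have aux : ∀ a b c : ℤ × ℤ, dt a b c = 1 → dt c a p = 0 → dt a b p = 0 → p = a := by
    intro a b c h1 h2 h3
    simp only [dt] at h1 h2 h3
    ext
    · linear_combination (b.1 - a.1) * h2 + (c.1 - a.1) * h3 - (p.1 - a.1) * h1
    · linear_combination (b.2 - a.2) * h2 + (c.2 - a.2) * h3 - (p.2 - a.2) * h1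
  rcases (by omega : dt c a p = 0 ∧ dt a b p = 0 ∨ dt a b p = 0 ∧ dt b c p = 0 ∨
    dt b c p = 0 ∧ dt c a p = 0) with h' | h' | h'
  · exact .inl (aux a b c h h'.1 h'.2)
  · exact .inr (.inl (aux b c a (by rw [dt_rot, h]) h'.1 h'.2))
  · exact .inr (.inr (aux c a b (by rw [dt_rot, dt_rot, h]) h'.1 h'.2))

theorem EmptyTri.of_abs_dt_eq_one {a b c : ℤ × ℤ} (h : |dt a b c| = 1) : EmptyTri a b c := by
  rcases eq_or_eq_neg_of_abs_eq h with h | h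
  · exact .of_dt_eq_one h
  · exact (EmptyTri.of_dt_eq_one (by rw [dt_swap, h]; rfl)).swap

theorem HypShape.exists_hypNormal {A : Set (ℤ × ℤ)} (hA : LConv A) (hfin : A.Finite)
    {a b c : ℤ × ℤ} (ha : a ∈ A) (hc : c ∈ A) (h : HypShape A a b c) :
    ∃ u w g, 2 ≤ g ∧ HypNormal A a u w g := by
  obtain ⟨w, g, hg, hcr, rfl, h1, hall⟩ := h
  set u := b - a
  have hB := hA.comap_frame a u w
  obtain ⟨l, hl, hmin⟩ := Set.exists_min_image {k : ℤ | frame a u w (1, k) ∈ A} id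
    (hfin.preimage (f := fun k => frame a u w (1, k)) fun x _ y _ hxy => by
      simpa using frame_inj hcr hxy) ⟨-1, h1⟩
  have hl1 : l ≤ -1 := hmin (-1) h1
  have htop : (1, g) ∈ {p | frame a u w p ∈ A} := by
    refine hB (a := (0, 0)) (b := (2, 2 * g + 1)) (c := (1, -1)) ?_ hc h1
      ⟨g + 1, g + 1, 1, by omega, by omega, by omega, by omega, by ring, by ring⟩
    rw [Set.mem_ofPred_eq, frame_zero]; exact ha
  have hf : ∀ p : ℤ × ℤ, frame a (u + (l * w.1, l * w.2)) w p = frame a u w (p.1, p.2 + l * p.1) := by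
    intro p
    ext <;> simp only [frame, Prod.fst_add, Prod.snd_add] <;> ring
  refine ⟨u + (l * w.1, l * w.2), w, g - l, by omega, ?_, fun P => ?_⟩
  · convert hcr using 2 <;> simp only [cross, Prod.fst_add, Prod.snd_add] <;> ring
  · simp only [hf]
    have e : 2 * (g - l) + 1 + l * 2 = 2 * g + 1 := by ring
    rw [e]
    constructor
    · intro hP
      rcases hall P hP with h | h | ⟨k, hk, rfl⟩
      · exact .inl h
      · exact .inr (.inl h)
      · have : l ≤ k := hmin k hP
        exact .inr (.inr ⟨k - l, by omega, by omega, by congr 2; ring⟩)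
    · rintro (rfl | rfl | ⟨k, hk, hk', rfl⟩)
      · exact ha
      · exact hc
      · exact hB (a := (1, l)) (b := (1, g)) (c := (1, g)) hl htop htop
          ⟨g - l - k, k, 0, by omega, by omega, by omega, by omega, by ring, by ring⟩

namespace HypNormal

variable {A : Set (ℤ × ℤ)} {o u w : ℤ × ℤ} {g : ℤ}

theorem left_mem (h : HypNormal A o u w g) : o ∈ A := (h.mem_iff _).2 (.inl rfl)

theorem right_mem (h : HypNormal A o u w g) : frame o u w (2, 2 * g + 1) ∈ A :=
  (h.mem_iff _).2 (.inr (.inl rfl))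

theorem column_mem (h : HypNormal A o u w g) {k : ℤ} (h0 : 0 ≤ k) (hg : k ≤ g) :
    frame o u w (1, k) ∈ A :=
  (h.mem_iff _).2 (.inr (.inr ⟨k, h0, hg, rfl⟩))

theorem exists_coords (h : HypNormal A o u w g) {P : ℤ × ℤ} (hP : P ∈ A) :
    ∃ p : ℤ × ℤ, P = frame o u w p ∧
      (p = (0, 0) ∨ p = (2, 2 * g + 1) ∨ p.1 = 1 ∧ 0 ≤ p.2 ∧ p.2 ≤ g) := by
  rcases (h.mem_iff P).1 hP with rfl | rfl | ⟨k, h0, h1, rfl⟩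
  · exact ⟨(0, 0), (frame_zero _ _ _).symm, .inl rfl⟩
  · exact ⟨_, rfl, .inr (.inl rfl)⟩
  · exact ⟨_, rfl, .inr (.inr ⟨rfl, h0, h1⟩)⟩

theorem uniqPair (h : HypNormal A o u w g) {p q : ℤ × ℤ}
    (hpq : ∀ r s : ℤ × ℤ, (r = (0, 0) ∨ r = (2, 2 * g + 1) ∨ r.1 = 1 ∧ 0 ≤ r.2 ∧ r.2 ≤ g) →
      (s = (0, 0) ∨ s = (2, 2 * g + 1) ∨ s.1 = 1 ∧ 0 ≤ s.2 ∧ s.2 ≤ g) → r + s = p + q →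
      r = p ∨ r = q) : UniqPair A (frame o u w p) (frame o u w q) := by
  intro P hP Q hQ hs
  obtain ⟨r, rfl, hr⟩ := h.exists_coords hP
  obtain ⟨s, rfl, hs'⟩ := h.exists_coords hQ
  rcases hpq r s hr hs' (frame_add_eq h.cross_eq hs) with rfl | rfl
  · exact .inl rfl
  · exact .inr rfl

theorem isolated (h : HypNormal A o u w g) {k : ℤ} (h0 : 0 ≤ k) (hg : k ≤ g) :
    Isolated A o (frame o u w (2, 2 * g + 1)) (frame o u w (1, k)) := by
  have e := frame_zero o u w
  refine ⟨?_, h.uniqPair ?_, ?_⟩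
  · nth_rw 1 [← e]
    refine h.uniqPair ?_
    simp only [Prod.forall, Prod.mk.injEq, Prod.mk_add_mk]
    omega
  · simp only [Prod.forall, Prod.mk.injEq, Prod.mk_add_mk]
    omega
  · nth_rw 2 [← e]
    refine h.uniqPair ?_
    simp only [Prod.forall, Prod.mk.injEq, Prod.mk_add_mk]
    omega

theorem not_emptyTri (h : HypNormal A o u w g) {k : ℤ} (hg : k < g) :
    ¬ EmptyTri o (frame o u w (2, 2 * g + 1)) (frame o u w (1, k)) := by
  intro hE
  have hT : InTri (0, 0) (2, 2 * g + 1) (1, k) (1, g) :=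
    ⟨g - k, g - k, 1, by omega, by omega, by omega, by omega, by ring, by ring⟩
  have hT' := hT.map_frame o u w
  rw [frame_zero] at hT'
  have h0 := hE _ hT'
  nth_rw 2 [← frame_zero o u w] at h0
  rcases h0 with h' | h' | h' <;> have := frame_inj h.cross_eq h' <;> simp at this
  omega

theorem isolatedTriples_eq (h : HypNormal A o u w g) (hA : LConv A) : isolatedTriples A =
    (fun k => {o, frame o u w (2, 2 * g + 1), frame o u w (1, k)}) '' Set.Ico 0 g := by
  ext m
  constructor
  · rintro ⟨a, b, c, ha, hb, hc, rfl, hI, hE⟩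
    have h0 := dt_ne_zero_of_primEdge (hI.1.primEdge hA ha hb) (hI.2.1.primEdge hA hb hc) hE
    have h2 : 2 ≤ |dt a b c| := by
      have h1 := mt EmptyTri.of_abs_dt_eq_one hE
      have := abs_pos.2 h0
      omega
    have col : ∀ p q : ℤ × ℤ, p.1 = 1 ∧ 0 ≤ p.2 ∧ p.2 ≤ g → q.1 = 1 ∧ 0 ≤ q.2 ∧ q.2 ≤ g →
        UniqPair A (frame o u w p) (frame o u w q) → p.2 ≤ q.2 + 1 := by
      rintro ⟨x, i⟩ ⟨y, j⟩ ⟨rfl, hi, hi'⟩ ⟨rfl, hj, hj'⟩ hU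
      by_contra! hlt
      simp only at hi hi' hj hj' hlt
      rcases hU (frame o u w (1, i - 1)) (h.column_mem (by omega) (by omega))
        (frame o u w (1, j + 1)) (h.column_mem (by omega) (by omega))
        (by ext <;> simp only [frame, Prod.fst_add, Prod.snd_add] <;> ring) with h' | h' <;>
      · have := congrArg Prod.snd (frame_inj h.cross_eq h')
        simp only at this
        omega
    obtain ⟨p, rfl, hp⟩ := h.exists_coords ha
    obtain ⟨q, rfl, hq⟩ := h.exists_coords hb
    obtain ⟨r, rfl, hr⟩ := h.exists_coords hc
    have hcr : |cross u w| = 1 := by rcases h.cross_eq with h | h <;> rw [h] <;> rfl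
    rw [dt_frame, abs_mul, hcr, one_mul, le_abs] at h2
    have c1 := fun hp hq => col p q hp hq hI.1
    have c2 := fun hq hp => col q p hq hp hI.1.symm
    have c3 := fun hq hr => col q r hq hr hI.2.1
    have c4 := fun hr hq => col r q hr hq hI.2.1.symm
    have c5 := fun hr hp => col r p hr hp hI.2.2
    have c6 := fun hp hr => col p r hp hr hI.2.2.symm
    have fin : ∀ k, 0 ≤ k → k < g → ∀ m : Multiset (ℤ × ℤ),
        m = {o, frame o u w (2, 2 * g + 1), frame o u w (1, k)} →
        m ∈ (fun k => ({o, frame o u w (2, 2 * g + 1), frame o u w (1, k)} :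
          Multiset (ℤ × ℤ))) '' Set.Ico 0 g := fun k h0 h1 m hm => ⟨k, ⟨h0, h1⟩, hm.symm⟩
    clear col hI hE ha hb hc hcr h0
    obtain ⟨p1, p2⟩ := p
    obtain ⟨q1, q2⟩ := q
    obtain ⟨r1, r2⟩ := r
    simp only [Prod.mk.injEq] at *
    rcases hp with ⟨rfl, rfl⟩ | ⟨rfl, rfl⟩ | ⟨rfl, hp⟩ <;>
    rcases hq with ⟨rfl, rfl⟩ | ⟨rfl, rfl⟩ | ⟨rfl, hq⟩ <;>
    rcases hr with ⟨rfl, rfl⟩ | ⟨rfl, rfl⟩ | ⟨rfl, hr⟩ <;>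
    simp [dt] at h2 <;> first
      | omega
      | exact fin p2 (by omega) (by omega) _
          (by simp only [frame_zero, Multiset.insert_eq_cons, ← Multiset.singleton_add]; abel)
      | exact fin q2 (by omega) (by omega) _
          (by simp only [frame_zero, Multiset.insert_eq_cons, ← Multiset.singleton_add]; abel)
      | exact fin r2 (by omega) (by omega) _
          (by simp only [frame_zero, Multiset.insert_eq_cons, ← Multiset.singleton_add] <;> abel)
  · rintro ⟨k, ⟨h0, hg⟩, rfl⟩
    exact ⟨_, _, _, h.left_mem, h.right_mem, h.column_mem h0 hg.le, rfl, h.isolated h0 hg.le,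
      h.not_emptyTri hg⟩

theorem ncard_isolatedTriples (h : HypNormal A o u w g) (hA : LConv A) :
    (isolatedTriples A).ncard = g.toNat := by
  rw [h.isolatedTriples_eq hA, Set.ncard_image_of_injective, ← Finset.coe_Ico,
    Set.ncard_coe_finset, Int.card_Ico, sub_zero]
  intro i j hij
  simpa [Multiset.insert_eq_cons] using frame_inj h.cross_eq
    (Multiset.singleton_inj.1 ((Multiset.cons_inj_right _).1 ((Multiset.cons_inj_right _).1 hij)))

theorem ncard_eq (h : HypNormal A o u w g) (hg : 0 ≤ g) : A.ncard = g.toNat + 3 := by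
  have hA : A = insert o (insert (frame o u w (2, 2 * g + 1))
      ((fun k => frame o u w (1, k)) '' Set.Icc 0 g)) := by
    ext P
    simp only [h.mem_iff, Set.mem_insert_iff, Set.mem_image, Set.mem_Icc]
    simp only [and_assoc, eq_comm]
  have hfin : ((fun k => frame o u w (1, k)) '' Set.Icc 0 g).Finite := (Set.finite_Icc 0 g).image _
  rw [hA, Set.ncard_insert_of_notMem _ (hfin.insert _), Set.ncard_insert_of_notMem _ hfin,
    Set.ncard_image_of_injective, ← Finset.coe_Icc, Set.ncard_coe_finset, Int.card_Icc]
  · omega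
  · intro i j hij
    simpa using frame_inj h.cross_eq hij
  · rintro ⟨k, -, hk⟩
    simpa using frame_inj h.cross_eq hk
  · rintro (hk | ⟨k, -, hk⟩)
    · simpa using frame_inj h.cross_eq ((frame_zero o u w).trans hk)
    · simpa using frame_inj h.cross_eq (hk.trans (frame_zero o u w).symm)

theorem inTri (h : HypNormal A o u w g) {P : ℤ × ℤ} (hP : P ∈ A) :
    InTri o (frame o u w (1, 0)) (frame o u w (2, 2 * g + 1)) P := by
  rcases (h.mem_iff P).1 hP with rfl | rfl | ⟨k, h0, h1, rfl⟩
  · exact .left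
  · exact .right
  · have : InTri (0, 0) (1, 0) (2, 2 * g + 1) (1, k) :=
      ⟨k, 2 * g + 1 - 2 * k, k, by omega, by omega, by omega, by omega, by ring, by ring⟩
    have := this.map_frame o u w
    rwa [frame_zero] at this

theorem primTri (h : HypNormal A o u w g) (hA : LConv A) (hg : 0 ≤ g) :
    PrimTri A o (frame o u w (1, 0)) (frame o u w (2, 2 * g + 1)) ∨
      PrimTri A o (frame o u w (2, 2 * g + 1)) (frame o u w (1, 0)) := by
  have hI := h.isolated le_rfl hg
  have hb := h.column_mem le_rfl hg
  have e1 := hI.1.primEdge hA h.left_mem h.right_mem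
  have e2 := hI.2.1.primEdge hA h.right_mem hb
  have e3 := hI.2.2.primEdge hA hb h.left_mem
  have hd : dt o (frame o u w (1, 0)) (frame o u w (2, 2 * g + 1)) = cross u w * (2 * g + 1) := by
    nth_rw 1 [← frame_zero o u w]
    rw [dt_frame]; simp [dt]
  rcases h.cross_eq with hc | hc
  · exact .inl ⟨h.left_mem, hb, h.right_mem, by rw [hd, hc]; omega, e3.symm, e2.symm, e1.symm,
      fun P hP => h.inTri hP⟩
  · exact .inr ⟨h.left_mem, h.right_mem, hb, by rw [dt_swap, hd, hc]; omega, e1, e2, e3,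
      fun P hP => (h.inTri hP).swap⟩

/-- The points besides the vertices of the hyperelliptic triangle. -/
theorem mem_column (h : HypNormal A o u w g) {P : ℤ × ℤ} (hP : P ∈ A) (ho : P ≠ o)
    (hc : P ≠ frame o u w (2, 2 * g + 1)) : ∃ k, P = frame o u w (1, k) := by
  rcases (h.mem_iff P).1 hP with h | h | ⟨k, -, -, h⟩
  · exact absurd h ho
  · exact absurd h hc
  · exact ⟨k, h⟩

end HypNormal

theorem dt_eq_zero_of_line {p q x y z : ℤ × ℤ} (hpq : p ≠ q) (hx : dt p q x = 0)
    (hy : dt p q y = 0) (hz : dt p q z = 0) : dt x y z = 0 := by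
  simp only [dt] at *
  have e1 : (q.1 - p.1) * ((y.1 - x.1) * (z.2 - x.2) - (y.2 - x.2) * (z.1 - x.1)) = 0 := by
    linear_combination (y.1 - x.1) * (hz - hx) - (z.1 - x.1) * (hy - hx)
  have e2 : (q.2 - p.2) * ((y.1 - x.1) * (z.2 - x.2) - (y.2 - x.2) * (z.1 - x.1)) = 0 := by
    linear_combination (y.2 - x.2) * (hz - hx) - (z.2 - x.2) * (hy - hx)
  rcases mul_eq_zero.1 e1 with h1 | h1
  · rcases mul_eq_zero.1 e2 with h2 | h2
    · exact absurd (Prod.ext (sub_eq_zero.1 h1).symm (sub_eq_zero.1 h2).symm) hpq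
    · exact h2
  · exact h1

namespace PrimTri

variable {A : Set (ℤ × ℤ)} {a b c : ℤ × ℤ}

theorem dt_pos_of_mem (h : PrimTri A a b c) {P : ℤ × ℤ} (hP : P ∈ A \ {a, b, c}) :
    0 < dt a b P ∧ 0 < dt b c P ∧ 0 < dt c a P := by
  obtain ⟨hP, hne⟩ := hP
  simp only [Set.mem_insert_iff, Set.mem_singleton_iff, not_or] at hne
  exact ⟨h.dt_pos hP hne.1 hne.2.1, h.rot.dt_pos hP hne.2.1 hne.2.2,
    h.rot.rot.dt_pos hP hne.2.2 hne.1⟩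

theorem cap_mem (h : PrimTri A a b c) (hA : LConv A) {e : ℤ × ℤ} (he : Cap a b c e) :
    e ∈ A \ {a, b, c} := by
  refine ⟨hA h.left_mem h.mid_mem h.right_mem (he.inTri h.pos), ?_⟩
  rintro (rfl | rfl | rfl)
  · have := he.1
    rw [dt_self_left] at this
    omega
  · have := he.1
    rw [dt_self_right] at this
    omega
  · have := he.2.1
    rw [dt_self_right] at this
    exact this.ne rfl

theorem hypNormal_of_line (h : PrimTri A a b c) (hA : LConv A) (hE : ¬ EmptyTri a b c)
    {p q : ℤ × ℤ} (hpq : p ≠ q) (hI : ∀ r ∈ A \ {a, b, c}, dt p q r = 0) (hb : dt p q b = 0) :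
    ∃ u w g, 1 ≤ g ∧ HypNormal A a u w g := by
  obtain ⟨e, he⟩ := h.exists_cap hE
  obtain ⟨f, hf⟩ := h.rot.exists_cap fun hE' => hE hE'.rot.rot
  have heI := h.cap_mem hA he
  have hfI : f ∈ A \ {a, b, c} := by
    have := h.rot.cap_mem hA hf
    simp only [Set.mem_sdiff, Set.mem_insert_iff, Set.mem_singleton_iff] at this ⊢
    tauto
  obtain ⟨u, w, hcr, ha, hbf, hef⟩ := exists_coords he.1
  have fr : ∀ {A B C P Q R}, A = frame a u w P → B = frame a u w Q → C = frame a u w R →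
      dt A B C = dt P Q R := by
    rintro A B C P Q R h1 h2 h3; rw [h1, h2, h3, dt_frame, hcr, one_mul]
  have hline : ∀ P ∈ A \ {a, b, c}, ∃ k, P = frame a u w (1, k) := by
    intro P hP
    obtain ⟨⟨x, k⟩, rfl⟩ := exists_frame_eq (.inl hcr) a P
    have := dt_eq_zero_of_line hpq hb (hI e heI) (hI _ hP)
    rw [fr hbf hef rfl] at this
    simp [dt] at this
    exact ⟨k, by rw [show x = 1 by omega]⟩
  obtain ⟨⟨x, y⟩, hc⟩ := exists_frame_eq (.inl hcr) a c
  obtain ⟨k, hk⟩ := hline f hfI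
  have he2 := he.2.1
  have he3 := he.2.2
  rw [fr hbf hc.symm hef] at he2
  rw [fr hc.symm ha hef] at he3
  have hf1 := hf.1
  rw [fr hbf hc.symm hk] at hf1
  simp [dt] at he2 he3 hf1
  have hx : x = 2 := by
    have := Int.eq_one_or_neg_one_of_mul_eq_one hf1
    omega
  subst hx
  have hodd : ∃ g, y = 2 * g + 1 := by
    rcases Int.even_or_odd' y with ⟨m, rfl | rfl⟩
    · exfalso
      have hT : InTri (2, 2 * m) (0, 0) (0, 0) (1, m) :=
        ⟨1, 1, 0, by omega, by omega, by omega, by omega, by ring, by ring⟩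
      have hT' := hT.map_frame a u w
      rw [hc, frame_zero] at hT'
      rcases h.edge_last _ hT' with h' | h'
      · rw [← hc] at h'
        simpa using frame_inj (.inl hcr) h'
      · nth_rw 2 [← frame_zero a u w] at h'
        simpa using frame_inj (.inl hcr) h'
    · exact ⟨m, rfl⟩
  obtain ⟨g, rfl⟩ := hodd
  refine ⟨u, w, g, by omega, .inl hcr, fun P => ?_⟩
  rw [hc]
  constructor
  · intro hP
    by_cases h1 : P = a
    · exact .inl h1
    by_cases h2 : P = c
    · exact .inr (.inl h2)
    by_cases h3 : P = b
    · exact .inr (.inr ⟨0, le_rfl, by omega, by rw [h3, ← hbf]⟩)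
    have hPI : P ∈ A \ {a, b, c} := ⟨hP, by simp [h1, h2, h3]⟩
    obtain ⟨k, rfl⟩ := hline P hPI
    have hpos := h.dt_pos_of_mem hPI
    rw [fr ha hbf rfl, fr hc.symm ha rfl] at hpos
    simp [dt] at hpos
    exact .inr (.inr ⟨k, by omega, by omega, rfl⟩)
  · rintro (rfl | rfl | ⟨k, h0, h1, rfl⟩)
    · exact h.left_mem
    · exact h.right_mem
    · have hT : InTri (0, 0) (1, 0) (2, 2 * g + 1) (1, k) :=
        ⟨k, 2 * g + 1 - 2 * k, k, by omega, by omega, by omega, by omega, by ring, by ring⟩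
      have hT' := hT.map_frame a u w
      rw [← ha, ← hbf, hc] at hT'
      exact hA h.left_mem h.mid_mem h.right_mem hT'

theorem exists_hypNormal (h : PrimTri A a b c) (hA : LConv A) (hE : ¬ EmptyTri a b c)
    {p q : ℤ × ℤ} (hp : p ∈ A \ {a, b, c}) (hq : q ∈ A \ {a, b, c}) (hpq : p ≠ q)
    (hI : ∀ r ∈ A \ {a, b, c}, dt p q r = 0) : ∃ o u w g, 1 ≤ g ∧ HypNormal A o u w g := by
  have hset : ∀ a b c : ℤ × ℤ, A \ {b, c, a} = A \ {a, b, c} := by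
    intro a b c
    ext
    simp only [Set.mem_sdiff, Set.mem_insert_iff, Set.mem_singleton_iff]
    tauto
  have key : ∀ {a b c}, PrimTri A a b c → ¬ EmptyTri a b c → p ∈ A \ {a, b, c} →
      q ∈ A \ {a, b, c} → (∀ r ∈ A \ {a, b, c}, dt p q r = 0) → dt p q a * dt p q b ≤ 0 := by
    intro a b c h hE hp hq hI
    obtain ⟨e, he⟩ := h.exists_cap hE
    exact he.mul_nonpos (h.dt_pos_of_mem hp) (h.dt_pos_of_mem hq) (hI e (h.cap_mem hA he))
  have k1 := key h hE hp hq hI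
  have k2 := key h.rot (fun h => hE h.rot.rot) (by rwa [hset]) (by rwa [hset]) (by rwa [hset])
  have k3 := key h.rot.rot (fun h => hE h.rot) (by rwa [hset, hset]) (by rwa [hset, hset])
    (by rwa [hset, hset])
  have : dt p q a = 0 ∨ dt p q b = 0 ∨ dt p q c = 0 := by
    by_contra! hne
    obtain ⟨h1, h2, h3⟩ := hne
    rcases h1.lt_or_gt with h1 | h1 <;> rcases h2.lt_or_gt with h2 | h2 <;>
      rcases h3.lt_or_gt with h3 | h3 <;> nlinarith
  rcases this with h0 | h0 | h0
  · exact ⟨c, h.rot.rot.hypNormal_of_line hA (fun h => hE h.rot) hpq (by rwa [hset, hset]) h0⟩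
  · exact ⟨a, h.hypNormal_of_line hA hE hpq hI h0⟩
  · exact ⟨b, h.rot.hypNormal_of_line hA (fun h => hE h.rot.rot) hpq (by rwa [hset]) h0⟩

end PrimTri

theorem toR_fst (p : ℤ × ℤ) : (toR p).1 = p.1 := rfl

theorem toR_snd (p : ℤ × ℤ) : (toR p).2 = p.2 := rfl

theorem toR_injective : Function.Injective toR := by
  intro p q h
  have h1 := congrArg Prod.fst h
  have h2 := congrArg Prod.snd h
  simp only [toR, Int.cast_inj] at h1 h2
  exact Prod.ext h1 h2

/-- Twice the signed area of a real triangle. -/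
def dtR (a b c : ℝ × ℝ) : ℝ := (b.1 - a.1) * (c.2 - a.2) - (b.2 - a.2) * (c.1 - a.1)

theorem dtR_toR (a b c : ℤ × ℤ) : dtR (toR a) (toR b) (toR c) = dt a b c := by
  simp [dtR, dt, toR]

theorem dtR_rot (a b c : ℝ × ℝ) : dtR b c a = dtR a b c := by simp only [dtR]; ring

theorem continuous_dtR (a b : ℝ × ℝ) : Continuous (dtR a b) := by
  unfold dtR; fun_prop

theorem mem_convexHull_triple {a b c x : ℝ × ℝ} : x ∈ convexHull ℝ {a, b, c} ↔
    ∃ α β γ : ℝ, 0 ≤ α ∧ 0 ≤ β ∧ 0 ≤ γ ∧ α + β + γ = 1 ∧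
      x.1 = α * a.1 + β * b.1 + γ * c.1 ∧ x.2 = α * a.2 + β * b.2 + γ * c.2 := by
  constructor
  · intro hx
    rw [convexHull_insert (by simp), convexHull_pair, mem_convexJoin] at hx
    obtain ⟨y, rfl, z, ⟨s, t, hs, ht, hst, rfl⟩, ⟨s', t', hs', ht', hst', rfl⟩⟩ := hx
    refine ⟨s', t' * s, t' * t, hs', by positivity, by positivity, ?_, ?_, ?_⟩
    · rw [add_assoc, ← mul_add, hst, mul_one, hst']
    · simp; ring
    · simp; ring
  · rintro ⟨α, β, γ, h1, h2, h3, h4, h5, h6⟩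
    have hC := convex_convexHull ℝ {a, b, c}
    have := hC.sum_mem (t := Finset.univ) (w := ![α, β, γ]) (z := ![a, b, c])
      (by intro i; fin_cases i <;> simp [*]) (by simp [Fin.sum_univ_three, h4])
      (by intro i _; apply subset_convexHull; fin_cases i <;> simp)
    convert this using 1
    ext <;> simp [Fin.sum_univ_three, h5, h6]

theorem mem_convexHull_iff_dtR {a b c x : ℝ × ℝ} (h : 0 < dtR a b c) :
    x ∈ convexHull ℝ {a, b, c} ↔ 0 ≤ dtR b c x ∧ 0 ≤ dtR c a x ∧ 0 ≤ dtR a b x := by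
  rw [mem_convexHull_triple]
  constructor
  · rintro ⟨α, β, γ, h1, h2, h3, h4, h5, h6⟩
    have hα : α = 1 - β - γ := by linarith
    have e1 : dtR b c x = α * dtR a b c := by simp only [dtR, h5, h6, hα]; ring
    have e2 : dtR c a x = β * dtR a b c := by simp only [dtR, h5, h6, hα]; ring
    have e3 : dtR a b x = γ * dtR a b c := by simp only [dtR, h5, h6, hα]; ring
    rw [e1, e2, e3]
    exact ⟨by positivity, by positivity, by positivity⟩
  · rintro ⟨h1, h2, h3⟩
    have hne := h.ne'
    refine ⟨dtR b c x / dtR a b c, dtR c a x / dtR a b c, dtR a b x / dtR a b c, by positivity,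
      by positivity, by positivity, ?_, ?_, ?_⟩ <;> field_simp <;> simp only [dtR] <;> ring

theorem dtR_pos_of_mem_interior {a b c x : ℝ × ℝ} (h : 0 < dtR a b c)
    (hx : x ∈ interior (convexHull ℝ {a, b, c})) : 0 < dtR a b x := by
  refine ((mem_convexHull_iff_dtR h).1 (interior_subset hx)).2.2.lt_of_ne fun h0 => ?_
  have hcont : Filter.Tendsto (fun t : ℝ => x + t • (x - c)) (nhdsWithin 0 (Set.Ioi 0)) (nhds x) := by
    have : Continuous fun t : ℝ => x + t • (x - c) := by fun_prop
    have := (this.tendsto 0).mono_left (nhdsWithin_le_nhds (s := Set.Ioi 0))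
    simpa using this
  obtain ⟨t, ht, ht0⟩ := ((hcont.eventually (isOpen_interior.mem_nhds hx)).and
    self_mem_nhdsWithin).exists
  have h1 := ((mem_convexHull_iff_dtR h).1 (interior_subset ht)).2.2
  have e : dtR a b (x + t • (x - c)) = dtR a b x + t * (dtR a b x - dtR a b c) := by
    simp only [dtR, Prod.fst_add, Prod.snd_add, Prod.smul_fst, Prod.smul_snd, Prod.fst_sub,
      Prod.snd_sub, smul_eq_mul]
    ring
  rw [e, ← h0] at h1
  have : 0 < t * dtR a b c := mul_pos ht0 h
  linarith

theorem mem_interior_iff_dtR {a b c x : ℝ × ℝ} (h : 0 < dtR a b c) :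
    x ∈ interior (convexHull ℝ {a, b, c}) ↔ 0 < dtR b c x ∧ 0 < dtR c a x ∧ 0 < dtR a b x := by
  have hset : ∀ a b c : ℝ × ℝ, ({a, b, c} : Set (ℝ × ℝ)) = {b, c, a} := by
    intro a b c
    ext
    simp only [Set.mem_insert_iff, Set.mem_singleton_iff]
    tauto
  constructor
  · intro hx
    refine ⟨dtR_pos_of_mem_interior (c := a) (by rwa [dtR_rot]) (by rwa [← hset]),
      dtR_pos_of_mem_interior (c := b) (by rwa [dtR_rot, dtR_rot]) (by rwa [← hset, ← hset]),
      dtR_pos_of_mem_interior h hx⟩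
  · intro hx
    refine mem_interior.2 ⟨{x | 0 < dtR b c x ∧ 0 < dtR c a x ∧ 0 < dtR a b x}, fun y hy =>
      (mem_convexHull_iff_dtR h).2 ⟨hy.1.le, hy.2.1.le, hy.2.2.le⟩, ?_, hx⟩
    exact ((isOpen_lt continuous_const (continuous_dtR b c)).inter
      ((isOpen_lt continuous_const (continuous_dtR c a)).inter
        (isOpen_lt continuous_const (continuous_dtR a b))))

theorem InTri.toR_mem {a b c p : ℤ × ℤ} (h : InTri a b c p) :
    toR p ∈ convexHull ℝ {toR a, toR b, toR c} := by
  obtain ⟨α, β, γ, h1, h2, h3, h4, h5, h6⟩ := h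
  have r1 : (0 : ℝ) ≤ α := by exact_mod_cast h1
  have r2 : (0 : ℝ) ≤ β := by exact_mod_cast h2
  have r3 : (0 : ℝ) ≤ γ := by exact_mod_cast h3
  have r4 : (0 : ℝ) < α + β + γ := by exact_mod_cast h4
  have r5 : ((α : ℝ) + β + γ) * p.1 = α * a.1 + β * b.1 + γ * c.1 := by exact_mod_cast h5
  have r6 : ((α : ℝ) + β + γ) * p.2 = α * a.2 + β * b.2 + γ * c.2 := by exact_mod_cast h6
  have hne := r4.ne'
  refine mem_convexHull_triple.2 ⟨α / (α + β + γ), β / (α + β + γ), γ / (α + β + γ),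
    by positivity, by positivity, by positivity, by field_simp, ?_, ?_⟩
  · simp only [toR]
    field_simp
    linarith
  · simp only [toR]
    field_simp
    linarith

namespace IsLatticePolygon

variable {Γ : Set (ℝ × ℝ)}

theorem convex (h : IsLatticePolygon Γ) : Convex ℝ Γ := by
  obtain ⟨S, rfl⟩ := h
  exact convex_convexHull ℝ _

theorem isCompact (h : IsLatticePolygon Γ) : IsCompact Γ := by
  obtain ⟨S, rfl⟩ := h
  exact (S.finite_toSet.image toR).isCompact_convexHull (𝕜 := ℝ)

theorem eq_convexHull (h : IsLatticePolygon Γ) : Γ = convexHull ℝ (toR '' latticePts Γ) := by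
  refine Set.Subset.antisymm ?_
    (convexHull_min (𝕜 := ℝ) (by rintro _ ⟨p, hp, rfl⟩; exact hp) h.convex)
  obtain ⟨S, rfl⟩ := h
  exact convexHull_mono (Set.image_mono fun p hp =>
    subset_convexHull ℝ _ (Set.mem_image_of_mem toR hp))

theorem lconv (h : IsLatticePolygon Γ) : LConv (latticePts Γ) := by
  intro a b c p ha hb hc hT
  refine convexHull_min (𝕜 := ℝ) ?_ h.convex hT.toR_mem
  rintro _ (rfl | rfl | rfl) <;> assumption

theorem finite (h : IsLatticePolygon Γ) : (latticePts Γ).Finite := by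
  obtain ⟨R, hR⟩ := h.isCompact.isBounded.exists_norm_le
  refine (Set.finite_Icc ((-⌈R⌉, -⌈R⌉) : ℤ × ℤ) (⌈R⌉, ⌈R⌉)).subset fun p hp => ?_
  have h1 := hR _ hp
  rw [Prod.norm_def, max_le_iff, Real.norm_eq_abs, Real.norm_eq_abs, abs_le, abs_le, toR_fst,
    toR_snd] at h1
  have h2 := Int.le_ceil R
  refine ⟨⟨?_, ?_⟩, ⟨?_, ?_⟩⟩ <;> rify <;> linarith

theorem eq_convexHull_triple (h : IsLatticePolygon Γ) {a b c : ℤ × ℤ} (ha : a ∈ latticePts Γ)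
    (hb : b ∈ latticePts Γ) (hc : c ∈ latticePts Γ) (hT : ∀ P ∈ latticePts Γ, InTri a b c P) :
    Γ = convexHull ℝ {toR a, toR b, toR c} := by
  refine Set.Subset.antisymm ?_ (convexHull_min ?_ h.convex)
  · rw [h.eq_convexHull]
    refine convexHull_min ?_ (convex_convexHull ℝ _)
    rintro _ ⟨p, hp, rfl⟩
    exact (hT p hp).toR_mem
  · rintro _ (rfl | rfl | rfl) <;> assumption

end IsLatticePolygon

theorem latticePts_frontier {Γ : Set (ℝ × ℝ)} (h : IsLatticePolygon Γ) :
    latticePts (frontier Γ) = latticePts Γ \ latticePts (interior Γ) := by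
  rw [h.isCompact.isClosed.frontier_eq]; rfl

namespace PrimTri

variable {Γ : Set (ℝ × ℝ)} {a b c : ℤ × ℤ}

theorem eq_convexHull (hΓ : IsLatticePolygon Γ) (h : PrimTri (latticePts Γ) a b c) :
    Γ = convexHull ℝ {toR a, toR b, toR c} :=
  hΓ.eq_convexHull_triple h.left_mem h.mid_mem h.right_mem h.inTri

theorem latticePts_interior (hΓ : IsLatticePolygon Γ) (h : PrimTri (latticePts Γ) a b c) :
    latticePts (interior Γ) = latticePts Γ \ {a, b, c} := by
  have hpos : 0 < dtR (toR a) (toR b) (toR c) := by rw [dtR_toR]; exact_mod_cast h.pos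
  have key : ∀ P, P ∈ latticePts (interior Γ) ↔ 0 < dt b c P ∧ 0 < dt c a P ∧ 0 < dt a b P := by
    intro P
    change toR P ∈ interior Γ ↔ _
    rw [h.eq_convexHull hΓ, mem_interior_iff_dtR hpos, dtR_toR, dtR_toR, dtR_toR]
    norm_cast
  ext P
  constructor
  · intro hP
    refine ⟨interior_subset (s := Γ) hP, ?_⟩
    rw [key] at hP
    rintro (rfl | rfl | rfl)
    · rw [dt_self_left] at hP; omega
    · rw [dt_self_left] at hP; omega
    · rw [dt_self_right] at hP; omega
  · intro hP
    have := h.dt_pos_of_mem hP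
    exact (key P).2 ⟨this.2.1, this.2.2, this.1⟩

theorem latticePts_frontier (hΓ : IsLatticePolygon Γ) (h : PrimTri (latticePts Γ) a b c) :
    latticePts (frontier Γ) = {a, b, c} := by
  rw [_root_.latticePts_frontier hΓ, h.latticePts_interior hΓ, Set.sdiff_sdiff_cancel_left]
  rintro _ (rfl | rfl | rfl)
  exacts [h.left_mem, h.mid_mem, h.right_mem]

end PrimTri

theorem collinear_toR_image {I : Set (ℤ × ℤ)} :
    Collinear ℝ (toR '' I) ↔ ∀ p ∈ I, ∀ q ∈ I, ∀ r ∈ I, dt p q r = 0 := by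
  constructor
  · intro h p hp q hq r hr
    obtain ⟨v, hv⟩ := (collinear_iff_of_mem (Set.mem_image_of_mem toR hp)).1 h
    obtain ⟨s, hs⟩ := hv _ (Set.mem_image_of_mem toR hq)
    obtain ⟨t, ht⟩ := hv _ (Set.mem_image_of_mem toR hr)
    have : dtR (toR p) (toR q) (toR r) = 0 := by
      rw [hs, ht]
      simp only [dtR, vadd_eq_add, Prod.fst_add, Prod.snd_add, Prod.smul_fst, Prod.smul_snd,
        smul_eq_mul]
      ring
    rw [dtR_toR] at this
    exact_mod_cast this
  · intro h
    rcases I.subsingleton_or_nontrivial with hI | ⟨p, hp, q, hq, hpq⟩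
    · rcases hI.eq_empty_or_singleton with rfl | ⟨x, rfl⟩
      · simpa using collinear_empty ℝ (ℝ × ℝ)
      · simpa using collinear_singleton ℝ (toR x)
    refine (collinear_iff_of_mem (Set.mem_image_of_mem toR hp)).2 ⟨toR q - toR p, ?_⟩
    rintro _ ⟨r, hr, rfl⟩
    have h0 : dtR (toR p) (toR q) (toR r) = 0 := by rw [dtR_toR, h p hp q hq r hr, Int.cast_zero]
    simp only [dtR] at h0
    by_cases hx : (toR q).1 - (toR p).1 = 0
    · have hy : (toR q).2 - (toR p).2 ≠ 0 := fun hy => hpq (toR_injective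
        (Prod.ext (sub_eq_zero.1 hx) (sub_eq_zero.1 hy))).symm
      refine ⟨((toR r).2 - (toR p).2) / ((toR q).2 - (toR p).2), Prod.ext ?_ ?_⟩ <;>
        simp only [vadd_eq_add, Prod.fst_add, Prod.snd_add, Prod.smul_fst, Prod.smul_snd,
          smul_eq_mul, Prod.fst_sub, Prod.snd_sub] <;> field_simp <;> linarith
    · refine ⟨((toR r).1 - (toR p).1) / ((toR q).1 - (toR p).1), Prod.ext ?_ ?_⟩ <;>
        simp only [vadd_eq_add, Prod.fst_add, Prod.snd_add, Prod.smul_fst, Prod.smul_snd,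
          smul_eq_mul, Prod.fst_sub, Prod.snd_sub] <;> field_simp <;> linarith

theorem collinear_convexHull {s : Set (ℝ × ℝ)} :
    Collinear ℝ (convexHull ℝ s) ↔ Collinear ℝ s := by
  rw [Collinear, Collinear, ← direction_affineSpan, affineSpan_convexHull, direction_affineSpan]

theorem isHyperelliptic_iff {Γ : Set (ℝ × ℝ)} : IsHyperelliptic Γ ↔
    (∀ p ∈ latticePts (interior Γ), ∀ q ∈ latticePts (interior Γ), ∀ r ∈ latticePts (interior Γ),
      dt p q r = 0) ∧ (latticePts (interior Γ)).Nontrivial := by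
  rw [IsHyperelliptic, interiorHull, collinear_convexHull, collinear_toR_image]
  refine and_congr_right fun _ => ⟨fun h => ?_, fun h => ?_⟩
  · by_contra hI
    rw [Set.not_nontrivial_iff] at hI
    have := (hI.image toR)
    rw [this.convex.convexHull_eq] at h
    exact Set.not_nontrivial_iff.2 this h
  · exact (h.image toR_injective).mono (subset_convexHull ℝ _)

theorem IsLatticePolygon.exists_primTri {Γ : Set (ℝ × ℝ)} (hΓ : IsLatticePolygon Γ)
    (hdim : ¬ Collinear ℝ Γ) (h3 : (latticePts (frontier Γ)).ncard = 3) :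
    ∃ a b c, PrimTri (latticePts Γ) a b c := by
  obtain ⟨a, b, c, -, -, -, hF⟩ := Set.ncard_eq_three.1 h3
  have hsub : toR '' latticePts (frontier Γ) ⊆ Γ := by
    rintro _ ⟨p, hp, rfl⟩
    rw [latticePts_frontier hΓ] at hp
    exact hp.1
  have hE : Γ.extremePoints ℝ ⊆ toR '' latticePts (frontier Γ) := by
    intro x hx
    have hx' := hx
    rw [hΓ.eq_convexHull] at hx'
    obtain ⟨p, hp, rfl⟩ := extremePoints_convexHull_subset hx'
    refine ⟨p, ?_, rfl⟩
    rw [latticePts_frontier hΓ]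
    exact ⟨hp, fun hp' => Set.disjoint_left.1 (disjoint_interior_extremePoints Γ) hp' hx⟩
  have hull : Γ = convexHull ℝ {toR a, toR b, toR c} := by
    rw [hF, Set.image_insert_eq, Set.image_pair] at hE hsub
    refine Set.Subset.antisymm ?_ (convexHull_min hsub hΓ.convex)
    rw [← closure_convexHull_extremePoints hΓ.isCompact hΓ.convex]
    refine (closure_mono (convexHull_mono hE)).trans_eq ?_
    exact (Set.Finite.isCompact_convexHull (𝕜 := ℝ) (by simp)).isClosed.closure_eq
  have main : ∀ a b c, 0 < dt a b c → latticePts (frontier Γ) = {a, b, c} →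
      Γ = convexHull ℝ {toR a, toR b, toR c} → PrimTri (latticePts Γ) a b c := by
    intro a b c hpos hF hull
    have hposR : 0 < dtR (toR a) (toR b) (toR c) := by rw [dtR_toR]; exact_mod_cast hpos
    have hmem : ∀ p ∈ ({a, b, c} : Set (ℤ × ℤ)), p ∈ latticePts Γ := by
      rw [← hF, latticePts_frontier hΓ]
      exact fun p hp => hp.1
    have hT : ∀ P ∈ latticePts Γ, InTri a b c P := by
      intro P hP
      have hP' : toR P ∈ Γ := hP
      rw [hull, mem_convexHull_iff_dtR hposR, dtR_toR, dtR_toR, dtR_toR] at hP'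
      exact (InTri.iff_dt hpos).2 (by exact_mod_cast hP')
    have ha := hmem a (by simp)
    have hb := hmem b (by simp)
    have hc := hmem c (by simp)
    have edge : ∀ p ∈ latticePts Γ, dt a b p = 0 ∨ dt b c p = 0 ∨ dt c a p = 0 →
        p = a ∨ p = b ∨ p = c := by
      intro p hp h0
      have : p ∈ latticePts (frontier Γ) := by
        rw [latticePts_frontier hΓ]
        refine ⟨hp, fun hp' => ?_⟩
        have hp' : toR p ∈ interior Γ := hp'
        rw [hull, mem_interior_iff_dtR hposR, dtR_toR, dtR_toR, dtR_toR] at hp'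
        norm_cast at hp'
        omega
      rwa [hF] at this
    have dt0 : ∀ {x y p}, InTri x y y p → dt x y p = 0 := by
      rintro x y p ⟨α, β, γ, -, -, -, h4, h5, h6⟩
      have := InTri.dt_mul α β γ h5 h6 x y
      rw [dt_self_left, dt_self_right] at this
      have : (α + β + γ) * dt x y p = 0 := by rw [this]; ring
      exact (mul_eq_zero.1 this).resolve_left h4.ne'
    have r1 : dt b c a = dt a b c := dt_rot _ _ _
    have r2 : dt c a b = dt a b c := by rw [dt_rot, dt_rot]
    refine ⟨ha, hb, hc, hpos, fun e he => ?_, fun e he => ?_, fun e he => ?_, hT⟩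
    · rcases edge e (hΓ.lconv ha hb hb he) (.inl (dt0 he)) with h | h | rfl
      · exact .inl h
      · exact .inr h
      · have := dt0 he
        omega
    · rcases edge e (hΓ.lconv hb hc hc he) (.inr (.inl (dt0 he))) with rfl | h | h
      · have := dt0 he
        omega
      · exact .inl h
      · exact .inr h
    · rcases edge e (hΓ.lconv hc ha ha he) (.inr (.inr (dt0 he))) with h | rfl | h
      · exact .inr h
      · have := dt0 he
        omega
      · exact .inl h
  rcases lt_trichotomy (dt a b c) 0 with hneg | h0 | hpos
  · refine ⟨a, c, b, main a c b (by rw [dt_swap]; omega) ?_ ?_⟩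
    · rw [hF, Set.pair_comm]
    · rw [hull, Set.pair_comm]
  · refine absurd ?_ hdim
    have himg : ({toR a, toR b, toR c} : Set (ℝ × ℝ)) = toR '' {a, b, c} := by
      rw [Set.image_insert_eq, Set.image_pair]
    rw [hull, himg, collinear_convexHull, collinear_toR_image]
    simp only [Set.mem_insert_iff, Set.mem_singleton_iff]
    rintro _ (rfl | rfl | rfl) _ (rfl | rfl | rfl) _ (rfl | rfl | rfl) <;>
      simp only [dt] at h0 ⊢ <;> linarith
  · exact ⟨a, b, c, main a b c hpos hF hull⟩

theorem unimodMap_image_convexHull (M : Matrix (Fin 2) (Fin 2) ℤ) (v : ℤ × ℤ) (a b c : ℝ × ℝ) :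
    unimodMap M v '' convexHull ℝ {a, b, c} =
      convexHull ℝ {unimodMap M v a, unimodMap M v b, unimodMap M v c} := by
  have key : ∀ {α β γ : ℝ} {x : ℝ × ℝ}, α + β + γ = 1 → x.1 = α * a.1 + β * b.1 + γ * c.1 →
      x.2 = α * a.2 + β * b.2 + γ * c.2 →
      (unimodMap M v x).1 = α * (unimodMap M v a).1 + β * (unimodMap M v b).1 +
        γ * (unimodMap M v c).1 ∧
      (unimodMap M v x).2 = α * (unimodMap M v a).2 + β * (unimodMap M v b).2 +
        γ * (unimodMap M v c).2 := by
    intro α β γ x h4 h5 h6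
    obtain rfl : α = 1 - β - γ := by linarith
    simp only [unimodMap, h5, h6]
    constructor <;> ring
  ext y
  constructor
  · rintro ⟨x, hx, rfl⟩
    obtain ⟨α, β, γ, h1, h2, h3, h4, h5, h6⟩ := mem_convexHull_triple.1 hx
    exact mem_convexHull_triple.2 ⟨α, β, γ, h1, h2, h3, h4, key h4 h5 h6⟩
  · intro hy
    obtain ⟨α, β, γ, h1, h2, h3, h4, h5, h6⟩ := mem_convexHull_triple.1 hy
    set x : ℝ × ℝ := (α * a.1 + β * b.1 + γ * c.1, α * a.2 + β * b.2 + γ * c.2)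
    have := key (x := x) h4 rfl rfl
    exact ⟨x, mem_convexHull_triple.2 ⟨α, β, γ, h1, h2, h3, h4, rfl, rfl⟩,
      Prod.ext (this.1.trans h5.symm) (this.2.trans h6.symm)⟩

theorem PrimTri.unimodEquiv {Γ : Set (ℝ × ℝ)} {a b c : ℤ × ℤ} (hΓ : IsLatticePolygon Γ)
    (h : PrimTri (latticePts Γ) a b c) (h1 : dt a b c = 1) : UnimodEquiv Γ SigmaTri := by
  refine ⟨!![c.2 - a.2, -(c.1 - a.1); -(b.2 - a.2), b.1 - a.1],
    (-((c.2 - a.2) * a.1 - (c.1 - a.1) * a.2), (b.2 - a.2) * a.1 - (b.1 - a.1) * a.2), ?_, ?_⟩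
  · rw [Matrix.det_fin_two_of]
    convert isUnit_one
    rw [← h1, dt]; ring
  · have h1' : dtR (toR a) (toR b) (toR c) = 1 := by rw [dtR_toR, h1, Int.cast_one]
    simp only [dtR, toR] at h1'
    rw [h.eq_convexHull hΓ, unimodMap_image_convexHull, SigmaTri]
    refine congrArg (convexHull ℝ) ?_
    refine congrArg₂ _ ?_ (congrArg₂ _ ?_ (congrArg _ ?_)) <;> refine Prod.ext ?_ ?_ <;>
      simp [unimodMap, toR] <;> linarith

theorem UnimodEquiv.isolatedTriples_eq_empty {Γ : Set (ℝ × ℝ)} (hΓ : IsLatticePolygon Γ)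
    (h : UnimodEquiv Γ SigmaTri) : isolatedTriples (latticePts Γ) = ∅ := by
  obtain ⟨M, v, hM, hS⟩ := h
  have hM' : |M.det| = 1 := Int.isUnit_iff_abs_eq.1 hM
  set f : ℤ × ℤ → ℤ × ℤ := fun p =>
    (M 0 0 * p.1 + M 0 1 * p.2 + v.1, M 1 0 * p.1 + M 1 1 * p.2 + v.2)
  have hf : ∀ p ∈ latticePts Γ, f p = (0, 0) ∨ f p = (1, 0) ∨ f p = (0, 1) := by
    intro p hp
    have hmem : toR (f p) ∈ SigmaTri := by
      rw [hS]
      refine ⟨toR p, hp, ?_⟩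
      simp [f, toR, unimodMap]
    rw [SigmaTri, mem_convexHull_iff_dtR (by simp [dtR])] at hmem
    simp only [dtR, toR] at hmem
    norm_num at hmem
    obtain ⟨h1, h2, h3⟩ := hmem
    have h1 : (f p).1 + (f p).2 ≤ 1 := by rify; linarith
    simp only [Prod.ext_iff]
    omega
  have hdt : ∀ p q r, dt (f p) (f q) (f r) = M.det * dt p q r := by
    intro p q r
    simp only [dt, f, Matrix.det_fin_two]
    ring
  rw [Set.eq_empty_iff_forall_notMem]
  rintro _ ⟨a, b, c, ha, hb, hc, rfl, hI, hE⟩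
  have h0 := dt_ne_zero_of_primEdge (hI.1.primEdge hΓ.lconv ha hb)
    (hI.2.1.primEdge hΓ.lconv hb hc) hE
  have h1 : |dt a b c| = |dt (f a) (f b) (f c)| := by rw [hdt, abs_mul, hM', one_mul]
  have h2 : |dt (f a) (f b) (f c)| ≤ 1 := by
    rcases hf a ha with h | h | h <;> rcases hf b hb with h' | h' | h' <;>
      rcases hf c hc with h'' | h'' | h'' <;> rw [h, h', h''] <;> decide
  have h3 := abs_pos.2 h0
  exact hE (.of_abs_dt_eq_one (by omega))

theorem exists_primTri_of_mem_isolatedTriples {A : Set (ℤ × ℤ)} (hA : LConv A) (hfin : A.Finite)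
    {m : Multiset (ℤ × ℤ)} (hm : m ∈ isolatedTriples A) :
    (∃ a b c, PrimTri A a b c ∧ m = {a, b, c}) ∨ ∃ o u w g, 2 ≤ g ∧ HypNormal A o u w g := by
  obtain ⟨a, b, c, ha, hb, hc, rfl, hI, hE⟩ := hm
  have e1 := hI.1.primEdge hA ha hb
  have e2 := hI.2.1.primEdge hA hb hc
  have e3 := hI.2.2.primEdge hA hc ha
  rcases hI.classify hA ha hb hc hE with h | h | h | h
  · left
    rcases (dt_ne_zero_of_primEdge e1 e2 hE).lt_or_gt with h0 | h0
    · exact ⟨a, c, b, ⟨ha, hc, hb, by rw [dt_swap]; omega, e3.symm, e2.symm, e1.symm,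
        fun P hP => (h P hP).swap⟩, multiset_swap a b c⟩
    · exact ⟨a, b, c, ⟨ha, hb, hc, h0, e1, e2, e3, h⟩, rfl⟩
  · exact .inr ⟨_, h.exists_hypNormal hA hfin ha hc⟩
  · exact .inr ⟨_, h.exists_hypNormal hA hfin hb ha⟩
  · exact .inr ⟨_, h.exists_hypNormal hA hfin hc hb⟩

theorem HypNormal.isHyperelliptic {Γ : Set (ℝ × ℝ)} (hΓ : IsLatticePolygon Γ) {o u w : ℤ × ℤ}
    {g : ℤ} (h : HypNormal (latticePts Γ) o u w g) (hg : 2 ≤ g) : IsHyperelliptic Γ := by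
  have hI : latticePts (interior Γ) =
      latticePts Γ \ {o, frame o u w (1, 0), frame o u w (2, 2 * g + 1)} := by
    rcases h.primTri hΓ.lconv (by omega) with h' | h'
    · exact h'.latticePts_interior hΓ
    · rw [h'.latticePts_interior hΓ, Set.pair_comm]
  have hcol : ∀ p ∈ latticePts (interior Γ), ∃ k, p = frame o u w (1, k) := by
    intro p hp
    rw [hI] at hp
    simp only [Set.mem_sdiff, Set.mem_insert_iff, Set.mem_singleton_iff, not_or] at hp
    exact h.mem_column hp.1 hp.2.1 hp.2.2.2
  have hmem : ∀ k, 1 ≤ k → k ≤ g → frame o u w (1, k) ∈ latticePts (interior Γ) := by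
    intro k h1 h2
    rw [hI]
    refine ⟨h.column_mem (by omega) h2, ?_⟩
    rintro (h' | h' | h')
    · simpa using frame_inj h.cross_eq (h'.trans (frame_zero o u w).symm)
    · have := congrArg Prod.snd (frame_inj h.cross_eq h')
      simp only at this
      omega
    · simpa using frame_inj h.cross_eq h'
  refine isHyperelliptic_iff.2 ⟨fun p hp q hq r hr => ?_, _, hmem 1 le_rfl (by omega), _,
    hmem 2 (by omega) hg, fun h' => ?_⟩
  · obtain ⟨i, rfl⟩ := hcol p hp
    obtain ⟨j, rfl⟩ := hcol q hq
    obtain ⟨k, rfl⟩ := hcol r hr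
    rw [dt_frame]
    simp [dt]
  · simpa using frame_inj h.cross_eq h'

theorem IsLatticePolygon.exists_primTri_of_mem {Γ : Set (ℝ × ℝ)} (hΓ : IsLatticePolygon Γ)
    {m : Multiset (ℤ × ℤ)} (hm : m ∈ isolatedTriples (latticePts Γ)) :
    ∃ a b c, PrimTri (latticePts Γ) a b c := by
  rcases exists_primTri_of_mem_isolatedTriples hΓ.lconv hΓ.finite hm with
    ⟨a, b, c, h, -⟩ | ⟨o, u, w, g, hg, h⟩
  · exact ⟨a, b, c, h⟩
  · rcases h.primTri hΓ.lconv (by omega) with h | h <;> exact ⟨_, _, _, h⟩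

theorem PrimTri.not_emptyTri {Γ : Set (ℝ × ℝ)} {a b c : ℤ × ℤ} (hΓ : IsLatticePolygon Γ)
    (h : PrimTri (latticePts Γ) a b c) (hS : ¬ UnimodEquiv Γ SigmaTri) : ¬ EmptyTri a b c :=
  fun hE => hS (h.unimodEquiv hΓ (le_antisymm hE.dt_le_one h.pos))

theorem stmt2 (k : Type*) [Field k] [IsAlgClosed k] (Γ : Set (ℝ × ℝ))
    (hpoly : IsLatticePolygon Γ) (hdim : ¬ Collinear ℝ Γ) :
    (4 ≤ (latticePts (frontier Γ)).ncard ∨ UnimodEquiv Γ SigmaTri →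
        cubicDefect k Γ = 0) ∧
    ((latticePts (frontier Γ)).ncard = 3 ∧ ¬ UnimodEquiv Γ SigmaTri ∧
        ¬ IsHyperelliptic Γ →
        cubicDefect k Γ = 1) ∧
    ((latticePts (frontier Γ)).ncard = 3 ∧ ¬ UnimodEquiv Γ SigmaTri ∧
        IsHyperelliptic Γ →
        cubicDefect k Γ = (latticePts Γ).ncard - 3) := by
  have hA := hpoly.lconv
  rw [cubicDefect_eq_ncard k hA hpoly.finite]
  refine ⟨?_, ?_, ?_⟩
  · rintro (h4 | hS)
    · suffices isolatedTriples (latticePts Γ) = ∅ by rw [this, Set.ncard_empty]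
      rw [Set.eq_empty_iff_forall_notMem]
      intro m hm
      obtain ⟨a, b, c, h⟩ := hpoly.exists_primTri_of_mem hm
      rw [h.latticePts_frontier hpoly] at h4
      have h1 := Set.ncard_insert_le a {b, c}
      have h2 := Set.ncard_insert_le b {c}
      rw [Set.ncard_singleton] at h2
      omega
    · rw [hS.isolatedTriples_eq_empty hpoly, Set.ncard_empty]
  · rintro ⟨h3, hS, hH⟩
    obtain ⟨a, b, c, h⟩ := hpoly.exists_primTri hdim h3
    refine Set.ncard_eq_one.2 ⟨{a, b, c}, Set.eq_singleton_iff_unique_mem.2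
      ⟨⟨a, b, c, h.left_mem, h.mid_mem, h.right_mem, rfl, h.isolated, h.not_emptyTri hpoly hS⟩,
        fun m hm => ?_⟩⟩
    rcases exists_primTri_of_mem_isolatedTriples hA hpoly.finite hm with
      ⟨x, y, z, h', rfl⟩ | ⟨o, u, w, g, hg, h'⟩
    · exact h'.multiset_eq h.left_mem h.mid_mem h.right_mem h.inTri
    · exact absurd (h'.isHyperelliptic hpoly hg) hH
  · rintro ⟨h3, hS, hH⟩
    obtain ⟨a, b, c, h⟩ := hpoly.exists_primTri hdim h3
    obtain ⟨hI, p, hp, q, hq, hpq⟩ := isHyperelliptic_iff.1 hH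
    rw [h.latticePts_interior hpoly] at hI hp hq
    obtain ⟨o, u, w, g, hg, h'⟩ := h.exists_hypNormal hA (h.not_emptyTri hpoly hS) hp hq hpq
      (hI p hp q hq)
    rw [h'.ncard_isolatedTriples hA, h'.ncard_eq (by omega), Nat.add_sub_cancel]
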